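/- Let m ∈ {1,2} and let n ∈ ℕ with 3 ∣ n. Then H_{2,m,3}(n) = −( ∑_{d∣n, d²<n} d³ − ∑_{d∣n, d²<n, 3∣d, 3∣(n/d)} d³ ) + n·(σ(n) − σ(n/3)) − (n/2)·∑_{d∣n} min(d, n/d) + 3n·δ_{9∣n}·∑_{d∣(n/9), d²<n/9} d + (n^{3/2}/2)·δ_{n=□}. -/

import Mathlib

open scoped BigOperators

namespace HurwitzPaper

/-- Evaluation of the binary quadratic form `(a,b,c)` (i.e. `a x² + b x y + c y²`). -/
def formEval (Q : ℤ × ℤ × ℤ) (x y : ℤ) : ℤ :=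
  Q.1 * x ^ 2 + Q.2.1 * x * y + Q.2.2 * y ^ 2

/-- Discriminant `b² - 4ac` of the form `(a,b,c)`. -/
def formDisc (Q : ℤ × ℤ × ℤ) : ℤ := Q.2.1 ^ 2 - 4 * Q.1 * Q.2.2

/-- Right action of `γ ∈ SL₂(ℤ)` on a binary quadratic form: `(Q∘γ)(x,y) = Q(ax+by, cx+dy)`. -/
def formAct (γ : Matrix.SpecialLinearGroup (Fin 2) ℤ) (Q : ℤ × ℤ × ℤ) : ℤ × ℤ × ℤ :=
  (formEval Q (γ.1 0 0) (γ.1 1 0),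
   formEval Q (γ.1 0 0 + γ.1 0 1) (γ.1 1 0 + γ.1 1 1)
     - formEval Q (γ.1 0 0) (γ.1 1 0) - formEval Q (γ.1 0 1) (γ.1 1 1),
   formEval Q (γ.1 0 1) (γ.1 1 1))

/-- A form is positive definite iff its leading coefficient is positive and its
discriminant is negative. -/
def IsPosDef (Q : ℤ × ℤ × ℤ) : Prop := 0 < Q.1 ∧ formDisc Q < 0

/-- `SL₂(ℤ)`-equivalence classes of positive definite integral binary quadratic forms
of discriminant `-N`. -/
abbrev FormClasses (N : ℤ) :=
  Quot (fun (Q Q' : {Q : ℤ × ℤ × ℤ // formDisc Q = -N ∧ IsPosDef Q}) =>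
    ∃ γ : Matrix.SpecialLinearGroup (Fin 2) ℤ, formAct γ Q.1 = Q'.1)

/-- The Hurwitz class number `H(N)`: each class of positive definite forms of
discriminant `-N` is counted with weight `1/ω_Q = 2/#Γ_Q`, where `Γ_Q` is the stabilizer
of (a representative of) the class in `SL₂(ℤ)`; `H(0) = -1/12`, and `H(N) = 0` when no
such forms exist (in particular for `N < 0` and `N ≡ 1, 2 (mod 4)`). -/
noncomputable def hurwitzClassNumber (N : ℤ) : ℝ :=
  if N = 0 then -(1 / 12)
  else ∑ᶠ c : FormClasses N,
    (2 : ℝ) / (Nat.card {γ : Matrix.SpecialLinearGroup (Fin 2) ℤ //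
      formAct γ c.out.1 = c.out.1})

/-- `H_{κ,m,M}(n) = ∑_{t ≡ m (mod M)} t^κ H(4n - t²)`. -/
noncomputable def HH (κ : ℕ) (m : ℤ) (M : ℕ) (n : ℕ) : ℝ :=
  ∑ᶠ t : ℤ, if t % (M : ℤ) = m % (M : ℤ) then
    (t : ℝ) ^ κ * hurwitzClassNumber (4 * n - t ^ 2) else 0

/-- `a(n)`: the `n`-th Fourier coefficient of `η(3τ)⁸ = q ∏_{k≥1} (1-q^{3k})⁸`
(the factors with `k > n` do not affect the coefficient of `q^n`). -/
noncomputable def etaCoeff (n : ℕ) : ℤ :=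
  Polynomial.coeff (Polynomial.X * ∏ k ∈ Finset.Icc 1 n, (1 - Polynomial.X ^ (3 * k)) ^ 8 : Polynomial ℤ) n


section Helpers
open Finset

lemma tele (G g : ℤ → ℤ) (h : ∀ z, G (z+1) - G z = g z) (a b : ℤ) (hab : a ≤ b) :
    ∑ z ∈ Ico a b, g z = G b - G a := by
  induction b, hab using Int.le_induction with
  | base => simp
  | succ b hb ih =>
    rw [← Finset.insert_Ico_right_eq_Ico_add_one hb, sum_insert (by simp), ih, ← h b]; ring

/-- ordered pairs of positive integers with product n -/
noncomputable def P0 (n : ℤ) : Finset (ℤ × ℤ) :=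
  ((Icc 1 n) ×ˢ (Icc 1 n)).filter (fun q => q.1 * q.2 = n)

noncomputable def P1 (n : ℤ) : Finset (ℤ × ℤ) :=
  (P0 n).filter (fun q => ¬ (3 ∣ q.1 - q.2))

lemma mem_P0 (n x w : ℤ) : (x, w) ∈ P0 n ↔ 0 < x ∧ 0 < w ∧ x * w = n := by
  simp only [P0, mem_filter, mem_product, mem_Icc]
  constructor
  · rintro ⟨⟨⟨h1, _⟩, ⟨h2, _⟩⟩, h5⟩
    exact ⟨by omega, by omega, h5⟩
  · rintro ⟨h1, h2, h5⟩
    refine ⟨⟨⟨by omega, ?_⟩, ⟨by omega, ?_⟩⟩, h5⟩ <;> nlinarith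

lemma mem_P1 (n x w : ℤ) : (x, w) ∈ P1 n ↔ 0 < x ∧ 0 < w ∧ x * w = n ∧ ¬ (3 ∣ x - w) := by
  simp only [P1, mem_filter, mem_P0]; tauto

lemma P0_swap (n : ℤ) (f : ℤ → ℤ → ℤ) : ∑ q ∈ P0 n, f q.1 q.2 = ∑ q ∈ P0 n, f q.2 q.1 := by
  refine sum_nbij' (fun q => (q.2, q.1)) (fun q => (q.2, q.1)) ?_ ?_ ?_ ?_ ?_ <;>
  rintro ⟨x, w⟩ h <;> simp only [mem_P0] at h ⊢
  · exact ⟨h.2.1, h.1, by linarith [h.2.2]⟩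
  · exact ⟨h.2.1, h.1, by linarith [h.2.2]⟩

lemma P1_swap (n : ℤ) (f : ℤ → ℤ → ℤ) : ∑ q ∈ P1 n, f q.1 q.2 = ∑ q ∈ P1 n, f q.2 q.1 := by
  refine sum_nbij' (fun q => (q.2, q.1)) (fun q => (q.2, q.1)) ?_ ?_ ?_ ?_ ?_ <;>
  rintro ⟨x, w⟩ h <;> simp only [mem_P1] at h ⊢
  · exact ⟨h.2.1, h.1, by linarith [h.2.2], by omega⟩
  · exact ⟨h.2.1, h.1, by linarith [h.2.2], by omega⟩

/-- parity-restricted quadratic sum -/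
lemma parsum (A B w : ℤ) (hw : 0 < w) :
    6 * ∑ z ∈ (Ico 1 w).filter (fun z => z % 2 = w % 2), (A + B * z^2) =
      3 * A * (w - 1 - if w % 2 = 0 then 1 else 0) + B * (w * (w - 1) * (w - 2)) := by
  rw [sum_filter, mul_sum]
  rw [tele (fun Z => if Z % 2 = w % 2 then 3 * A * Z + B * (Z * (Z-1) * (Z-2))
    else 3 * A * (Z+1) + B * ((Z+1) * Z * (Z-1))) _ ?_ 1 w (by omega)]
  · by_cases h : w % 2 = 0
    · have : ¬ ((1:ℤ) % 2 = w % 2) := by omega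
      simp only [h, this, if_true, if_false]; split_ifs <;> first | omega | ring
    · have : ((1:ℤ) % 2 = w % 2) := by omega
      simp only [h, this, if_true, if_false]; ring
  · intro z
    by_cases h : z % 2 = w % 2
    · have : ¬ ((z+1) % 2 = w % 2) := by omega
      simp only [h, this, if_true, if_false]; ring
    · have : ((z+1) % 2 = w % 2) := by omega
      simp only [h, this, if_true, if_false]; ring

lemma parsum3 (A B w : ℤ) (hw : 0 < w) :
    2 * ∑ z ∈ (Ico 1 (3*w)).filter (fun z => z % 2 = w % 2 ∧ ¬ 3 ∣ z), (A + B * z^2) =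
      2 * A * w + B * (6 * w^3 - 4 * w) := by
  have h1 := parsum A B (3*w) (by omega)
  have h2 := parsum A (9*B) w hw
  have e : ∑ z ∈ (Ico 1 (3*w)).filter (fun z => z % 2 = (3*w) % 2), (A + B * z^2) =
     ∑ z ∈ (Ico 1 (3*w)).filter (fun z => z % 2 = w % 2 ∧ ¬ 3 ∣ z), (A + B * z^2)
     + ∑ z ∈ (Ico 1 w).filter (fun z => z % 2 = w % 2), (A + 9 * B * z^2) := by
    have e2 : ∑ z ∈ (Ico 1 w).filter (fun z => z % 2 = w % 2), (A + 9 * B * z^2) =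
       ∑ z ∈ (Ico 1 (3*w)).filter (fun z => z % 2 = w % 2 ∧ 3 ∣ z), (A + B * z^2) := by
      refine sum_nbij' (fun z => 3 * z) (fun z => z / 3) ?_ ?_ ?_ ?_ ?_ <;>
      intro z h <;> simp only [mem_filter, mem_Ico] at h ⊢ <;> first | omega | ring
    rw [e2]
    simp only [sum_filter, ← sum_add_distrib]
    refine sum_congr rfl fun z _ => ?_
    split_ifs <;> first | omega | simp
  have : (3 * w) % 2 = w % 2 := by omega
  rw [e, this] at h1
  split_ifs at h1 h2 <;> linarith

/-- positive quadruples (x,C,c,X) with xC+3cX=n and 3 not dividing x-C -/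
noncomputable def PP (n : ℤ) : Finset (ℤ × ℤ × ℤ × ℤ) :=
  ((Icc 1 n) ×ˢ (Icc 1 n) ×ˢ (Icc 1 n) ×ˢ (Icc 1 n)).filter
    (fun q => q.1 * q.2.1 + 3 * q.2.2.1 * q.2.2.2 = n ∧ ¬ (3 ∣ q.1 - q.2.1))

lemma mem_PP (n x C c X : ℤ) : (x, C, c, X) ∈ PP n ↔
    0 < x ∧ 0 < C ∧ 0 < c ∧ 0 < X ∧ x * C + 3 * c * X = n ∧ ¬ (3 ∣ x - C) := by
  simp only [PP, mem_filter, mem_product, mem_Icc]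
  constructor
  · rintro ⟨⟨⟨h1, _⟩, ⟨h2, _⟩, ⟨h3, _⟩, ⟨h4, _⟩⟩, h5, h6⟩
    exact ⟨by omega, by omega, by omega, by omega, h5, h6⟩
  · rintro ⟨h1, h2, h3, h4, h5, h6⟩
    have a1 : 0 < x * C := mul_pos h1 h2
    have a2 : 0 < c * X := mul_pos h3 h4
    refine ⟨⟨⟨by omega, ?_⟩, ⟨by omega, ?_⟩, ⟨by omega, ?_⟩, ⟨by omega, ?_⟩⟩, h5, h6⟩ <;> nlinarith

lemma PP_swap (n : ℤ) (p : ℤ → ℤ → Prop) [∀ a b, Decidable (p a b)] (f : ℤ → ℤ → ℤ) :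
    ∑ q ∈ (PP n).filter (fun q => p q.2.1 q.2.2.2), f q.1 q.2.2.1 =
    ∑ q ∈ (PP n).filter (fun q => p q.1 q.2.2.1), f q.2.1 q.2.2.2 := by
  refine sum_nbij' (fun q => (q.2.1, q.1, q.2.2.2, q.2.2.1)) (fun q => (q.2.1, q.1, q.2.2.2, q.2.2.1))
    ?_ ?_ ?_ ?_ ?_
  · rintro ⟨x, C, c, X⟩ h
    simp only [mem_filter, mem_PP] at h ⊢
    obtain ⟨⟨h1, h2, h3, h4, h5, h6⟩, h7⟩ := h
    exact ⟨⟨h2, h1, h4, h3, by linarith, by omega⟩, h7⟩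
  · rintro ⟨x, C, c, X⟩ h
    simp only [mem_filter, mem_PP] at h ⊢
    obtain ⟨⟨h1, h2, h3, h4, h5, h6⟩, h7⟩ := h
    exact ⟨⟨h2, h1, h4, h3, by linarith, by omega⟩, h7⟩
  · rintro ⟨x, C, c, X⟩ h; rfl
  · rintro ⟨x, C, c, X⟩ h; rfl
  · rintro ⟨x, C, c, X⟩ h; rfl

def ff (x c : ℤ) : ℤ := x^2 - 3*x*c + 3*c^2
def gg (x c : ℤ) : ℤ := x^2 + 3*x*c + 3*c^2

lemma mv1 (n : ℤ) : ∑ q ∈ (PP n).filter (fun q => 3 * q.2.2.1 < q.1), ff q.1 q.2.2.1 =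
    ∑ q ∈ (PP n).filter (fun q => q.2.1 < q.2.2.2), gg q.1 q.2.2.1 := by
  refine sum_nbij' (fun q => (q.1 - 3*q.2.2.1, q.2.1, q.2.2.1, q.2.2.2 + q.2.1))
    (fun q => (q.1 + 3*q.2.2.1, q.2.1, q.2.2.1, q.2.2.2 - q.2.1)) ?_ ?_ ?_ ?_ ?_ <;>
  rintro ⟨x, C, c, X⟩ h <;> simp only [mem_filter, mem_PP, ff, gg, Prod.mk.injEq] at h ⊢
  · obtain ⟨⟨h1, h2, h3, h4, h5, h6⟩, h7⟩ := h
    refine ⟨⟨by omega, by omega, by omega, by omega, by linarith, by omega⟩, by omega⟩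
  · obtain ⟨⟨h1, h2, h3, h4, h5, h6⟩, h7⟩ := h
    refine ⟨⟨by omega, by omega, by omega, by omega, by linarith, by omega⟩, by omega⟩
  · refine ⟨?_, ?_, ?_, ?_⟩ <;> first | trivial | omega
  · refine ⟨?_, ?_, ?_, ?_⟩ <;> first | trivial | omega
  · ring

lemma mv5 (n : ℤ) : ∑ q ∈ (PP n).filter (fun q => q.1 < q.2.2.1), ff q.1 q.2.2.1 =
    ∑ q ∈ (PP n).filter (fun q => 3 * q.2.2.2 < q.2.1), gg q.1 q.2.2.1 := by
  refine sum_nbij' (fun q => (q.1, q.2.1 + 3*q.2.2.2, q.2.2.1 - q.1, q.2.2.2))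
    (fun q => (q.1, q.2.1 - 3*q.2.2.2, q.2.2.1 + q.1, q.2.2.2)) ?_ ?_ ?_ ?_ ?_ <;>
  rintro ⟨x, C, c, X⟩ h <;> simp only [mem_filter, mem_PP, ff, gg, Prod.mk.injEq] at h ⊢
  · obtain ⟨⟨h1, h2, h3, h4, h5, h6⟩, h7⟩ := h
    refine ⟨⟨by omega, by omega, by omega, by omega, by linarith, by omega⟩, by omega⟩
  · obtain ⟨⟨h1, h2, h3, h4, h5, h6⟩, h7⟩ := h
    refine ⟨⟨by omega, by omega, by omega, by omega, by linarith, by omega⟩, by omega⟩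
  · refine ⟨?_, ?_, ?_, ?_⟩ <;> first | trivial | omega
  · refine ⟨?_, ?_, ?_, ?_⟩ <;> first | trivial | omega
  · ring

lemma mv4 (n : ℤ) : ∑ q ∈ (PP n).filter (fun q => 2 * q.2.2.1 < q.1 ∧ q.1 < 3 * q.2.2.1), ff q.1 q.2.2.1 =
    ∑ q ∈ (PP n).filter (fun q => 2 * q.2.2.2 < q.2.1 ∧ q.2.1 < 3 * q.2.2.2), gg q.1 q.2.2.1 := by
  refine sum_nbij' (fun q => (3*q.2.2.1 - q.1, 3*q.2.2.2 + 2*q.2.1, q.1 - 2*q.2.2.1, q.2.2.2 + q.2.1))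
    (fun q => (2*q.1 + 3*q.2.2.1, 3*q.2.2.2 - q.2.1, q.1 + q.2.2.1, q.2.1 - 2*q.2.2.2)) ?_ ?_ ?_ ?_ ?_ <;>
  rintro ⟨x, C, c, X⟩ h <;> simp only [mem_filter, mem_PP, ff, gg, Prod.mk.injEq] at h ⊢
  · obtain ⟨⟨h1, h2, h3, h4, h5, h6⟩, h7⟩ := h
    refine ⟨⟨by omega, by omega, by omega, by omega, by linarith, by omega⟩, by omega⟩
  · obtain ⟨⟨h1, h2, h3, h4, h5, h6⟩, h7⟩ := h
    refine ⟨⟨by omega, by omega, by omega, by omega, by linarith, by omega⟩, by omega⟩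
  · refine ⟨?_, ?_, ?_, ?_⟩ <;> first | trivial | omega
  · refine ⟨?_, ?_, ?_, ?_⟩ <;> first | trivial | omega
  · ring

lemma mv3 (n : ℤ) : ∑ q ∈ (PP n).filter (fun q => 3 * q.2.2.1 < 2 * q.1 ∧ q.1 < 2 * q.2.2.1), ff q.1 q.2.2.1 =
    ∑ q ∈ (PP n).filter (fun q => 3 * q.2.2.2 < 2 * q.2.1 ∧ q.2.1 < 2 * q.2.2.2), gg q.1 q.2.2.1 := by
  refine sum_nbij' (fun q => (2*q.1 - 3*q.2.2.1, 3*q.2.2.2 + 2*q.2.1, 2*q.2.2.1 - q.1, 2*q.2.2.2 + q.2.1))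
    (fun q => (2*q.1 + 3*q.2.2.1, 2*q.2.1 - 3*q.2.2.2, q.1 + 2*q.2.2.1, 2*q.2.2.2 - q.2.1)) ?_ ?_ ?_ ?_ ?_ <;>
  rintro ⟨x, C, c, X⟩ h <;> simp only [mem_filter, mem_PP, ff, gg, Prod.mk.injEq] at h ⊢
  · obtain ⟨⟨h1, h2, h3, h4, h5, h6⟩, h7⟩ := h
    refine ⟨⟨by omega, by omega, by omega, by omega, by linarith, by omega⟩, by omega⟩
  · obtain ⟨⟨h1, h2, h3, h4, h5, h6⟩, h7⟩ := h
    refine ⟨⟨by omega, by omega, by omega, by omega, by linarith, by omega⟩, by omega⟩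
  · refine ⟨?_, ?_, ?_, ?_⟩ <;> first | trivial | omega
  · refine ⟨?_, ?_, ?_, ?_⟩ <;> first | trivial | omega
  · ring

lemma mv2 (n : ℤ) : ∑ q ∈ (PP n).filter (fun q => q.2.2.1 < q.1 ∧ 2 * q.1 < 3 * q.2.2.1), ff q.1 q.2.2.1 =
    ∑ q ∈ (PP n).filter (fun q => q.2.2.2 < q.2.1 ∧ 2 * q.2.1 < 3 * q.2.2.2), gg q.1 q.2.2.1 := by
  refine sum_nbij' (fun q => (3*q.2.2.1 - 2*q.1, 3*q.2.2.2 + q.2.1, q.1 - q.2.2.1, 2*q.2.2.2 + q.2.1))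
    (fun q => (q.1 + 3*q.2.2.1, 3*q.2.2.2 - 2*q.2.1, q.1 + 2*q.2.2.1, q.2.1 - q.2.2.2)) ?_ ?_ ?_ ?_ ?_ <;>
  rintro ⟨x, C, c, X⟩ h <;> simp only [mem_filter, mem_PP, ff, gg, Prod.mk.injEq] at h ⊢
  · obtain ⟨⟨h1, h2, h3, h4, h5, h6⟩, h7⟩ := h
    refine ⟨⟨by omega, by omega, by omega, by omega, by linarith, by omega⟩, by omega⟩
  · obtain ⟨⟨h1, h2, h3, h4, h5, h6⟩, h7⟩ := h
    refine ⟨⟨by omega, by omega, by omega, by omega, by linarith, by omega⟩, by omega⟩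
  · refine ⟨?_, ?_, ?_, ?_⟩ <;> first | trivial | omega
  · refine ⟨?_, ?_, ?_, ?_⟩ <;> first | trivial | omega
  · ring

lemma split9 (s : Finset (ℤ × ℤ × ℤ × ℤ)) (u v : ℤ × ℤ × ℤ × ℤ → ℤ) (hv : ∀ q ∈ s, 0 < v q)
    (f : ℤ × ℤ × ℤ × ℤ → ℤ) :
    ∑ q ∈ s, f q = ∑ q ∈ s.filter (fun q => u q < v q), f q
      + ∑ q ∈ s.filter (fun q => v q < u q ∧ 2 * u q < 3 * v q), f q
      + ∑ q ∈ s.filter (fun q => 3 * v q < 2 * u q ∧ u q < 2 * v q), f q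
      + ∑ q ∈ s.filter (fun q => 2 * v q < u q ∧ u q < 3 * v q), f q
      + ∑ q ∈ s.filter (fun q => 3 * v q < u q), f q
      + ∑ q ∈ s.filter (fun q => u q = v q), f q
      + ∑ q ∈ s.filter (fun q => 2 * u q = 3 * v q), f q
      + ∑ q ∈ s.filter (fun q => u q = 2 * v q), f q
      + ∑ q ∈ s.filter (fun q => u q = 3 * v q), f q := by
  simp only [sum_filter, ← sum_add_distrib]
  refine sum_congr rfl fun q hq => ?_
  have := hv q hq
  split_ifs <;> first | omega | simp

lemma Z_faces (n : ℤ) : -6 * ∑ q ∈ PP n, q.1 * q.2.2.1 =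
      ∑ q ∈ (PP n).filter (fun q => q.1 = q.2.2.1), (ff q.1 q.2.2.1 - gg q.2.1 q.2.2.2)
    + ∑ q ∈ (PP n).filter (fun q => 2 * q.1 = 3 * q.2.2.1), (ff q.1 q.2.2.1 - gg q.2.1 q.2.2.2)
    + ∑ q ∈ (PP n).filter (fun q => q.1 = 2 * q.2.2.1), (ff q.1 q.2.2.1 - gg q.2.1 q.2.2.2)
    + ∑ q ∈ (PP n).filter (fun q => q.1 = 3 * q.2.2.1), (ff q.1 q.2.2.1 - gg q.2.1 q.2.2.2) := by
  have e1 := split9 (PP n) (fun q => q.1) (fun q => q.2.2.1)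
    (by rintro ⟨x, C, c, X⟩ h; rw [mem_PP] at h; exact h.2.2.1) (fun q => ff q.1 q.2.2.1)
  have e2 := split9 (PP n) (fun q => q.2.1) (fun q => q.2.2.2)
    (by rintro ⟨x, C, c, X⟩ h; rw [mem_PP] at h; exact h.2.2.2.1) (fun q => gg q.1 q.2.2.1)
  beta_reduce at e1 e2
  have m1 := mv1 n
  have m2 := mv2 n
  have m3 := mv3 n
  have m4 := mv4 n
  have m5 := mv5 n
  have s1 := PP_swap n (fun a b => a = b) gg
  have s2 := PP_swap n (fun a b => 2 * a = 3 * b) gg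
  have s3 := PP_swap n (fun a b => a = 2 * b) gg
  have s4 := PP_swap n (fun a b => a = 3 * b) gg
  have e3 : ∑ q ∈ PP n, ff q.1 q.2.2.1 - ∑ q ∈ PP n, gg q.1 q.2.2.1 = -6 * ∑ q ∈ PP n, q.1 * q.2.2.1 := by
    rw [← sum_sub_distrib, mul_sum]
    refine sum_congr rfl fun q _ => ?_
    simp only [ff, gg]; ring
  simp only [sum_sub_distrib]
  rw [← e3, e1, e2]
  linarith

lemma face1 (n : ℤ) :
   4 * ∑ q ∈ (PP n).filter (fun q => q.1 = q.2.2.1), (ff q.1 q.2.2.1 - gg q.2.1 q.2.2.2) =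
   ∑ p ∈ P1 n, ∑ z ∈ (Ico 1 p.2).filter (fun z => z % 2 = p.2 % 2 ∧ p.2 < 3 * z), (4 * p.1^2 - p.2^2 - 3 * z^2) := by
  rw [mul_sum, sum_sigma']
  refine sum_nbij' (fun q => ⟨(q.1, q.2.1 + 3 * q.2.2.2), q.2.1 + q.2.2.2⟩)
    (fun s => (s.1.1, (3 * s.2 - s.1.2)/2, s.1.1, (s.1.2 - s.2)/2)) ?_ ?_ ?_ ?_ ?_
  · rintro ⟨x, C, c, X⟩ h
    simp only [mem_filter, mem_PP, mem_sigma, mem_P1, mem_Ico] at h ⊢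
    obtain ⟨⟨h1, h2, h3, h4, h5, h6⟩, h7⟩ := h
    subst h7
    exact ⟨⟨h1, by omega, by linarith, by omega⟩, ⟨by omega, by omega⟩, by omega, by omega⟩
  · rintro ⟨⟨c, w⟩, z⟩ h
    simp only [mem_filter, mem_PP, mem_sigma, mem_P1, mem_Ico] at h ⊢
    obtain ⟨⟨h1, h2, h3, h4⟩, ⟨h5, h6⟩, h7, h8⟩ := h
    obtain ⟨X, hX⟩ : ∃ X, w = z + 2 * X := ⟨(w - z)/2, by omega⟩
    subst hX
    have e1 : (3 * z - (z + 2 * X)) / 2 = z - X := by omega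
    have e2 : (z + 2 * X - z) / 2 = X := by omega
    rw [e1, e2]
    exact ⟨⟨by omega, by omega, by omega, by omega, by linarith, by omega⟩, by trivial⟩
  · rintro ⟨x, C, c, X⟩ h
    simp only [mem_filter, mem_PP, Prod.mk.injEq] at h ⊢
    obtain ⟨⟨h1, h2, h3, h4, h5, h6⟩, h7⟩ := h
    first | trivial | (refine ⟨?_, ?_, ?_, ?_⟩ <;> first | trivial | omega)
  · rintro ⟨⟨c, w⟩, z⟩ h
    simp only [mem_filter, mem_sigma, mem_P1, mem_Ico] at h
    have e1 : (3 * z - w) / 2 + 3 * ((w - z) / 2) = w := by omega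
    have e2 : (3 * z - w) / 2 + ((w - z) / 2) = z := by omega
    simp only [e1, e2]
  · rintro ⟨x, C, c, X⟩ h
    simp only [mem_filter] at h
    simp only [h.2, ff, gg]; ring

lemma face2 (n : ℤ) :
   4 * ∑ q ∈ (PP n).filter (fun q => q.1 = 2 * q.2.2.1), (ff q.1 q.2.2.1 - gg q.2.1 q.2.2.2) =
   ∑ p ∈ P1 n, ∑ z ∈ (Ico 1 p.2).filter (fun z => z % 2 = p.2 % 2 ∧ 3 * z < p.2), (4 * p.1^2 - p.2^2 - 3 * z^2) := by
  rw [mul_sum, sum_sigma']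
  refine sum_nbij' (fun q => ⟨(q.2.2.1, 2 * q.2.1 + 3 * q.2.2.2), q.2.2.2⟩)
    (fun s => (2 * s.1.1, (s.1.2 - 3 * s.2)/2, s.1.1, s.2)) ?_ ?_ ?_ ?_ ?_
  · rintro ⟨x, C, c, X⟩ h
    simp only [mem_filter, mem_PP, mem_sigma, mem_P1, mem_Ico] at h ⊢
    obtain ⟨⟨h1, h2, h3, h4, h5, h6⟩, h7⟩ := h
    subst h7
    exact ⟨⟨by omega, by omega, by linarith, by omega⟩, ⟨by omega, by omega⟩, by omega, by omega⟩
  · rintro ⟨⟨c, w⟩, z⟩ h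
    simp only [mem_filter, mem_PP, mem_sigma, mem_P1, mem_Ico] at h ⊢
    obtain ⟨⟨h1, h2, h3, h4⟩, ⟨h5, h6⟩, h7, h8⟩ := h
    obtain ⟨X, hX⟩ : ∃ X, w = 3 * z + 2 * X := ⟨(w - 3 * z)/2, by omega⟩
    subst hX
    have e1 : (3 * z + 2 * X - 3 * z) / 2 = X := by omega
    rw [e1]
    exact ⟨⟨by omega, by omega, by omega, by omega, by linarith, by omega⟩, by trivial⟩
  · rintro ⟨x, C, c, X⟩ h
    simp only [mem_filter, mem_PP, Prod.mk.injEq] at h ⊢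
    obtain ⟨⟨h1, h2, h3, h4, h5, h6⟩, h7⟩ := h
    refine ⟨?_, ?_, by trivial⟩ <;> omega
  · rintro ⟨⟨c, w⟩, z⟩ h
    simp only [mem_filter, mem_sigma, mem_P1, mem_Ico] at h
    have e1 : 2 * ((w - 3 * z) / 2) + 3 * z = w := by omega
    simp only [e1]
  · rintro ⟨x, C, c, X⟩ h
    simp only [mem_filter] at h
    simp only [h.2, ff, gg]; ring

lemma face3 (n N : ℤ) (hN : n = 3 * N) :
   4 * ∑ q ∈ (PP n).filter (fun q => q.1 = 3 * q.2.2.1), (ff q.1 q.2.2.1 - gg q.2.1 q.2.2.2) =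
   ∑ p ∈ P0 N, ∑ z ∈ (Ico 1 (3 * p.2)).filter (fun z => (z % 2 = p.2 % 2 ∧ ¬ 3 ∣ z) ∧ p.2 < z), (12 * p.1^2 - 3 * p.2^2 - z^2) := by
  rw [mul_sum, sum_sigma']
  refine sum_nbij' (fun q => ⟨(q.2.2.1, q.2.1 + q.2.2.2), q.2.1 + 3 * q.2.2.2⟩)
    (fun s => (3 * s.1.1, (3 * s.1.2 - s.2)/2, s.1.1, (s.2 - s.1.2)/2)) ?_ ?_ ?_ ?_ ?_
  · rintro ⟨x, C, c, X⟩ h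
    simp only [mem_filter, mem_PP, mem_sigma, mem_P0, mem_Ico] at h ⊢
    obtain ⟨⟨h1, h2, h3, h4, h5, h6⟩, h7⟩ := h
    subst h7
    exact ⟨⟨by omega, by omega, by linarith⟩, ⟨by omega, by omega⟩, by omega, by omega⟩
  · rintro ⟨⟨c, w⟩, z⟩ h
    simp only [mem_filter, mem_PP, mem_sigma, mem_P0, mem_Ico] at h ⊢
    obtain ⟨⟨h1, h2, h3⟩, ⟨h5, h6⟩, h7, h8⟩ := h
    obtain ⟨X, hX⟩ : ∃ X, z = w + 2 * X := ⟨(z - w)/2, by omega⟩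
    subst hX
    have e1 : (3 * w - (w + 2 * X)) / 2 = w - X := by omega
    have e2 : (w + 2 * X - w) / 2 = X := by omega
    rw [e1, e2]
    exact ⟨⟨by omega, by omega, by omega, by omega, by linarith, by omega⟩, by trivial⟩
  · rintro ⟨x, C, c, X⟩ h
    simp only [mem_filter, mem_PP, Prod.mk.injEq] at h ⊢
    obtain ⟨⟨h1, h2, h3, h4, h5, h6⟩, h7⟩ := h
    first | trivial | (refine ⟨?_, ?_, ?_, ?_⟩ <;> first | trivial | omega)
  · rintro ⟨⟨c, w⟩, z⟩ h
    simp only [mem_filter, mem_sigma, mem_P0, mem_Ico] at h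
    have e1 : (3 * w - z) / 2 + ((z - w) / 2) = w := by omega
    have e2 : (3 * w - z) / 2 + 3 * ((z - w) / 2) = z := by omega
    simp only [e1, e2]
  · rintro ⟨x, C, c, X⟩ h
    simp only [mem_filter] at h
    simp only [h.2, ff, gg]; ring

lemma face4 (n N : ℤ) (hN : n = 3 * N) :
   4 * ∑ q ∈ (PP n).filter (fun q => 2 * q.1 = 3 * q.2.2.1), (ff q.1 q.2.2.1 - gg q.2.1 q.2.2.2) =
   ∑ p ∈ P0 N, ∑ z ∈ (Ico 1 (3 * p.2)).filter (fun z => (z % 2 = p.2 % 2 ∧ ¬ 3 ∣ z) ∧ z < p.2), (12 * p.1^2 - 3 * p.2^2 - z^2) := by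
  rw [mul_sum, sum_sigma']
  refine sum_nbij' (fun q => ⟨(q.2.2.1 / 2, q.2.1 + 2 * q.2.2.2), q.2.1⟩)
    (fun s => (3 * s.1.1, s.2, 2 * s.1.1, (s.1.2 - s.2)/2)) ?_ ?_ ?_ ?_ ?_
  · rintro ⟨x, C, c, X⟩ h
    simp only [mem_filter, mem_PP, mem_sigma, mem_P0, mem_Ico] at h ⊢
    obtain ⟨⟨h1, h2, h3, h4, h5, h6⟩, h7⟩ := h
    obtain ⟨e, rfl⟩ : ∃ e, c = 2 * e := ⟨c / 2, by omega⟩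
    obtain rfl : x = 3 * e := by omega
    have : 2 * e / 2 = e := by omega
    rw [this]
    exact ⟨⟨by omega, by omega, by linarith⟩, ⟨by omega, by omega⟩, by omega, by omega⟩
  · rintro ⟨⟨c, w⟩, z⟩ h
    simp only [mem_filter, mem_PP, mem_sigma, mem_P0, mem_Ico] at h ⊢
    obtain ⟨⟨h1, h2, h3⟩, ⟨h5, h6⟩, h7, h8⟩ := h
    obtain ⟨X, hX⟩ : ∃ X, w = z + 2 * X := ⟨(w - z)/2, by omega⟩
    subst hX
    have e2 : (z + 2 * X - z) / 2 = X := by omega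
    rw [e2]
    exact ⟨⟨by omega, by omega, by omega, by omega, by linarith, by omega⟩, by ring⟩
  · rintro ⟨x, C, c, X⟩ h
    simp only [mem_filter, mem_PP, Prod.mk.injEq] at h ⊢
    obtain ⟨⟨h1, h2, h3, h4, h5, h6⟩, h7⟩ := h
    first | trivial | (refine ⟨?_, ?_, ?_, ?_⟩ <;> first | trivial | omega)
  · rintro ⟨⟨c, w⟩, z⟩ h
    simp only [mem_filter, mem_sigma, mem_P0, mem_Ico] at h
    have e1 : z + 2 * ((w - z) / 2) = w := by omega
    have e2 : 2 * c / 2 = c := by omega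
    simp only [e1, e2]
  · rintro ⟨x, C, c, X⟩ h
    simp only [mem_filter] at h
    obtain ⟨e, rfl⟩ : ∃ e, c = 2 * e := ⟨c / 2, by omega⟩
    obtain rfl : x = 3 * e := by omega
    have : 2 * e / 2 = e := by omega
    simp only [this, ff, gg]; ring

/-- the excluded diagonal terms cancel -/
lemma excl (n N : ℤ) (hN : n = 3 * N) :
   ∑ p ∈ P1 n, ∑ z ∈ (Ico 1 p.2).filter (fun z => z % 2 = p.2 % 2 ∧ 3 * z = p.2), (4 * p.1^2 - p.2^2 - 3 * z^2) =
   - ∑ p ∈ P0 N, ∑ z ∈ (Ico 1 (3 * p.2)).filter (fun z => (z % 2 = p.2 % 2 ∧ ¬ 3 ∣ z) ∧ z = p.2), (12 * p.1^2 - 3 * p.2^2 - z^2) := by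
  rw [sum_sigma', sum_sigma', ← sum_neg_distrib]
  refine sum_nbij' (fun s => ⟨(s.2, s.1.1), s.1.1⟩) (fun s => ⟨(s.1.2, 3 * s.1.1), s.1.1⟩) ?_ ?_ ?_ ?_ ?_
  · rintro ⟨⟨c, w⟩, z⟩ h
    simp only [mem_filter, mem_sigma, mem_P0, mem_P1, mem_Ico] at h ⊢
    obtain ⟨⟨h1, h2, h3, h4⟩, ⟨h5, h6⟩, h7, rfl⟩ := h
    exact ⟨⟨by omega, by omega, by linarith⟩, ⟨by omega, by omega⟩, by first | exact ⟨by trivial, by omega⟩ | (simp; omega)⟩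
  · rintro ⟨⟨c, w⟩, z⟩ h
    simp only [mem_filter, mem_sigma, mem_P0, mem_P1, mem_Ico] at h ⊢
    obtain ⟨⟨h1, h2, h3⟩, ⟨h5, h6⟩, h7, h8⟩ := h
    exact ⟨⟨by omega, by omega, by linarith, by omega⟩, ⟨by omega, by omega⟩, by omega, by trivial⟩
  · rintro ⟨⟨c, w⟩, z⟩ h
    simp only [mem_filter, mem_sigma] at h
    simp [h.2.2.2]
  · rintro ⟨⟨c, w⟩, z⟩ h
    simp only [mem_filter, mem_sigma] at h
    simp [h.2.2.2]
  · rintro ⟨⟨c, w⟩, z⟩ h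
    simp only [mem_filter, mem_sigma] at h
    simp only [← h.2.2.2]; ring

lemma par_cancel (n : ℤ) : ∑ p ∈ P1 n, (if p.2 % 2 = 0 then 4 * p.1^2 - p.2^2 else 0) = 0 := by
  have : ∑ p ∈ P1 n, (if p.2 % 2 = 0 then 4 * p.1^2 - p.2^2 else 0) =
     ∑ p ∈ P1 n, -(if p.2 % 2 = 0 then 4 * p.1^2 - p.2^2 else 0) := by
    rw [sum_neg_distrib, ← sum_filter, ← sum_neg_distrib]
    refine sum_nbij' (fun q => (q.2/2, 2 * q.1)) (fun q => (q.2/2, 2 * q.1)) ?_ ?_ ?_ ?_ ?_ <;>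
    rintro ⟨x, w⟩ h <;> simp only [mem_filter, mem_P1, Prod.mk.injEq] at h ⊢
    · obtain ⟨⟨h1, h2, h3, h4⟩, h5⟩ := h
      obtain ⟨v, rfl⟩ : ∃ v, w = 2 * v := ⟨w/2, by omega⟩
      have : 2 * v / 2 = v := by omega
      rw [this]
      exact ⟨⟨by omega, by omega, by linarith, by omega⟩, by omega⟩
    · obtain ⟨⟨h1, h2, h3, h4⟩, h5⟩ := h
      obtain ⟨v, rfl⟩ : ∃ v, w = 2 * v := ⟨w/2, by omega⟩
      have : 2 * v / 2 = v := by omega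
      rw [this]
      exact ⟨⟨by omega, by omega, by linarith, by omega⟩, by omega⟩
    · omega
    · omega
    · obtain ⟨⟨h1, h2, h3, h4⟩, h5⟩ := h
      obtain ⟨v, rfl⟩ : ∃ v, w = 2 * v := ⟨w/2, by omega⟩
      have : 2 * v / 2 = v := by omega
      rw [this]; ring
  rw [sum_neg_distrib] at this
  linarith

lemma Q1_split (p : ℤ × ℤ) (f : ℤ → ℤ) :
   ∑ z ∈ (Ico 1 p.2).filter (fun z => z % 2 = p.2 % 2), f z =
   ∑ z ∈ (Ico 1 p.2).filter (fun z => z % 2 = p.2 % 2 ∧ p.2 < 3 * z), f z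
   + ∑ z ∈ (Ico 1 p.2).filter (fun z => z % 2 = p.2 % 2 ∧ 3 * z < p.2), f z
   + ∑ z ∈ (Ico 1 p.2).filter (fun z => z % 2 = p.2 % 2 ∧ 3 * z = p.2), f z := by
  simp only [sum_filter, ← sum_add_distrib]
  refine sum_congr rfl fun z _ => ?_
  split_ifs <;> first | omega | simp

lemma Q2_split (p : ℤ × ℤ) (f : ℤ → ℤ) :
   ∑ z ∈ (Ico 1 (3 * p.2)).filter (fun z => z % 2 = p.2 % 2 ∧ ¬ 3 ∣ z), f z =
   ∑ z ∈ (Ico 1 (3 * p.2)).filter (fun z => (z % 2 = p.2 % 2 ∧ ¬ 3 ∣ z) ∧ p.2 < z), f z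
   + ∑ z ∈ (Ico 1 (3 * p.2)).filter (fun z => (z % 2 = p.2 % 2 ∧ ¬ 3 ∣ z) ∧ z < p.2), f z
   + ∑ z ∈ (Ico 1 (3 * p.2)).filter (fun z => (z % 2 = p.2 % 2 ∧ ¬ 3 ∣ z) ∧ z = p.2), f z := by
  simp only [sum_filter, ← sum_add_distrib]
  refine sum_congr rfl fun z _ => ?_
  split_ifs <;> first | omega | simp

theorem Z_eval (n N : ℤ) (hN : n = 3 * N) :
   24 * ∑ q ∈ PP n, q.1 * q.2.2.1 = ∑ p ∈ P1 n, (p.2^3 + p.2 - 2 * n * p.2)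
     + ∑ p ∈ P0 N, (6 * p.2^3 - 12 * N * p.2 - 2 * p.2) := by
  have h0 := Z_faces n
  have f1 := face1 n
  have f2 := face2 n
  have f3 := face3 n N hN
  have f4 := face4 n N hN
  have ex := excl n N hN
  have q1 : ∑ p ∈ P1 n, ∑ z ∈ (Ico 1 p.2).filter (fun z => z % 2 = p.2 % 2), (4 * p.1^2 - p.2^2 - 3 * z^2) = _ :=
    sum_congr rfl fun p _ => Q1_split p (fun z => (4 * p.1^2 - p.2^2 - 3 * z^2))
  have q2 : ∑ p ∈ P0 N, ∑ z ∈ (Ico 1 (3 * p.2)).filter (fun z => z % 2 = p.2 % 2 ∧ ¬ 3 ∣ z), (12 * p.1^2 - 3 * p.2^2 - z^2) = _ :=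
    sum_congr rfl fun p _ => Q2_split p (fun z => (12 * p.1^2 - 3 * p.2^2 - z^2))
  rw [sum_add_distrib, sum_add_distrib] at q1 q2
  have r1 : 2 * ∑ p ∈ P1 n, ∑ z ∈ (Ico 1 p.2).filter (fun z => z % 2 = p.2 % 2), (4 * p.1^2 - p.2^2 - 3 * z^2)
     = ∑ p ∈ P1 n, (4 * n * p.1 - 4 * p.1^2 + 4 * p.2^2 - 2 * p.2^3 - 2 * p.2) := by
    have := par_cancel n
    rw [mul_sum, ← sub_zero (∑ p ∈ P1 n, (4 * n * p.1 - 4 * p.1^2 + 4 * p.2^2 - 2 * p.2^3 - 2 * p.2)), ← this,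
      ← sum_sub_distrib]
    refine sum_congr rfl ?_
    rintro ⟨c, w⟩ h
    rw [mem_P1] at h
    have ps := parsum (4 * c^2 - w^2) (-3) w h.2.1
    simp only [neg_mul, ← sub_eq_add_neg] at ps
    have h3 := h.2.2.1
    subst h3
    simp only
    split_ifs at ps ⊢ <;> linarith
  have r2 : 2 * ∑ p ∈ P0 N, ∑ z ∈ (Ico 1 (3 * p.2)).filter (fun z => z % 2 = p.2 % 2 ∧ ¬ 3 ∣ z), (12 * p.1^2 - 3 * p.2^2 - z^2)
     = ∑ p ∈ P0 N, (24 * N * p.1 - 12 * p.2^3 + 4 * p.2) := by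
    rw [mul_sum]
    refine sum_congr rfl ?_
    rintro ⟨c, w⟩ h
    rw [mem_P0] at h
    have := parsum3 (12 * c^2 - 3 * w^2) (-1) w h.2.1
    simp only [neg_mul, one_mul, ← sub_eq_add_neg] at this
    have h3 := h.2.2
    subst h3
    simp only
    linarith
  have s1 := P1_swap n (fun a b => 4 * n * a - 4 * a^2)
  have s2 := P0_swap N (fun a b => 24 * N * a)
  simp only [sum_add_distrib, sum_sub_distrib, ← mul_sum] at *
  linarith

lemma ge_aux (m k u v f : ℤ) (hm : 0 < m) (hk : |k| < 3 * m) (hu : u ≠ 0) (hv : v ≠ 0)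
    (hf : m * u^2 + k * u * v + 3 * m * v^2 ≤ f) : m < f := by
  obtain ⟨h1, h2⟩ := abs_lt.1 hk
  have hu1 : 0 < |u| := abs_pos.2 hu
  have hv1 : 0 < |v| := abs_pos.2 hv
  have e1 : u^2 = |u|^2 := (sq_abs u).symm
  have e2 : v^2 = |v|^2 := (sq_abs v).symm
  have e3 : |k * u * v| = |k| * (|u| * |v|) := by rw [abs_mul, abs_mul]; ring
  have e4 := neg_abs_le (k * u * v)
  rw [e1, e2] at hf
  set a := |u|
  set b := |v|
  have hab : 0 < a * b := mul_pos hu1 hv1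
  have e5 : |k| * (a * b) ≤ (3 * m - 1) * (a * b) := mul_le_mul_of_nonneg_right (by omega) hab.le
  have e6 : 1 ≤ a^2 - 3 * (a * b) + 3 * b^2 := by
    by_contra hcon
    have : a^2 - 3 * (a * b) + 3 * b^2 ≤ 0 := by omega
    nlinarith [sq_nonneg (2 * a - 3 * b), mul_pos hv1 hv1]
  nlinarith [mul_le_mul_of_nonneg_left e6 hm.le]

lemma grow (k b c c' b' p q r s : ℤ) (hb : |k| < 3 * b) (hc : |k| < 3 * c)
    (hp : p ≠ 0) (hs : s ≠ 0) (hq : q ≠ 0) (hr : r ≠ 0)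
    (e1 : c' = c * p^2 + k * p * r + 3 * b * r^2)
    (e3 : b' = 3 * c * q^2 + k * q * s + b * s^2) : min b c < min b' c' := by
  have h0 := abs_nonneg k
  have hm : 0 < min b c := lt_min (by omega) (by omega)
  have hk : |k| < 3 * min b c := by
    rcases min_choice b c with h | h <;> rw [h] <;> assumption
  have m1 : min b c ≤ b := min_le_left _ _
  have m2 : min b c ≤ c := min_le_right _ _
  set m := min b c
  refine lt_min ?_ ?_
  · refine ge_aux m k s q b' hm hk hs hq ?_
    nlinarith [mul_le_mul_of_nonneg_right m1 (sq_nonneg s), mul_le_mul_of_nonneg_right m2 (sq_nonneg q)]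
  · refine ge_aux m k p r c' hm hk hp hr ?_
    nlinarith [mul_le_mul_of_nonneg_right m2 (sq_nonneg p), mul_le_mul_of_nonneg_right m1 (sq_nonneg r)]

lemma zmod_r : ∀ k b p q r s k' : ZMod 3, k = 1 → k' = 1 → p * s - q * r = 1 →
    k * p * r + b * r^2 = 0 → k' = k * (p * s + q * r) + 2 * b * r * s → r = 0 := by
  intro k b p q r s k' hk hk'
  subst hk hk'
  revert b p q r s
  decide

lemma zcast {a b : ℤ} (h : a = b) : (a : ZMod 3) = (b : ZMod 3) := by rw [h]

lemma mod1_cast {k : ℤ} (h : k % 3 = 1) : (k : ZMod 3) = 1 := by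
  have : (k : ZMod 3) = ((1 : ℤ) : ZMod 3) := (ZMod.intCast_eq_intCast_iff _ _ 3).2 (by simpa [Int.ModEq] using h)
  simpa using this

lemma core_inj (k b c k' b' c' p q r s : ℤ) (hk : k % 3 = 1) (hk' : k' % 3 = 1)
    (hb : |k| < 3 * b) (hc : |k| < 3 * c) (hb' : |k'| < 3 * b') (hc' : |k'| < 3 * c')
    (hd : p * s - q * r = 1)
    (e1 : 3 * c' = 3 * c * p^2 + k * p * r + b * r^2)
    (e2 : k' = 2 * (3 * c) * p * q + k * (p * s + q * r) + 2 * b * r * s)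
    (e3 : b' = 3 * c * q^2 + k * q * s + b * s^2) :
    q = 0 ∧ r = 0 := by
  have h3 : (3 : ZMod 3) = 0 := by decide
  have hr : (r : ZMod 3) = 0 := by
    refine zmod_r k b p q r s k' (mod1_cast hk) (mod1_cast hk') ?_ ?_ ?_
    · have := zcast hd; push_cast at this; exact this
    · have := zcast e1; push_cast at this; rw [h3] at this; linear_combination -this
    · have := zcast e2; push_cast at this; rw [h3] at this; linear_combination this
  rw [ZMod.intCast_zmod_eq_zero_iff_dvd] at hr
  obtain ⟨r, rfl⟩ := hr
  push_cast at *
  have e1' : c' = c * p^2 + k * p * r + 3 * b * r^2 := by linarith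
  obtain ⟨k1, k2⟩ := abs_lt.1 hb
  obtain ⟨k3, k4⟩ := abs_lt.1 hc
  obtain ⟨k5, k6⟩ := abs_lt.1 hb'
  obtain ⟨k7, k8⟩ := abs_lt.1 hc'
  have h0 := abs_nonneg k
  have hb0 : 0 < b := by omega
  have hc0 : 0 < c := by omega
  by_cases hr0 : r = 0
  · subst hr0
    refine ⟨?_, by ring⟩
    simp at *
    rcases Int.mul_eq_one_iff_eq_one_or_neg_one.1 hd with ⟨rfl, rfl⟩ | ⟨rfl, rfl⟩
    · by_contra hq
      rcases lt_or_gt_of_ne hq with h | h <;> nlinarith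
    · by_contra hq
      rcases lt_or_gt_of_ne hq with h | h <;> nlinarith
  · by_cases hq : q = 0
    · subst hq
      exfalso
      simp at *
      rcases Int.mul_eq_one_iff_eq_one_or_neg_one.1 hd with ⟨rfl, rfl⟩ | ⟨rfl, rfl⟩
      · simp at e3 e2
        rcases lt_or_gt_of_ne hr0 with h | h <;> nlinarith
      · simp at e3 e2
        rcases lt_or_gt_of_ne hr0 with h | h <;> nlinarith
    · exfalso
      have hp : p ≠ 0 := by
        rintro rfl
        have : 3 * (q * r) = -1 := by linarith
        omega
      have hs : s ≠ 0 := by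
        rintro rfl
        have : 3 * (q * r) = -1 := by linarith
        omega
      have g1 := grow k b c c' b' p q r s hb hc hp hs hq hr0 e1' e3
      have g2 := grow k' b' c' c b s (-q) (-r) p hb' hc' hs hp (by omega) (by omega) (by
          rw [e2, e1', e3]
          linear_combination (-c * (p * s - q * (3 * r)) - c) * hd) (by
          rw [e2, e1', e3]
          linear_combination (-b * (p * s - q * (3 * r)) - b) * hd)
      omega

abbrev SL := Matrix.SpecialLinearGroup (Fin 2) ℤ

lemma formAct_eq (γ : SL) (A B C : ℤ) : formAct γ (A, B, C) =
    (A * (γ.1 0 0)^2 + B * (γ.1 0 0) * (γ.1 1 0) + C * (γ.1 1 0)^2,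
     2 * A * (γ.1 0 0) * (γ.1 0 1) + B * ((γ.1 0 0) * (γ.1 1 1) + (γ.1 0 1) * (γ.1 1 0)) + 2 * C * (γ.1 1 0) * (γ.1 1 1),
     A * (γ.1 0 1)^2 + B * (γ.1 0 1) * (γ.1 1 1) + C * (γ.1 1 1)^2) := by
  simp only [formAct, formEval, Prod.mk.injEq]
  refine ⟨?_, ?_, ?_⟩ <;> first | trivial | ring

lemma formAct_mul (γ δ : SL) (Q : ℤ × ℤ × ℤ) : formAct (γ * δ) Q = formAct δ (formAct γ Q) := by
  obtain ⟨A, B, C⟩ := Q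
  rw [formAct_eq, formAct_eq, formAct_eq]
  simp only [Matrix.SpecialLinearGroup.coe_mul, Matrix.mul_apply, Fin.sum_univ_two, Prod.mk.injEq]
  refine ⟨by ring, by ring, by ring⟩

lemma formAct_one (Q : ℤ × ℤ × ℤ) : formAct 1 Q = Q := by
  obtain ⟨A, B, C⟩ := Q
  rw [formAct_eq]
  simp

lemma formAct_neg_one (Q : ℤ × ℤ × ℤ) : formAct (-1) Q = Q := by
  obtain ⟨A, B, C⟩ := Q
  rw [formAct_eq]
  simp

lemma det_eq (γ : SL) : (γ.1 0 0) * (γ.1 1 1) - (γ.1 0 1) * (γ.1 1 0) = 1 := by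
  have := γ.2
  rwa [Matrix.det_fin_two] at this

lemma disc_act (γ : SL) (Q : ℤ × ℤ × ℤ) : formDisc (formAct γ Q) = formDisc Q := by
  obtain ⟨A, B, C⟩ := Q
  rw [formAct_eq]
  simp only [formDisc]
  have := det_eq γ
  generalize γ.1 0 0 = p at *
  generalize γ.1 0 1 = q at *
  generalize γ.1 1 0 = r at *
  generalize γ.1 1 1 = s at *
  linear_combination (B^2 - 4 * A * C) * (p * s - q * r + 1) * this

lemma posdef_act (γ : SL) (Q : ℤ × ℤ × ℤ) (h : IsPosDef Q) : IsPosDef (formAct γ Q) := by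
  refine ⟨?_, by rw [disc_act]; exact h.2⟩
  obtain ⟨A, B, C⟩ := Q
  rw [formAct_eq]
  obtain ⟨h1, h2⟩ := h
  simp only [formDisc] at h1 h2 ⊢
  have := det_eq γ
  generalize γ.1 0 0 = p at *
  generalize γ.1 0 1 = q at *
  generalize γ.1 1 0 = r at *
  generalize γ.1 1 1 = s at *
  have e : 4 * A * (A * p^2 + B * p * r + C * r^2) = (2 * A * p + B * r)^2 + (4 * A * C - B^2) * r^2 := by ring
  have : 0 < (2 * A * p + B * r)^2 + (4 * A * C - B^2) * r^2 := by
    by_cases hr : r = 0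
    · subst hr
      have hp : p ≠ 0 := by rintro rfl; simp at this
      have : 2 * A * p + B * 0 ≠ 0 := by simp [hp]; omega
      have := pow_pos (abs_pos.2 this) 2
      rw [sq_abs] at this
      linarith
    · have := pow_pos (abs_pos.2 hr) 2
      rw [sq_abs] at this
      nlinarith [sq_nonneg (2 * A * p + B * r), mul_pos (show 0 < 4 * A * C - B^2 by linarith) this]
  rw [← e] at this
  by_contra hcon
  nlinarith

def mkSL (p q r s : ℤ) (h : p * s - q * r = 1) : SL :=
  ⟨!![p, q; r, s], by rw [Matrix.det_fin_two]; simpa using h⟩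

lemma act_mkSL (p q r s : ℤ) (h : p * s - q * r = 1) (A B C : ℤ) : formAct (mkSL p q r s h) (A, B, C) =
    (A * p^2 + B * p * r + C * r^2, 2 * A * p * q + B * (p * s + q * r) + 2 * C * r * s,
     A * q^2 + B * q * s + C * s^2) := by
  rw [formAct_eq]; simp [mkSL]

def Good (Q : ℤ × ℤ × ℤ) : Prop := 3 ∣ Q.1 ∧ Q.2.1 % 3 = 1 ∧ |Q.2.1| < Q.1 ∧ |Q.2.1| < 3 * Q.2.2

lemma good_inj (γ : SL) (Q : ℤ × ℤ × ℤ) (h : Good Q) (h' : Good (formAct γ Q)) : γ = 1 ∨ γ = -1 := by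
  obtain ⟨A, B, C⟩ := Q
  obtain ⟨h1, h2, h3, h4⟩ := h
  rw [formAct_eq] at h'
  obtain ⟨h1', h2', h3', h4'⟩ := h'
  simp only at *
  obtain ⟨c, rfl⟩ := h1
  obtain ⟨c', hc'⟩ := h1'
  rw [hc'] at h3'
  have hd := det_eq γ
  have := core_inj B C c _ _ c' _ _ _ _ h2 h2' h4 h3 h4' h3' hd hc'.symm rfl rfl
  rw [this.1, this.2] at hd
  simp only [mul_zero, sub_zero] at hd
  rcases Int.mul_eq_one_iff_eq_one_or_neg_one.1 hd with ⟨ha, hb⟩ | ⟨ha, hb⟩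
  · left
    ext i j
    fin_cases i <;> fin_cases j <;> simp [this.1, this.2, ha, hb]
  · right
    ext i j
    fin_cases i <;> fin_cases j <;> simp [this.1, this.2, ha, hb]

lemma reduce (m : ℕ) : ∀ Q : ℤ × ℤ × ℤ, IsPosDef Q → 3 ∣ Q.1 → Q.2.1 % 3 = 1 → Q.2.1.natAbs = m →
    ∃ γ : SL, Good (formAct γ Q) := by
  induction m using Nat.strong_induction_on with
  | _ m ih =>
    rintro ⟨A, B, C⟩ hpd hA hB hm
    simp only at hA hB hm
    have hA0 : 0 < A := hpd.1
    have hC0 : 0 < C := by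
      have := hpd.2
      simp only [formDisc] at this
      by_contra hcon
      nlinarith [sq_nonneg B]
    have step : ∀ γ : SL, 3 ∣ (formAct γ (A, B, C)).1 → (formAct γ (A, B, C)).2.1 % 3 = 1 →
        (formAct γ (A, B, C)).2.1.natAbs < m → ∃ γ : SL, Good (formAct γ (A, B, C)) := by
      intro γ a1 a2 a3
      obtain ⟨δ, hδ⟩ := ih _ a3 (formAct γ (A, B, C)) (posdef_act _ _ hpd) a1 a2 rfl
      exact ⟨γ * δ, by rwa [formAct_mul]⟩
    by_cases c1 : |B| < A
    · by_cases c2 : |B| < 3 * C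
      · exact ⟨1, by rw [formAct_one]; exact ⟨hA, hB, c1, c2⟩⟩
      · rcases le_or_gt 0 B with hs | hs
        · rw [abs_of_nonneg hs] at c2
          apply step (mkSL 1 0 (-3) 1 (by ring)) <;> rw [act_mkSL] <;> simp only
          · omega
          · omega
          · ring_nf; omega
        · rw [abs_of_neg hs] at c2
          apply step (mkSL 1 0 3 1 (by ring)) <;> rw [act_mkSL] <;> simp only
          · omega
          · omega
          · ring_nf; omega
    · rcases le_or_gt 0 B with hs | hs
      · rw [abs_of_nonneg hs] at c1
        apply step (mkSL 1 (-1) 0 1 (by ring)) <;> rw [act_mkSL] <;> simp only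
        · omega
        · omega
        · ring_nf; omega
      · rw [abs_of_neg hs] at c1
        apply step (mkSL 1 1 0 1 (by ring)) <;> rw [act_mkSL] <;> simp only
        · omega
        · omega
        · ring_nf; omega

lemma zmod_root : ∀ A B C : ZMod 3, B^2 - 4 * A * C = 1 → (A = 0 ∧ B = 1) ∨
   ∃ r : ZMod 3, A * r^2 + B * r + C = 0 ∧ -(2 * A * r) - B = 1 := by decide

lemma cast_mod1 {k : ℤ} (h : (k : ZMod 3) = 1) : k % 3 = 1 := by
  have : (k : ZMod 3) = ((1 : ℤ) : ZMod 3) := by simpa using h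
  have := (ZMod.intCast_eq_intCast_iff _ _ 3).1 this
  simpa [Int.ModEq] using this

lemma exists_good (D : ℤ) (hD : D % 3 = 2) (Q : ℤ × ℤ × ℤ) (hQ : formDisc Q = -D) (hpd : IsPosDef Q) :
    ∃ γ : SL, Good (formAct γ Q) := by
  obtain ⟨A, B, C⟩ := Q
  have e : ((B^2 - 4 * A * C : ℤ) : ZMod 3) = 1 := by
    apply mod1_cast
    simp only [formDisc] at hQ
    omega
  push_cast at e
  rcases zmod_root A B C e with ⟨h1, h2⟩ | ⟨r, h1, h2⟩
  · exact reduce _ (A, B, C) hpd ((ZMod.intCast_zmod_eq_zero_iff_dvd _ 3).1 h1) (cast_mod1 h2) rfl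
  · obtain ⟨r, rfl⟩ := ZMod.intCast_surjective r
    have hr := act_mkSL r (-1) 1 0 (by ring) A B C
    obtain ⟨δ, hδ⟩ := reduce _ (formAct (mkSL r (-1) 1 0 (by ring)) (A, B, C)) (posdef_act _ _ hpd)
      (by rw [hr]; apply (ZMod.intCast_zmod_eq_zero_iff_dvd _ 3).1; push_cast; linear_combination h1)
      (by rw [hr]; apply cast_mod1; push_cast; linear_combination h2) rfl
    exact ⟨mkSL r (-1) 1 0 (by ring) * δ, by rwa [formAct_mul]⟩

noncomputable def GG (D : ℤ) : Finset (ℤ × ℤ × ℤ) :=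
  ((Icc (-D) D) ×ˢ (Icc (-D) D) ×ˢ (Icc (-D) D)).filter
    (fun q => q.1 % 3 = 1 ∧ |q.1| < 3 * q.2.1 ∧ |q.1| < 3 * q.2.2 ∧ 12 * q.2.1 * q.2.2 - q.1^2 = D)

lemma mem_GG (D k b c : ℤ) : (k, b, c) ∈ GG D ↔ k % 3 = 1 ∧ |k| < 3 * b ∧ |k| < 3 * c ∧ 12 * b * c - k^2 = D := by
  simp only [GG, mem_filter, mem_product, mem_Icc]
  constructor
  · exact fun h => h.2
  · rintro ⟨h1, h2, h3, h4⟩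
    have h0 := abs_nonneg k
    have hb : 0 < b := by omega
    have hc : 0 < c := by omega
    have e : k^2 ≤ 9 * (b * c) := by
      rw [← sq_abs]; nlinarith
    have e1 : b ≤ b * c := by nlinarith
    have e2 : c ≤ b * c := by nlinarith
    have e3 : 3 * (b * c) ≤ D := by nlinarith
    obtain ⟨h5, h6⟩ := abs_lt.1 h2
    refine ⟨⟨⟨?_, ?_⟩, ⟨?_, ?_⟩, ⟨?_, ?_⟩⟩, h1, h2, h3, h4⟩ <;> omega

lemma GG_prop (D : ℤ) (hD : 0 < D) (q : ℤ × ℤ × ℤ) (hq : q ∈ GG D) :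
   (formDisc (3 * q.2.2, q.1, q.2.1) = -D ∧ IsPosDef (3 * q.2.2, q.1, q.2.1)) ∧ Good (3 * q.2.2, q.1, q.2.1) := by
  obtain ⟨k, b, c⟩ := q
  rw [mem_GG] at hq
  obtain ⟨h1, h2, h3, h4⟩ := hq
  have h0 := abs_nonneg k
  have : formDisc (3 * c, k, b) = -D := by simp only [formDisc]; linarith
  refine ⟨⟨this, ⟨by simp only; omega, by rw [this]; omega⟩⟩, ⟨by simp, h1, h3, h2⟩⟩

lemma class_rel (D : ℤ) (Q Q' : {Q : ℤ × ℤ × ℤ // formDisc Q = -D ∧ IsPosDef Q})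
    (h : (Quot.mk _ Q : FormClasses D) = Quot.mk _ Q') : ∃ γ : SL, formAct γ Q.1 = Q'.1 := by
  have := Quot.eqvGen_exact h
  clear h
  induction this with
  | rel x y h => exact h
  | refl x => exact ⟨1, formAct_one _⟩
  | symm x y _ ih =>
    obtain ⟨γ, hγ⟩ := ih
    exact ⟨γ⁻¹, by rw [← hγ, ← formAct_mul, mul_inv_cancel, formAct_one]⟩
  | trans x y z _ _ ih1 ih2 =>
    obtain ⟨γ, hγ⟩ := ih1
    obtain ⟨δ, hδ⟩ := ih2
    exact ⟨γ * δ, by rw [formAct_mul, hγ, hδ]⟩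

lemma stab_card (D : ℤ) (hD : D % 3 = 2) (Q : ℤ × ℤ × ℤ) (hQ : formDisc Q = -D) (hpd : IsPosDef Q) :
    Nat.card {γ : SL // formAct γ Q = Q} = 2 := by
  obtain ⟨δ, hδ⟩ := exists_good D hD Q hQ hpd
  have : {γ : SL | formAct γ Q = Q} = {1, -1} := by
    ext γ
    simp only [Set.mem_ofPred_eq, Set.mem_insert_iff, Set.mem_singleton_iff]
    constructor
    · intro h
      have e : formAct (δ⁻¹ * γ * δ) (formAct δ Q) = formAct δ Q := by
        rw [← formAct_mul, ← mul_assoc, ← mul_assoc, mul_inv_cancel, one_mul, formAct_mul, h]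
      rcases good_inj (δ⁻¹ * γ * δ) (formAct δ Q) hδ (by rwa [e]) with h1 | h1
      · left
        have : γ = δ * (δ⁻¹ * γ * δ) * δ⁻¹ := by group
        rw [this, h1]; group
      · right
        have : γ = δ * (δ⁻¹ * γ * δ) * δ⁻¹ := by group
        rw [this, h1]; simp
    · rintro (rfl | rfl)
      · exact formAct_one _
      · exact formAct_neg_one _
  have h2 : Nat.card {γ : SL // formAct γ Q = Q} = Set.ncard {γ : SL | formAct γ Q = Q} := rfl
  rw [h2, this, Set.ncard_pair]
  intro h
  have := congrArg (fun γ : SL => γ.1 0 0) h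
  simp at this

theorem hurwitz_eq (D : ℤ) (hD0 : 0 < D) (hD : D % 3 = 2) : hurwitzClassNumber D = ((GG D).card : ℝ) := by
  rw [hurwitzClassNumber, if_neg hD0.ne']
  let e : {q // q ∈ GG D} → FormClasses D := fun q =>
    Quot.mk _ ⟨(3 * q.1.2.2, q.1.1, q.1.2.1), (GG_prop D hD0 q.1 q.2).1⟩
  have he : Function.Bijective e := by
    constructor
    · rintro ⟨⟨k, b, c⟩, h⟩ ⟨⟨k', b', c'⟩, h'⟩ heq
      obtain ⟨γ, hγ⟩ := class_rel D _ _ heq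
      simp only at hγ
      have g1 := (GG_prop D hD0 _ h).2
      have g2 := (GG_prop D hD0 _ h').2
      simp only at g1 g2
      have : (3 * c, k, b) = (3 * c', k', b') := by
        rw [← hγ] at g2
        rcases good_inj γ _ g1 g2 with rfl | rfl
        · rwa [formAct_one] at hγ
        · rwa [formAct_neg_one] at hγ
      simp only [Prod.mk.injEq, Subtype.mk.injEq] at this ⊢
      omega
    · intro c
      obtain ⟨⟨Q, h1, h2⟩, rfl⟩ := Quot.exists_rep c
      obtain ⟨γ, hγ⟩ := exists_good D hD Q h1 h2
      have d1 : formDisc (formAct γ Q) = -D := by rw [disc_act, h1]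
      have key : ∀ Q' : ℤ × ℤ × ℤ, formAct γ Q = Q' → Good Q' → formDisc Q' = -D →
          (Q'.2.1, Q'.2.2, Q'.1 / 3) ∈ GG D ∧ (3 * (Q'.1 / 3), Q'.2.1, Q'.2.2) = Q' := by
        rintro ⟨A, B, C⟩ _ ⟨g1, g2, g3, g4⟩ d1
        simp only [mem_GG, formDisc] at *
        obtain ⟨c, rfl⟩ := g1
        have : 3 * c / 3 = c := by omega
        rw [this]
        exact ⟨⟨g2, g4, g3, by linarith⟩, rfl⟩
      obtain ⟨k1, k2⟩ := key _ rfl hγ d1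
      refine ⟨⟨_, k1⟩, ?_⟩
      apply Eq.symm
      apply Quot.sound
      exact ⟨γ, k2.symm⟩
  rw [← finsum_eq_of_bijective (f := fun _ => (1 : ℝ)) e he]
  · rw [finsum_eq_sum_of_fintype]; simp
  · intro x
    rw [stab_card D hD _ (Quot.out (e x)).2.1 (Quot.out (e x)).2.2]; norm_num

lemma hurwitz_neg (D : ℤ) (hD : D < 0) : hurwitzClassNumber D = 0 := by
  rw [hurwitzClassNumber, if_neg hD.ne]
  have : IsEmpty (FormClasses D) := by
    constructor
    intro c
    obtain ⟨⟨Q, h1, h2⟩, rfl⟩ := Quot.exists_rep c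
    have := h2.2
    omega
  exact finsum_of_isEmpty _

abbrev Q4 := ℤ × ℤ × ℤ × ℤ

/-- the reduced region -/
def Gp (k b c : ℤ) : Prop := (0 < k ∧ k < 3 * b ∧ k < 3 * c) ∨ (k < 0 ∧ 3 * b < k ∧ 3 * c < k)

instance (k b c : ℤ) : Decidable (Gp k b c) := by unfold Gp; infer_instance

def phi (k b c : ℤ) : ℤ := k.sign * (b.sign + c.sign)

def gi (k b c : ℤ) : ℤ := if Gp k b c then 1 else 0

lemma sgn_cases (a : ℤ) : (0 < a ∧ a.sign = 1) ∨ (a = 0 ∧ a.sign = 0) ∨ (a < 0 ∧ a.sign = -1) := by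
  rcases lt_trichotomy a 0 with h | h | h
  · exact Or.inr (Or.inr ⟨h, Int.sign_eq_neg_one_of_neg h⟩)
  · exact Or.inr (Or.inl ⟨h, by rw [h]; rfl⟩)
  · exact Or.inl ⟨h, Int.sign_eq_one_of_pos h⟩

/-- the pair identity: s(r)(s(k)+s(k')) with 6r = k+k' -/
lemma phi_pair (k k' r : ℤ) (hk : k ≠ 0) (hk' : k' ≠ 0) (h : 6 * r = k + k') :
    r.sign * (k.sign + k'.sign) = if (0 < k ↔ 0 < k') then 2 else 0 := by
  rcases sgn_cases r with ⟨h1, h2⟩ | ⟨h1, h2⟩ | ⟨h1, h2⟩ <;>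
  rcases sgn_cases k with ⟨h3, h4⟩ | ⟨h3, h4⟩ | ⟨h3, h4⟩ <;>
  rcases sgn_cases k' with ⟨h5, h6⟩ | ⟨h5, h6⟩ | ⟨h5, h6⟩ <;>
  first
  | (exfalso; omega)
  | (rw [h2, h4, h6]; split_ifs <;> omega)

lemma gi_eq (k0 k k1 b c : ℤ) (h1 : 6 * b = k0 + k) (h2 : 6 * c = k + k1) :
    gi k b c = if (0 < k ∧ k < k0 ∧ k < k1) ∨ (k < 0 ∧ k0 < k ∧ k1 < k) then 1 else 0 := by
  unfold gi Gp
  refine if_congr ?_ rfl rfl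
  omega

set_option maxHeartbeats 4000000 in
lemma cyc (b c k : ℤ) (hk : ¬ 3 ∣ k) :
    phi k b c + phi (6*c-k) c (b+3*c-k) + phi (6*b+12*c-5*k) (b+3*c-k) (3*b+4*c-2*k)
     + phi (12*b+12*c-7*k) (3*b+4*c-2*k) (4*b+3*c-2*k) + phi (12*b+6*c-5*k) (4*b+3*c-2*k) (3*b+c-k)
     + phi (6*b-k) (3*b+c-k) b
     - 4 * (gi k b c + gi (6*c-k) c (b+3*c-k) + gi (6*b+12*c-5*k) (b+3*c-k) (3*b+4*c-2*k)
     + gi (12*b+12*c-7*k) (3*b+4*c-2*k) (4*b+3*c-2*k) + gi (12*b+6*c-5*k) (4*b+3*c-2*k) (3*b+c-k)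
     + gi (6*b-k) (3*b+c-k) b) = 8 := by
  have p1 := phi_pair k (6*c-k) c (by omega) (by omega) (by ring)
  have p2 := phi_pair (6*c-k) (6*b+12*c-5*k) (b+3*c-k) (by omega) (by omega) (by ring)
  have p3 := phi_pair (6*b+12*c-5*k) (12*b+12*c-7*k) (3*b+4*c-2*k) (by omega) (by omega) (by ring)
  have p4 := phi_pair (12*b+12*c-7*k) (12*b+6*c-5*k) (4*b+3*c-2*k) (by omega) (by omega) (by ring)
  have p5 := phi_pair (12*b+6*c-5*k) (6*b-k) (3*b+c-k) (by omega) (by omega) (by ring)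
  have p6 := phi_pair (6*b-k) k b (by omega) (by omega) (by ring)
  rw [gi_eq (6*b-k) k (6*c-k) b c (by ring) (by ring),
    gi_eq k (6*c-k) (6*b+12*c-5*k) c (b+3*c-k) (by ring) (by ring),
    gi_eq (6*c-k) (6*b+12*c-5*k) (12*b+12*c-7*k) (b+3*c-k) (3*b+4*c-2*k) (by ring) (by ring),
    gi_eq (6*b+12*c-5*k) (12*b+12*c-7*k) (12*b+6*c-5*k) (3*b+4*c-2*k) (4*b+3*c-2*k) (by ring) (by ring),
    gi_eq (12*b+12*c-7*k) (12*b+6*c-5*k) (6*b-k) (4*b+3*c-2*k) (3*b+c-k) (by ring) (by ring),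
    gi_eq (12*b+6*c-5*k) (6*b-k) k (3*b+c-k) b (by ring) (by ring)]
  have e : phi k b c + phi (6*c-k) c (b+3*c-k) + phi (6*b+12*c-5*k) (b+3*c-k) (3*b+4*c-2*k)
     + phi (12*b+12*c-7*k) (3*b+4*c-2*k) (4*b+3*c-2*k) + phi (12*b+6*c-5*k) (4*b+3*c-2*k) (3*b+c-k)
     + phi (6*b-k) (3*b+c-k) b = 
     (if (0 < k ↔ 0 < 6*c-k) then 2 else 0) + (if (0 < 6*c-k ↔ 0 < 6*b+12*c-5*k) then 2 else 0)
     + (if (0 < 6*b+12*c-5*k ↔ 0 < 12*b+12*c-7*k) then 2 else 0) + (if (0 < 12*b+12*c-7*k ↔ 0 < 12*b+6*c-5*k) then 2 else 0)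
     + (if (0 < 12*b+6*c-5*k ↔ 0 < 6*b-k) then 2 else 0) + (if (0 < 6*b-k ↔ 0 < k) then 2 else 0) := by
    rw [← p1, ← p2, ← p3, ← p4, ← p5, ← p6]; unfold phi; ring
  rw [e]; clear e p1 p2 p3 p4 p5 p6
  obtain ⟨k0, h0⟩ : ∃ z, z = k := ⟨_, rfl⟩
  obtain ⟨k1, h1⟩ : ∃ z, z = 6*c-k := ⟨_, rfl⟩
  obtain ⟨k2, h2⟩ : ∃ z, z = 6*b+12*c-5*k := ⟨_, rfl⟩
  obtain ⟨k3, h3⟩ : ∃ z, z = 12*b+12*c-7*k := ⟨_, rfl⟩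
  obtain ⟨k4, h4⟩ : ∃ z, z = 12*b+6*c-5*k := ⟨_, rfl⟩
  obtain ⟨k5, h5⟩ : ∃ z, z = 6*b-k := ⟨_, rfl⟩
  rw [← h1, ← h2, ← h3, ← h4, ← h5, ← h0]
  rcases lt_or_gt_of_ne (show k0 ≠ 0 by omega) with a0 | a0 <;>
  rcases lt_or_gt_of_ne (show k1 ≠ 0 by omega) with a1 | a1 <;>
  rcases lt_or_gt_of_ne (show k2 ≠ 0 by omega) with a2 | a2 <;> first | (exfalso; omega) | skip
  all_goals rcases lt_or_gt_of_ne (show k3 ≠ 0 by omega) with a3 | a3 <;> first | (exfalso; omega) | skip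
  all_goals rcases lt_or_gt_of_ne (show k4 ≠ 0 by omega) with a4 | a4 <;> first | (exfalso; omega) | skip
  all_goals rcases lt_or_gt_of_ne (show k5 ≠ 0 by omega) with a5 | a5 <;> first | (exfalso; omega) | skip
  all_goals simp only [a0, a1, a2, a3, a4, a5, not_lt_of_gt, iff_true, true_iff, if_true, if_false, true_and, false_and, or_false, false_or, iff_self, not_true, iff_false, not_false_eq_true]
  all_goals rcases lt_or_gt_of_ne (show k0 ≠ k1 by omega) with b0 | b0 <;>
    rcases lt_or_gt_of_ne (show k1 ≠ k2 by omega) with b1 | b1 <;> first | (exfalso; omega) | skip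
  all_goals rcases lt_or_gt_of_ne (show k2 ≠ k3 by omega) with b2 | b2 <;> first | (exfalso; omega) | skip
  all_goals rcases lt_or_gt_of_ne (show k3 ≠ k4 by omega) with b3 | b3 <;> first | (exfalso; omega) | skip
  all_goals rcases lt_or_gt_of_ne (show k4 ≠ k5 by omega) with b4 | b4 <;> first | (exfalso; omega) | skip
  all_goals rcases lt_or_gt_of_ne (show k5 ≠ k0 by omega) with b5 | b5 <;> first | (exfalso; omega) | skip
  all_goals simp only [b0, b1, b2, b3, b4, b5, not_lt_of_gt, if_true, if_false, and_true, and_false, and_self]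
  all_goals norm_num

lemma rays (x c : ℤ) (h : x ≠ 0 ∨ c ≠ 0) :
    x.sign * c.sign + c.sign * (3*c-x).sign + (3*c-x).sign * (2*c-x).sign + (2*c-x).sign * (3*c-2*x).sign
    + (3*c-2*x).sign * (c-x).sign - (c-x).sign * x.sign = 4 := by
  rcases sgn_cases x with ⟨h1, g1⟩ | ⟨h1, g1⟩ | ⟨h1, g1⟩ <;>
  rcases sgn_cases c with ⟨h2, g2⟩ | ⟨h2, g2⟩ | ⟨h2, g2⟩ <;> first | (exfalso; omega) | skip
  all_goals rcases sgn_cases (3*c-x) with ⟨h3, g3⟩ | ⟨h3, g3⟩ | ⟨h3, g3⟩ <;> first | (exfalso; omega) | skip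
  all_goals rcases sgn_cases (2*c-x) with ⟨h4, g4⟩ | ⟨h4, g4⟩ | ⟨h4, g4⟩ <;> first | (exfalso; omega) | skip
  all_goals rcases sgn_cases (3*c-2*x) with ⟨h5, g5⟩ | ⟨h5, g5⟩ | ⟨h5, g5⟩ <;> first | (exfalso; omega) | skip
  all_goals rcases sgn_cases (c-x) with ⟨h6, g6⟩ | ⟨h6, g6⟩ | ⟨h6, g6⟩ <;> first | (exfalso; omega) | skip
  all_goals (rw [g1, g2, g3, g4, g5, g6]; norm_num)

/-- the window set -/
def YP (n L K x y b c : ℤ) : Prop :=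
  x*y+3*b*c = n ∧ ¬ 3 ∣ x - y ∧ |x+y| ≤ L ∧ |b| ≤ K ∧ |c| ≤ K ∧ |b+3*c-(x-y)| ≤ K ∧ |3*b+c-(x-y)| ≤ K
   ∧ |3*b+4*c-2*(x-y)| ≤ K ∧ |4*b+3*c-2*(x-y)| ≤ K

open Classical in
noncomputable def Y (n L K : ℤ) : Finset Q4 :=
  ((Icc (-(L+5*K)) (L+5*K)) ×ˢ (Icc (-(L+5*K)) (L+5*K)) ×ˢ (Icc (-(L+5*K)) (L+5*K)) ×ˢ (Icc (-(L+5*K)) (L+5*K))).filter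
   (fun q => YP n L K q.1 q.2.1 q.2.2.1 q.2.2.2)

lemma mem_Y (n L K x y b c : ℤ) : (x, y, b, c) ∈ Y n L K ↔ YP n L K x y b c := by
  simp only [Y, mem_filter, mem_product, mem_Icc, and_iff_right_iff_imp]
  unfold YP
  simp only [abs_le]
  omega

lemma Y_rho (n L K : ℤ) (f : ℤ → ℤ → ℤ → ℤ → ℤ) :
    ∑ q ∈ Y n L K, f q.1 q.2.1 q.2.2.1 q.2.2.2 =
    ∑ q ∈ Y n L K, f (q.2.1+3*q.2.2.2) (q.1-3*q.2.2.2) q.2.2.2 (q.2.2.1+3*q.2.2.2-q.1+q.2.1) := by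
  symm
  refine sum_nbij' (fun q => (q.2.1+3*q.2.2.2, q.1-3*q.2.2.2, q.2.2.2, q.2.2.1+3*q.2.2.2-q.1+q.2.1))
    (fun q => (q.2.1+3*q.2.2.1, q.1-3*q.2.2.1, q.2.2.2+3*q.2.2.1-q.1+q.2.1, q.2.2.1)) ?_ ?_ ?_ ?_ ?_
  · rintro ⟨x, y, b, c⟩ h
    simp only [mem_Y] at h ⊢
    unfold YP at h ⊢
    simp only [abs_le] at h ⊢
    refine ⟨by linear_combination h.1, ?_⟩
    have := h.2
    omega
  · rintro ⟨x, y, b, c⟩ h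
    simp only [mem_Y] at h ⊢
    unfold YP at h ⊢
    simp only [abs_le] at h ⊢
    refine ⟨by linear_combination h.1, ?_⟩
    have := h.2
    omega
  · rintro ⟨x, y, b, c⟩ h
    simp only [Prod.mk.injEq]; refine ⟨by ring, by ring, by ring, trivial⟩
  · rintro ⟨x, y, b, c⟩ h
    simp only [Prod.mk.injEq]; refine ⟨by ring, by ring, trivial, by ring⟩
  · rintro ⟨x, y, b, c⟩ h; rfl

lemma Y_W (n L K : ℤ) (f : ℤ → ℤ → ℤ → ℤ → ℤ) :
    ∑ q ∈ Y n L K, f q.1 q.2.1 q.2.2.1 q.2.2.2 =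
    ∑ q ∈ Y n L K, f q.2.1 q.1 (-q.2.2.2) (-q.2.2.1) := by
  symm
  refine sum_nbij' (fun q => (q.2.1, q.1, -q.2.2.2, -q.2.2.1))
    (fun q => (q.2.1, q.1, -q.2.2.2, -q.2.2.1)) ?_ ?_ ?_ ?_ ?_
  · rintro ⟨x, y, b, c⟩ h
    simp only [mem_Y] at h ⊢
    unfold YP at h ⊢
    simp only [abs_le] at h ⊢
    refine ⟨by linear_combination h.1, ?_⟩
    have := h.2
    omega
  · rintro ⟨x, y, b, c⟩ h
    simp only [mem_Y] at h ⊢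
    unfold YP at h ⊢
    simp only [abs_le] at h ⊢
    refine ⟨by linear_combination h.1, ?_⟩
    have := h.2
    omega
  · rintro ⟨x, y, b, c⟩ h
    simp
  · rintro ⟨x, y, b, c⟩ h
    simp
  · rintro ⟨x, y, b, c⟩ h; rfl

lemma Y_neg (n L K : ℤ) (f : ℤ → ℤ → ℤ → ℤ → ℤ) :
    ∑ q ∈ Y n L K, f q.1 q.2.1 q.2.2.1 q.2.2.2 =
    ∑ q ∈ Y n L K, f (-q.1) (-q.2.1) (-q.2.2.1) (-q.2.2.2) := by
  symm
  refine sum_nbij' (fun q => (-q.1, -q.2.1, -q.2.2.1, -q.2.2.2))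
    (fun q => (-q.1, -q.2.1, -q.2.2.1, -q.2.2.2)) ?_ ?_ ?_ ?_ ?_
  · rintro ⟨x, y, b, c⟩ h
    simp only [mem_Y] at h ⊢
    unfold YP at h ⊢
    simp only [abs_le] at h ⊢
    refine ⟨by linear_combination h.1, ?_⟩
    have := h.2
    omega
  · rintro ⟨x, y, b, c⟩ h
    simp only [mem_Y] at h ⊢
    unfold YP at h ⊢
    simp only [abs_le] at h ⊢
    refine ⟨by linear_combination h.1, ?_⟩
    have := h.2
    omega
  · rintro ⟨x, y, b, c⟩ h
    simp
  · rintro ⟨x, y, b, c⟩ h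
    simp
  · rintro ⟨x, y, b, c⟩ h; rfl

/-- one step of rho, on functions -/
def Rf (f : ℤ → ℤ → ℤ → ℤ → ℤ) : ℤ → ℤ → ℤ → ℤ → ℤ :=
  fun x y b c => f (y+3*c) (x-3*c) c (b+3*c-x+y)

noncomputable def SY (n L K : ℤ) (f : ℤ → ℤ → ℤ → ℤ → ℤ) : ℤ := ∑ q ∈ Y n L K, f q.1 q.2.1 q.2.2.1 q.2.2.2

lemma SY_R (n L K : ℤ) (f : ℤ → ℤ → ℤ → ℤ → ℤ) : SY n L K (Rf f) = SY n L K f := (Y_rho n L K f).symm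

def fphi (x y b c : ℤ) : ℤ := (x+y)^2 * phi (x-y) b c
def fgi (x y b c : ℤ) : ℤ := (x+y)^2 * gi (x-y) b c
def pinf (x y b c : ℤ) : ℤ := (x+y)^2 * (x.sign * c.sign)
def pz (x y b c : ℤ) : ℤ := (x+y)^2 * (-(b.sign * y.sign))
def p13 (x y b c : ℤ) : ℤ := (x+y)^2 * ((x-3*b).sign * (c+y).sign)
def p12 (x y b c : ℤ) : ℤ := (x+y)^2 * ((x-2*b).sign * (3*c+2*y).sign)
def p23 (x y b c : ℤ) : ℤ := (x+y)^2 * ((2*x-3*b).sign * (2*c+y).sign)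
def p1 (x y b c : ℤ) : ℤ := (x+y)^2 * ((x-b).sign * (3*c+y).sign)

lemma pt1 (x y b c : ℤ) (h : x ≠ 0 ∨ c ≠ 0) :
   pinf x y b c + Rf pz x y b c + Rf (Rf p13) x y b c + Rf (Rf (Rf p12)) x y b c
   + Rf (Rf (Rf (Rf p23))) x y b c + Rf (Rf (Rf (Rf (Rf p1)))) x y b c = 4 * (x+y)^2 := by
  have r := rays x c h
  simp only [Rf, pinf, pz, p13, p12, p23, p1]
  ring_nf
  ring_nf at r
  have e1 : (c*3-x).sign = -(x-c*3).sign := by rw [← Int.sign_neg]; congr 1; ring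
  have e2 : (c*2-x).sign = -(x-c*2).sign := by rw [← Int.sign_neg]; congr 1; ring
  have e3 : (c-x).sign = -(x-c).sign := by rw [← Int.sign_neg]; congr 1; ring
  have e4 : (c*3-x*2).sign = -(x*2-c*3).sign := by rw [← Int.sign_neg]; congr 1; ring
  have e5 : (-x+c*3).sign = -(x-c*3).sign := by rw [← Int.sign_neg]; congr 1; ring
  have e6 : (-x+c*2).sign = -(x-c*2).sign := by rw [← Int.sign_neg]; congr 1; ring
  have e7 : (-x+c).sign = -(x-c).sign := by rw [← Int.sign_neg]; congr 1; ring
  have e8 : (-(x*2)+c*3).sign = -(x*2-c*3).sign := by rw [← Int.sign_neg]; congr 1; ring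
  simp only [e1, e2, e3, e4, e5, e6, e7, e8, Int.sign_neg] at r ⊢
  linear_combination (x^2+2*x*y+y^2) * r

lemma pt2 (x y b c : ℤ) (hk : ¬ 3 ∣ x - y) :
   fphi x y b c + Rf fphi x y b c + Rf (Rf fphi) x y b c + Rf (Rf (Rf fphi)) x y b c
   + Rf (Rf (Rf (Rf fphi))) x y b c + Rf (Rf (Rf (Rf (Rf fphi)))) x y b c 
   - 4 * (fgi x y b c + Rf fgi x y b c + Rf (Rf fgi) x y b c + Rf (Rf (Rf fgi)) x y b c
   + Rf (Rf (Rf (Rf fgi))) x y b c + Rf (Rf (Rf (Rf (Rf fgi)))) x y b c) = 8 * (x+y)^2 := by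
  have r := cyc b c (x-y) hk
  simp only [Rf, fphi, fgi]
  ring_nf
  ring_nf at r
  linear_combination (x^2+2*x*y+y^2) * r

theorem main12 (n L K : ℤ) (hn : 0 < n) :
    12 * SY n L K fgi = 3 * SY n L K (fun x y b c => (x+y)^2 * (phi (x-y) b c - 2 * (x.sign * c.sign)))
      + 4 * SY n L K (fun x y b c => (x+y)^2 * (x.sign * c.sign - (x-b).sign * (3*c+y).sign))
      + 2 * SY n L K (fun x y b c => (x+y)^2 * ((x-b).sign * (3*c+y).sign - (2*x-3*b).sign * (2*c+y).sign)) := by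
  have R := SY_R n L K
  have w1 : SY n L K pz = SY n L K pinf := by
    unfold SY; rw [Y_W]; refine sum_congr rfl fun q _ => ?_
    simp only [pz, pinf, Int.sign_neg]; ring
  have w2 : SY n L K p13 = SY n L K p1 := by
    unfold SY; rw [Y_W]; refine sum_congr rfl fun q _ => ?_
    simp only [p13, p1]
    rw [show q.2.1 - 3 * -q.2.2.2 = 3 * q.2.2.2 + q.2.1 by ring, show -q.2.2.1 + q.1 = q.1 - q.2.2.1 by ring]; ring
  have w3 : SY n L K p12 = SY n L K p23 := by
    unfold SY; rw [Y_W]; refine sum_congr rfl fun q _ => ?_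
    simp only [p12, p23]
    rw [show q.2.1 - 2 * -q.2.2.2 = 2 * q.2.2.2 + q.2.1 by ring, show 3 * -q.2.2.1 + 2 * q.1 = 2 * q.1 - 3 * q.2.2.1 by ring]; ring
  have s1 : 2 * SY n L K pinf + 2 * SY n L K p1 + 2 * SY n L K p23 = SY n L K (fun x y b c => 4 * (x+y)^2) := by
    have : SY n L K pinf + SY n L K (Rf pz) + SY n L K (Rf (Rf p13)) + SY n L K (Rf (Rf (Rf p12)))
      + SY n L K (Rf (Rf (Rf (Rf p23)))) + SY n L K (Rf (Rf (Rf (Rf (Rf p1))))) = SY n L K (fun x y b c => 4 * (x+y)^2) := by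
      unfold SY; simp only [← sum_add_distrib]
      refine sum_congr rfl ?_
      rintro ⟨x, y, b, c⟩ h
      rw [mem_Y] at h
      have : x ≠ 0 ∨ c ≠ 0 := by
        by_contra hh
        push Not at hh
        obtain ⟨h1, h2⟩ := hh
        have h3 := h.1
        have h4 := h.2.1
        rw [h1, h2] at h3
        linarith
      exact pt1 x y b c this
    simp only [R, w1, w2, w3] at this; linarith
  have s2 : 6 * SY n L K fphi - 24 * SY n L K fgi = SY n L K (fun x y b c => 8 * (x+y)^2) := by
    have : SY n L K fphi + SY n L K (Rf fphi) + SY n L K (Rf (Rf fphi)) + SY n L K (Rf (Rf (Rf fphi)))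
      + SY n L K (Rf (Rf (Rf (Rf fphi)))) + SY n L K (Rf (Rf (Rf (Rf (Rf fphi)))))
      - 4 * (SY n L K fgi + SY n L K (Rf fgi) + SY n L K (Rf (Rf fgi)) + SY n L K (Rf (Rf (Rf fgi)))
      + SY n L K (Rf (Rf (Rf (Rf fgi)))) + SY n L K (Rf (Rf (Rf (Rf (Rf fgi)))))) = SY n L K (fun x y b c => 8 * (x+y)^2) := by
      unfold SY; simp only [← sum_add_distrib, mul_sum, ← sum_sub_distrib]
      refine sum_congr rfl ?_
      rintro ⟨x, y, b, c⟩ h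
      rw [mem_Y] at h
      exact pt2 x y b c h.2.1
    simp only [R] at this; linarith
  have s3 : SY n L K (fun x y b c => 8 * (x+y)^2) = 2 * SY n L K (fun x y b c => 4 * (x+y)^2) := by
    unfold SY; rw [mul_sum]; refine sum_congr rfl fun q _ => by ring
  have t1 : SY n L K (fun x y b c => (x+y)^2 * (phi (x-y) b c - 2 * (x.sign * c.sign))) = SY n L K fphi - 2 * SY n L K pinf := by
    unfold SY; rw [mul_sum, ← sum_sub_distrib]; refine sum_congr rfl fun q _ => by simp only [fphi, pinf]; ring
  have t2 : SY n L K (fun x y b c => (x+y)^2 * (x.sign * c.sign - (x-b).sign * (3*c+y).sign)) = SY n L K pinf - SY n L K p1 := by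
    unfold SY; rw [← sum_sub_distrib]; refine sum_congr rfl fun q _ => by simp only [p1, pinf]; ring
  have t3 : SY n L K (fun x y b c => (x+y)^2 * ((x-b).sign * (3*c+y).sign - (2*x-3*b).sign * (2*c+y).sign)) = SY n L K p1 - SY n L K p23 := by
    unfold SY; rw [← sum_sub_distrib]; refine sum_congr rfl fun q _ => by simp only [p1, p23]; ring
  rw [t1, t2, t3]; linarith

lemma Y_V (n L K : ℤ) (f : ℤ → ℤ → ℤ → ℤ → ℤ) :
    ∑ q ∈ Y n L K, f q.1 q.2.1 q.2.2.1 q.2.2.2 =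
    ∑ q ∈ Y n L K, f q.2.1 q.1 (-q.2.2.1) (-q.2.2.2) := by
  symm
  refine sum_nbij' (fun q => (q.2.1, q.1, -q.2.2.1, -q.2.2.2))
    (fun q => (q.2.1, q.1, -q.2.2.1, -q.2.2.2)) ?_ ?_ ?_ ?_ ?_
  · rintro ⟨x, y, b, c⟩ h
    simp only [mem_Y] at h ⊢
    unfold YP at h ⊢
    simp only [abs_le] at h ⊢
    refine ⟨by linear_combination h.1, ?_⟩
    have := h.2
    omega
  · rintro ⟨x, y, b, c⟩ h
    simp only [mem_Y] at h ⊢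
    unfold YP at h ⊢
    simp only [abs_le] at h ⊢
    refine ⟨by linear_combination h.1, ?_⟩
    have := h.2
    omega
  · rintro ⟨x, y, b, c⟩ h
    simp
  · rintro ⟨x, y, b, c⟩ h
    simp
  · rintro ⟨x, y, b, c⟩ h; simp

def fij (i j x y b c : ℤ) : ℤ := if (x-y)%3 = i ∧ (x+y)%3 = j then fgi x y b c else 0

lemma gi_neg (k b c : ℤ) : gi (-k) (-b) (-c) = gi k b c := by
  unfold gi Gp
  refine if_congr ?_ rfl rfl
  omega

lemma fij_V (n L K i j i' : ℤ) (h : (i = 1 ∧ i' = 2) ∨ (i = 2 ∧ i' = 1)) : SY n L K (fij i j) = SY n L K (fij i' j) := by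
  unfold SY
  rw [Y_V]
  refine sum_congr rfl ?_
  rintro ⟨x, y, b, c⟩ hq
  simp only [fij, fgi]
  rw [show y - x = -(x-y) by ring, gi_neg, add_comm y x]
  refine if_congr ?_ rfl rfl
  omega

lemma fij_neg (n L K : ℤ) : SY n L K (fij 1 1) = SY n L K (fij 2 2) := by
  unfold SY
  rw [Y_neg]
  refine sum_congr rfl ?_
  rintro ⟨x, y, b, c⟩ hq
  simp only [fij, fgi]
  rw [show -x - -y = -(x-y) by ring, gi_neg, show -x+-y = -(x+y) by ring, neg_sq]
  refine if_congr ?_ rfl rfl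
  omega

lemma not3 (N n x y b c : ℤ) (hN : n = 3 * N) (h : x*y+3*b*c = n) (h3 : ¬ 3 ∣ x - y) : ¬ 3 ∣ x + y := by
  have h1 : (3:ℤ) ∣ x * y := ⟨N - b*c, by linarith⟩
  rcases Int.prime_three.dvd_or_dvd h1 with h2 | h2 <;> omega

lemma four_fij (n L K N m : ℤ) (hN : n = 3 * N) (hm : m = 1 ∨ m = 2) :
    SY n L K fgi = 4 * SY n L K (fij 1 m) := by
  have h1 : SY n L K fgi = SY n L K (fij 1 1) + SY n L K (fij 1 2) + SY n L K (fij 2 1) + SY n L K (fij 2 2) := by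
    unfold SY
    simp only [← sum_add_distrib]
    refine sum_congr rfl ?_
    rintro ⟨x, y, b, c⟩ hq
    rw [mem_Y] at hq
    have := not3 N n x y b c hN hq.1 hq.2.1
    have := hq.2.1
    simp only [fij]
    split_ifs <;> first | omega | simp
  have h2 := fij_V n L K 1 1 2 (by simp)
  have h3 := fij_V n L K 1 2 2 (by simp)
  have h4 := fij_neg n L K
  rcases hm with rfl | rfl <;> linarith

lemma GG_empty (D : ℤ) (h : D < 0) : GG D = ∅ := by
  ext ⟨k, b, c⟩
  simp only [mem_GG, notMem_empty, iff_false]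
  rintro ⟨h1, h2, h3, h4⟩
  have h5 : k^2 = |k|^2 := (sq_abs k).symm
  have := abs_nonneg k
  nlinarith [mul_lt_mul'' h2 h3 this this]

lemma HH_eq (m : ℤ) (hm : m = 1 ∨ m = 2) (n : ℕ) (hn : 0 < n) (h3 : 3 ∣ n) :
    HH 2 m 3 n = ((∑ t ∈ (Icc (-(2*(n:ℤ))) (2*n)).filter (fun t => t % 3 = m), t^2 * ((GG (4*n-t^2)).card : ℤ) : ℤ) : ℝ) := by
  unfold HH
  rw [finsum_eq_sum_of_support_subset (s := Icc (-(2*(n:ℤ))) (2*n))]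
  · rw [sum_filter]
    push_cast
    refine sum_congr rfl fun t ht => ?_
    have e : m % 3 = m := by omega
    by_cases h : t % 3 = m
    · rw [if_pos h, if_pos (by omega)]
      have hmod : (4 * (n:ℤ) - t^2) % 3 = 2 := by
        obtain ⟨N, rfl⟩ := h3
        have : t ^ 2 % 3 = 1 := by
          have : t % 3 = 1 ∨ t % 3 = 2 := by omega
          rcases this with h | h <;> simp [pow_two, Int.mul_emod, h]
        push_cast
        omega
      rcases lt_trichotomy (4 * (n:ℤ) - t^2) 0 with h0 | h0 | h0
      · rw [hurwitz_neg _ h0, GG_empty _ h0]; simp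
      · omega
      · rw [hurwitz_eq _ h0 hmod]; 
    · rw [if_neg h, if_neg (by omega)]
  · intro t ht
    rw [Function.mem_support] at ht
    rw [coe_Icc, Set.mem_Icc]
    by_contra hc
    apply ht
    have : 4 * (n:ℤ) - t^2 < 0 := by
      have hn' : (1:ℤ) ≤ n := by exact_mod_cast hn
      by_cases h : t < -(2*(n:ℤ))
      · nlinarith
      · have : 2 * (n:ℤ) < t := by
          by_contra hh; exact hc ⟨by omega, by omega⟩
        nlinarith
    rw [hurwitz_neg _ this]; simp

lemma sgn_pos_mul (k b : ℤ) (hk : k ≠ 0) : (0 < k ∧ k.sign * b = b) ∨ (k < 0 ∧ k.sign * b = -b) := by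
  rcases sgn_cases k with ⟨h, e⟩ | ⟨h, e⟩ | ⟨h, e⟩
  · left; exact ⟨h, by rw [e]; ring⟩
  · exact absurd h hk
  · right; exact ⟨h, by rw [e]; ring⟩

/-- bounds -/
lemma Gbound (n t k b c : ℤ) (h2 : |k| < 3*b) (h3 : |k| < 3*c) (h4 : 12*b*c-k^2 = 4*n-t^2) (h0 : k ≠ 0) :
    b ≤ 4 * n ∧ c ≤ 4 * n ∧ |t| ≤ 2 * n := by
  have h5 : k^2 = |k|^2 := (sq_abs k).symm
  have h6 : 1 ≤ |k| := Int.one_le_abs h0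
  have hb : 1 ≤ b := by omega
  have hc : 1 ≤ c := by omega
  have h7 : |k| * |k| < (3*b)*(3*c) := mul_lt_mul'' h2 h3 (by omega) (by omega)
  have h8 := sq_nonneg t
  have hbb : b ≤ b * c := by nlinarith
  have hcc : c ≤ b * c := by nlinarith
  have hn : 0 < n := by nlinarith
  refine ⟨by nlinarith, by nlinarith, ?_⟩
  by_contra hh
  push Not at hh
  have : |t|^2 = t^2 := sq_abs t
  nlinarith

lemma card_fij (n L K m : ℤ) (hn : 0 < n) (hL : 20 * n ≤ L) (hK : 1000 * (L * L + n) ≤ K) :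
    ∑ t ∈ (Icc (-(2*n)) (2*n)).filter (fun t => t % 3 = m), t^2 * ((GG (4*n-t^2)).card : ℤ) = SY n L K (fij 1 m) := by
  have hKn : 1000 * n ≤ K := by nlinarith
  have e1 : ∀ t ∈ (Icc (-(2*n)) (2*n)).filter (fun t => t % 3 = m), t^2 * ((GG (4*n-t^2)).card : ℤ) = ∑ g ∈ GG (4*n-t^2), t^2 := by
    intro t _; rw [sum_const, nsmul_eq_mul, mul_comm]
  rw [sum_congr rfl e1, sum_sigma']
  have e2 : SY n L K (fij 1 m) = ∑ q ∈ (Y n L K).filter (fun q => ((q.1-q.2.1)%3 = 1 ∧ (q.1+q.2.1)%3 = m) ∧ Gp (q.1-q.2.1) q.2.2.1 q.2.2.2), (q.1+q.2.1)^2 := by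
    unfold SY; rw [sum_filter]; refine sum_congr rfl fun q _ => ?_
    simp only [fij, fgi, gi]
    split_ifs <;> first | tauto | simp
  rw [e2]
  refine sum_bij' (fun (g : (_ : ℤ) × (ℤ × ℤ × ℤ)) _ => (((g.1 + g.2.1)/2, (g.1-g.2.1)/2, g.2.1.sign * g.2.2.1, g.2.1.sign * g.2.2.2) : ℤ × ℤ × ℤ × ℤ))
    (fun q _ => (⟨q.1+q.2.1, (q.1-q.2.1, (q.1-q.2.1).sign*q.2.2.1, (q.1-q.2.1).sign*q.2.2.2)⟩ : (_ : ℤ) × (ℤ × ℤ × ℤ))) ?_ ?_ ?_ ?_ ?_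
  · rintro ⟨t, k, b, c⟩ hg
    simp only [mem_sigma, mem_filter, mem_Icc, mem_GG] at hg
    obtain ⟨⟨⟨ht1, ht2⟩, ht3⟩, hk1, hk2, hk3, hD⟩ := hg
    have hk0 : k ≠ 0 := by omega
    have hp : (t - k) % 2 = 0 := by
      rcases Int.emod_two_eq_zero_or_one t with h | h <;> rcases Int.emod_two_eq_zero_or_one k with h' | h' <;> first | omega | skip
      · exfalso
        have h1 : t^2 % 2 = 0 := by simp [pow_two, Int.mul_emod, h]
        have h2 : k^2 % 2 = 1 := by simp [pow_two, Int.mul_emod, h']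
        generalize b * c = B at *
        have : 12 * b * c = 12 * (b * c) := by ring
        omega
      · exfalso
        have h1 : t^2 % 2 = 1 := by simp [pow_two, Int.mul_emod, h]
        have h2 : k^2 % 2 = 0 := by simp [pow_two, Int.mul_emod, h']
        have : 12 * b * c = 12 * (b * c) := by ring
        omega
    obtain ⟨b1, b2, b3⟩ := Gbound n t k b c hk2 hk3 hD hk0
    obtain ⟨y, hy⟩ : ∃ y, t - k = 2 * y := ⟨(t-k)/2, by omega⟩
    have hx1 : (t + k)/2 = y + k := by omega
    have hy1 : (t - k)/2 = y := by omega
    simp only [mem_filter, hx1, hy1, mem_Y]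
    have hte : t = 2 * y + k := by omega
    rw [abs_le] at b3
    have heq : (y+k)*y + 3*b*c = n := by
      rw [hte] at hD
      linarith [show 4 * ((y+k)*y) = (2*y+k)^2 - k^2 by ring]
    rcases abs_cases k with ⟨ka, kb⟩ | ⟨ka, kb⟩
    · have s1 : k.sign = 1 := Int.sign_eq_one_of_pos (by omega)
      rw [s1]; unfold YP Gp; simp only [one_mul, abs_le]
      refine ⟨⟨heq, ?_⟩, ?_, ?_⟩ <;> omega
    · have s1 : k.sign = -1 := Int.sign_eq_neg_one_of_neg (by omega)
      rw [s1]; unfold YP Gp; simp only [abs_le]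
      refine ⟨⟨by linarith, ?_⟩, ?_, ?_⟩ <;> omega
  · rintro ⟨x, y, b, c⟩ hq
    simp only [mem_filter, mem_Y] at hq
    obtain ⟨hY, ⟨h1, h2⟩, hG⟩ := hq
    have e : 12 * b * c - (x-y)^2 = 4 * n - (x+y)^2 := by linear_combination 4 * hY.1
    have hG0 : |x-y| < 3 * ((x-y).sign * b) ∧ |x-y| < 3 * ((x-y).sign * c) ∧ ((x-y).sign * b) * ((x-y).sign * c) = b * c := by
      rcases hG with ⟨g1, g2, g3⟩ | ⟨g1, g2, g3⟩
      · rw [Int.sign_eq_one_of_pos g1, abs_of_pos g1]; refine ⟨by omega, by omega, by ring⟩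
      · rw [Int.sign_eq_neg_one_of_neg g1, abs_of_neg g1]; refine ⟨by omega, by omega, by ring⟩
    have e' : 12 * ((x-y).sign * b) * ((x-y).sign * c) - (x-y)^2 = 4 * n - (x+y)^2 := by
      rw [← e, mul_assoc, hG0.2.2]; ring
    have := Gbound n (x+y) (x-y) _ _ hG0.1 hG0.2.1 e' (by omega)
    simp only [mem_sigma, mem_filter, mem_Icc, mem_GG]
    exact ⟨⟨abs_le.mp this.2.2, h2⟩, h1, hG0.1, hG0.2.1, e'⟩
  · rintro ⟨t, k, b, c⟩ hg
    simp only [mem_sigma, mem_filter, mem_Icc, mem_GG] at hg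
    obtain ⟨⟨⟨ht1, ht2⟩, ht3⟩, hk1, hk2, hk3, hD⟩ := hg
    have hk0 : k ≠ 0 := by omega
    have hp : (t - k) % 2 = 0 := by
      have h5 : (t - k) * (t + k) = 2 * (2 * (n - 3 * (b * c))) := by linear_combination hD
      have h6 : (2:ℤ) ∣ (t-k) * (t+k) := ⟨_, h5⟩
      rcases Int.prime_two.dvd_or_dvd h6 with h | h <;> omega
    have hx1 : (t + k)/2 + (t-k)/2 = t := by omega
    have hy1 : (t + k)/2 - (t-k)/2 = k := by omega
    have hs : k.sign * k.sign = 1 := by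
      rcases sgn_cases k with ⟨h, e⟩ | ⟨h, e⟩ | ⟨h, e⟩ <;> first | omega | (rw [e]; norm_num)
    simp only [hx1, hy1, ← mul_assoc, hs, one_mul]
  · rintro ⟨x, y, b, c⟩ hq
    simp only [mem_filter, mem_Y] at hq
    obtain ⟨hY, ⟨h1, h2⟩, hG⟩ := hq
    have hx1 : (x + y + (x-y))/2 = x := by omega
    have hy1 : (x + y - (x-y))/2 = y := by omega
    have hs : (x-y).sign * (x-y).sign = 1 := by
      rcases sgn_cases (x-y) with ⟨h, e⟩ | ⟨h, e⟩ | ⟨h, e⟩ <;> first | omega | (rw [e]; norm_num)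
    simp only [hx1, hy1, ← mul_assoc, hs, one_mul]
  · rintro ⟨t, k, b, c⟩ hg
    simp only [mem_sigma, mem_filter, mem_Icc, mem_GG] at hg
    obtain ⟨⟨⟨ht1, ht2⟩, ht3⟩, hk1, hk2, hk3, hD⟩ := hg
    have hp : (t - k) % 2 = 0 := by
      have h5 : (t - k) * (t + k) = 2 * (2 * (n - 3 * (b * c))) := by linear_combination hD
      have h6 : (2:ℤ) ∣ (t-k) * (t+k) := ⟨_, h5⟩
      rcases Int.prime_two.dvd_or_dvd h6 with h | h <;> omega
    have hx1 : (t + k)/2 + (t-k)/2 = t := by omega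
    simp only [hx1]

theorem HH_SY (m : ℤ) (hm : m = 1 ∨ m = 2) (n : ℕ) (hn : 0 < n) (h3 : 3 ∣ n) (L K : ℤ)
    (hL : 20 * (n:ℤ) ≤ L) (hK : 1000 * (L * L + n) ≤ K) :
    4 * HH 2 m 3 n = ((SY n L K fgi : ℤ) : ℝ) := by
  rw [HH_eq m hm n hn h3, card_fij n L K m (by exact_mod_cast hn) hL hK]
  obtain ⟨N, rfl⟩ := h3
  rw [four_fij _ L K N m (by push_cast; ring) hm]; push_cast; ring

lemma sum_symm_Icc (L : ℤ) (hL : 0 ≤ L) (h : ℤ → ℤ) :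
    ∑ t ∈ Icc (-L) L, h t = h 0 + ∑ t ∈ Ico 1 (L+1), (h t + h (-t)) := by
  induction L, hL using Int.le_induction with
  | base => simp
  | succ L hL ih =>
    have e : Icc (-(L+1)) (L+1) = insert (-(L+1)) (insert (L+1) (Icc (-L) L)) := by
      ext z; simp only [mem_Icc, mem_insert]; omega
    rw [e, sum_insert (by simp only [mem_insert, mem_Icc]; omega), sum_insert (by simp only [mem_Icc]; omega), ih,
      ← Finset.insert_Ico_right_eq_Ico_add_one (show (1:ℤ) ≤ L+1 by omega), sum_insert (by simp)]
    ring

lemma symm_sign (L c : ℤ) (hc : 0 < c) (hL : 3 * c ≤ L) (p : ℤ → Prop) [DecidablePred p]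
    (hp : ∀ t, p (-t) ↔ p t) (hp3 : ∀ t, p t → ¬ 3 ∣ t) :
    ∑ t ∈ (Icc (-L) L).filter p, (t+3*c).sign * t^2 = 2 * ∑ t ∈ (Ico 1 (3*c)).filter p, t^2 := by
  rw [sum_filter, sum_symm_Icc L (by omega)]
  have h0 : ¬ p 0 := fun h => hp3 0 h (by simp)
  rw [if_neg h0, zero_add, mul_sum]
  have e : (Ico 1 (3*c)).filter p = ((Ico 1 (L+1)).filter p).filter (fun t => t < 3*c) := by
    ext z; simp only [mem_filter, mem_Ico]; constructor
    · rintro ⟨h1, h2⟩; exact ⟨⟨by omega, h2⟩, by omega⟩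
    · rintro ⟨⟨h1, h2⟩, h3⟩; exact ⟨by omega, h2⟩
  rw [e, sum_filter, sum_filter]
  refine sum_congr rfl fun t ht => ?_
  rw [mem_Ico] at ht
  by_cases hpt : p t
  · rw [if_pos hpt, if_pos hpt, if_pos ((hp t).2 hpt)]
    have h3 := hp3 t hpt
    rw [Int.sign_eq_one_of_pos (by omega)]
    split_ifs with h
    · rw [Int.sign_eq_one_of_pos (by omega)]; ring
    · rw [Int.sign_eq_neg_one_of_neg (by omega)]; ring
  · rw [if_neg hpt, if_neg hpt, if_neg (fun h => hpt ((hp t).1 h))]; rfl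

lemma sq3 (c : ℤ) (hc : 0 < c) : ∑ t ∈ (Ico 1 (3*c)).filter (fun t => ¬ 3 ∣ t), t^2 = 6*c^3 - c := by
  rw [sum_filter]
  rw [tele (fun z => 6 * (z/3)^3 - z/3 + if z % 3 = 2 then (3*(z/3)+1)^2 else 0) _ ?_ 1 (3*c) (by omega)]
  · have h1 : 3 * c / 3 = c := by omega
    have h2 : 3 * c % 3 = 0 := by omega
    have h3 : (1:ℤ) / 3 = 0 := by norm_num
    simp [h1, h2, h3]
  · intro z
    obtain ⟨q, hq⟩ : ∃ q, q = z / 3 := ⟨_, rfl⟩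
    have : z % 3 = 0 ∨ z % 3 = 1 ∨ z % 3 = 2 := by omega
    rcases this with h | h | h
    · have hz : z = 3 * q := by omega
      have e1 : (z+1)/3 = q := by omega
      rw [if_neg (by omega), if_neg (by omega), if_neg (by omega), e1, ← hq]; ring
    · have hz : z = 3 * q + 1 := by omega
      have e1 : (z+1)/3 = q := by omega
      rw [if_pos (by omega), if_neg (by omega), if_pos (by omega), e1, ← hq, hz]; ring
    · have hz : z = 3 * q + 2 := by omega
      have e1 : (z+1)/3 = q + 1 := by omega
      rw [if_neg (by omega), if_pos (by omega), if_pos (by omega), e1, ← hq, hz]; ring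

lemma s1 (L c : ℤ) (hc : 0 < c) (hL : 3 * c ≤ L) :
    ∑ t ∈ (Icc (-L) L).filter (fun t => ¬ 3 ∣ t), (t+3*c).sign * t^2 = 12*c^3 - 2 * c := by
  rw [symm_sign L c hc hL _ (fun t => by simp) (fun t h => h), sq3 c hc]; ring

lemma reflect (L : ℤ) (p : ℤ → Prop) [DecidablePred p] (hp : ∀ t, p (-t) ↔ p t) (f : ℤ → ℤ) :
    ∑ t ∈ (Icc (-L) L).filter p, f t = ∑ t ∈ (Icc (-L) L).filter p, f (-t) := by
  refine sum_nbij' (fun t => -t) (fun t => -t) ?_ ?_ ?_ ?_ ?_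
  · intro t ht; simp only [mem_filter, mem_Icc, hp] at ht ⊢; exact ⟨by omega, ht.2⟩
  · intro t ht; simp only [mem_filter, mem_Icc, hp] at ht ⊢; exact ⟨by omega, ht.2⟩
  · intro t _; simp
  · intro t _; simp
  · intro t _; simp

lemma s3 (L c : ℤ) (hc : 0 < c) (hL : 3 * c ≤ L) :
    ∑ t ∈ (Icc (-L) L).filter (fun t => ¬ 3 ∣ t), (t-3*c).sign * t^2 = -(12*c^3 - 2 * c) := by
  rw [← s1 L c hc hL, reflect L _ (fun t => by simp), ← sum_neg_distrib]
  refine sum_congr rfl fun t _ => ?_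
  rw [show -t - 3*c = -(t+3*c) by ring, Int.sign_neg]; ring

lemma s2 (L c : ℤ) (hc : 0 < c) (hL : 3 * c ≤ L) :
    ∑ t ∈ (Icc (-L) L).filter (fun t => t % 2 = c % 2 ∧ ¬ 3 ∣ t), (3*c-t).sign * t^2 = 6*c^3 - 4 * c := by
  rw [reflect L _ (fun t => by omega)]
  have h := symm_sign L c hc hL (fun t => t % 2 = c % 2 ∧ ¬ 3 ∣ t) (fun t => by omega) (fun t h => h.2)
  have h2 := parsum3 0 1 c hc
  simp only [zero_add, one_mul, mul_zero, zero_mul] at h2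
  rw [← h2, ← h]
  refine sum_congr rfl fun t _ => ?_
  rw [show 3*c - -t = t+3*c by ring]; ring

lemma s4 (B L x w : ℤ) (hx : 0 < x) (hw : 0 < w) (hL : 3 * (x + w) ≤ L) (hB : L ≤ B) :
    ∑ c ∈ (Icc (-B) B).filter (fun c => |x+w-3*c| ≤ L), (c.sign + (w-c).sign) * (x+w-3*c)^2
      = 2*(x*w)*x - 2*(x*w)*w + 2*w^3+3*w := by
  have e : ∑ c ∈ (Icc (-B) B).filter (fun c => |x+w-3*c| ≤ L), (c.sign + (w-c).sign) * (x+w-3*c)^2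
     = ∑ c ∈ Ico 0 w, (x+w-3*c)^2 + ∑ c ∈ Ico 1 (w+1), (x+w-3*c)^2 := by
    have e1 : Ico 0 w = ((Icc (-B) B).filter (fun c => |x+w-3*c| ≤ L)).filter (fun c => 0 ≤ c ∧ c < w) := by
      ext z; simp only [mem_filter, mem_Icc, mem_Ico, abs_le]; omega
    have e2 : Ico 1 (w+1) = ((Icc (-B) B).filter (fun c => |x+w-3*c| ≤ L)).filter (fun c => 0 < c ∧ c ≤ w) := by
      ext z; simp only [mem_filter, mem_Icc, mem_Ico, abs_le]; omega
    rw [e1, e2, sum_filter (fun c => 0 ≤ c ∧ c < w), sum_filter (fun c => 0 < c ∧ c ≤ w), ← sum_add_distrib]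
    refine sum_congr rfl fun c _ => ?_
    rcases sgn_cases c with ⟨h1, g1⟩ | ⟨h1, g1⟩ | ⟨h1, g1⟩ <;>
    rcases sgn_cases (w-c) with ⟨h2, g2⟩ | ⟨h2, g2⟩ | ⟨h2, g2⟩ <;> rw [g1, g2] <;> split_ifs <;> first | omega | ring
  rw [e]
  have t1 : 2 * ∑ c ∈ Ico 0 w, (x+w-3*c)^2 = 2*w*(x+w)^2 - 6*(x+w)*(w*(w-1)) + 3*(w*(w-1)*(2*w-1)) := by
    rw [mul_sum, tele (fun z => 2*z*(x+w)^2 - 6*(x+w)*(z*(z-1)) + 3*(z*(z-1)*(2*z-1))) _ (fun z => by ring) 0 w (by omega)]; ring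
  have t2 : 2 * ∑ c ∈ Ico 1 (w+1), (x+w-3*c)^2 = 2*w*(x+w)^2 - 6*(x+w)*(w*(w+1)) + 3*(w*(w+1)*(2*w+1)) := by
    rw [mul_sum, tele (fun z => 2*z*(x+w)^2 - 6*(x+w)*(z*(z-1)) + 3*(z*(z-1)*(2*z-1))) _ (fun z => by ring) 1 (w+1) (by omega)]; ring
  have : 2 * (∑ c ∈ Ico 0 w, (x+w-3*c)^2 + ∑ c ∈ Ico 1 (w+1), (x+w-3*c)^2) = 2 * (2*(x*w)*x - 2*(x*w)*w + 2*w^3+3*w) := by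
    rw [mul_add, t1, t2]; ring
  linarith

lemma s5 (k B : ℤ) (hB : |k| ≤ B) : ∑ b ∈ Icc (k-B) B, b.sign = k := by
  rw [abs_le] at hB
  have e : Icc (k-B) B = Ico (k-B) (B+1) := by ext z; simp only [mem_Icc, mem_Ico]; omega
  rw [e, tele (fun z => max (z-1) (-z)) _ ?_ _ _ (by omega)]
  · rw [max_def, max_def]; split_ifs <;> omega
  · intro z
    rcases sgn_cases z with ⟨h1, g1⟩ | ⟨h1, g1⟩ | ⟨h1, g1⟩ <;> rw [g1, max_def, max_def] <;> split_ifs <;> omega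

lemma SY_neg (n L K : ℤ) (f : ℤ → ℤ → ℤ → ℤ → ℤ) : SY n L K f = SY n L K (fun x y b c => f (-x) (-y) (-b) (-c)) := Y_neg n L K f
lemma SY_W (n L K : ℤ) (f : ℤ → ℤ → ℤ → ℤ → ℤ) : SY n L K f = SY n L K (fun x y b c => f y x (-c) (-b)) := Y_W n L K f

lemma pb (x y n : ℤ) (hx : 0 < x) (hy : 0 < y) (h : x * y = n) : x ≤ n ∧ y ≤ n := by
  constructor <;> nlinarith

lemma Y_c0 (n L K : ℤ) (hn : 0 < n) (hL : 20 * n ≤ L) (hK : 1000 * (L * L + n) ≤ K) (h : ℤ → ℤ → ℤ → ℤ) :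
    SY n L K (fun x y b c => if c = 0 ∧ 0 < x then h x y b else 0) =
      ∑ p ∈ P1 n, ∑ b ∈ Icc ((p.1-p.2) - (K+2*(p.1-p.2))/4) ((K+2*(p.1-p.2))/4), h p.1 p.2 b := by
  have hKn : 1000 * n ≤ K := by nlinarith
  unfold SY
  rw [sum_sigma', ← sum_filter]
  refine sum_bij' (fun q _ => (⟨(q.1, q.2.1), q.2.2.1⟩ : (_ : ℤ × ℤ) × ℤ))
    (fun (g : (_ : ℤ × ℤ) × ℤ) _ => ((g.1.1, g.1.2, g.2, 0) : Q4)) ?_ ?_ ?_ ?_ ?_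
  · rintro ⟨x, y, b, c⟩ hq
    simp only [mem_filter, mem_Y] at hq
    obtain ⟨hY, rfl, hx⟩ := hq
    simp only [mem_sigma, mem_P1, mem_Icc]
    unfold YP at hY
    simp only [abs_le] at hY
    have h1 : x * y = n := by linarith [hY.1]
    have hy : 0 < y := by
      by_contra hh; push Not at hh; nlinarith
    have h2 := hY.2
    refine ⟨⟨hx, hy, h1, hY.2.1⟩, ?_⟩
    omega
  · rintro ⟨⟨x, y⟩, b⟩ hg
    simp only [mem_sigma, mem_P1, mem_Icc] at hg
    obtain ⟨⟨hx, hy, h1, h3⟩, h4⟩ := hg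
    have := pb x y n hx hy h1
    simp only [mem_filter, mem_Y]
    unfold YP
    simp only [abs_le]
    refine ⟨⟨by linarith, h3, ?_⟩, trivial, hx⟩
    omega
  · rintro ⟨x, y, b, c⟩ hq
    simp only [mem_filter, mem_Y] at hq
    obtain ⟨hY, rfl, hx⟩ := hq
    rfl
  · rintro ⟨⟨x, y⟩, b⟩ hg
    rfl
  · rintro ⟨x, y, b, c⟩ hq
    rfl

lemma Y_double (n L K : ℤ) (f : ℤ → ℤ → ℤ → ℤ → ℤ)
    (hf : ∀ x y b c, f (-x) (-y) (-b) (-c) = f x y b c) (h0 : ∀ x y b c, (x,y,b,c) ∈ Y n L K → x = 0 → f x y b c = 0) :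
    SY n L K f = 2 * SY n L K (fun x y b c => if 0 < x then f x y b c else 0) := by
  have h1 : SY n L K f = SY n L K (fun x y b c => if 0 < x then f x y b c else 0)
      + SY n L K (fun x y b c => if x < 0 then f x y b c else 0) := by
    unfold SY; rw [← sum_add_distrib]
    refine sum_congr rfl ?_
    rintro ⟨x, y, b, c⟩ hq
    have := h0 x y b c hq
    simp only
    split_ifs with h h' h'
    · omega
    · simp
    · simp
    · rw [this (by omega)]; rfl
  have h2 : SY n L K (fun x y b c => if x < 0 then f x y b c else 0) = SY n L K (fun x y b c => if 0 < x then f x y b c else 0) := by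
    refine (SY_neg n L K _).trans ?_
    unfold SY
    refine sum_congr rfl ?_
    rintro ⟨x, y, b, c⟩ hq
    simp only [hf, Left.neg_neg_iff]
  linarith

def F1 (x y b c : ℤ) : ℤ := (x+y)^2 * (phi (x-y) b c - 2 * (x.sign * c.sign))

lemma phi_neg (k b c : ℤ) : phi (-k) (-b) (-c) = phi k b c := by
  unfold phi; simp only [Int.sign_neg]; ring

/-- F1 nonzero with b c nonzero forces bounds -/
lemma F1_bound (n L x y b c : ℤ) (hn : 0 < n) (hL : 20 * n ≤ L) (h : x*y+3*b*c = n) (h3 : ¬ 3 ∣ x - y) (ht : |x+y| ≤ L) (hb : b ≠ 0) (hc : c ≠ 0)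
    (hF : F1 x y b c ≠ 0) : |x-y| ≤ L ∧ |b| ≤ L*L+n ∧ |c| ≤ L*L+n := by
  have hk : |x-y| ≤ |x+y| := by
    by_contra hh
    push Not at hh
    have h4 : 0 < b * c := by
      have h5 : (x+y)^2 < (x-y)^2 := sq_lt_sq.2 hh
      nlinarith
    apply hF
    have hs : x.sign = (x-y).sign := by
      rcases abs_cases (x-y) with ⟨a1, a2⟩ | ⟨a1, a2⟩ <;> rcases abs_cases (x+y) with ⟨a3, a4⟩ | ⟨a3, a4⟩ <;>
      first
      | (rw [Int.sign_eq_one_of_pos (show 0 < x by omega), Int.sign_eq_one_of_pos (by omega)])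
      | (rw [Int.sign_eq_neg_one_of_neg (show x < 0 by omega), Int.sign_eq_neg_one_of_neg (by omega)])
    have hs2 : b.sign = c.sign := by
      rcases pos_and_pos_or_neg_and_neg_of_mul_pos h4 with ⟨u, v⟩ | ⟨u, v⟩
      · rw [Int.sign_eq_one_of_pos u, Int.sign_eq_one_of_pos v]
      · rw [Int.sign_eq_neg_one_of_neg u, Int.sign_eq_neg_one_of_neg v]
    unfold F1 phi; rw [hs, hs2]; ring
  have hk2 : |x-y| ≤ L := le_trans hk ht
  have h5 : |x-y| * |x-y| = (x-y)^2 := by rw [abs_mul_abs_self]; ring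
  have h6 : |x+y| * |x+y| = (x+y)^2 := by rw [abs_mul_abs_self]; ring
  have h7 := abs_nonneg (x-y)
  have h8 := abs_nonneg (x+y)
  have hbc : |b| * |c| ≤ L * L + n := by
    rw [← abs_mul, abs_le]
    constructor <;> nlinarith
  have hb1 := Int.one_le_abs hb
  have hc1 := Int.one_le_abs hc
  refine ⟨hk2, by nlinarith, by nlinarith⟩

def bnd (L n x y b c : ℤ) : Prop := |x-y| ≤ L ∧ |b| ≤ L*L+n ∧ |c| ≤ L*L+n ∧ b ≠ 0 ∧ c ≠ 0

instance (L n x y b c : ℤ) : Decidable (bnd L n x y b c) := by unfold bnd; infer_instance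

lemma F1_sum (n L K : ℤ) (hn : 0 < n) (hL : 20 * n ≤ L) (hK : 1000 * (L * L + n) ≤ K) :
    SY n L K F1 = 4 * ∑ p ∈ P1 n, (p.1+p.2)^2 * |p.1-p.2| := by
  have hKn : 1000 * n ≤ K := by nlinarith
  have hLL : 0 ≤ L * L := mul_self_nonneg L
  have hL2 : L ≤ L * L := by nlinarith
  have d : SY n L K F1 = SY n L K (fun x y b c => if c = 0 then F1 x y b c else 0) +
     SY n L K (fun x y b c => if b = 0 then F1 x y b c else 0) +
     SY n L K (fun x y b c => if bnd L n x y b c then F1 x y b c else 0) := by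
    unfold SY; simp only [← sum_add_distrib]
    refine sum_congr rfl ?_
    rintro ⟨x, y, b, c⟩ hq
    rw [mem_Y] at hq
    simp only
    by_cases hc : c = 0
    · rw [if_pos hc, if_neg (c := bnd _ _ _ _ _ _) (fun h => h.2.2.2.2 hc)]
      by_cases hb : b = 0
      · rw [hc, hb]; simp [F1, phi]
      · rw [if_neg hb]; ring
    · rw [if_neg hc]
      by_cases hb : b = 0
      · rw [if_pos hb, if_neg (c := bnd _ _ _ _ _ _) (fun h => h.2.2.2.1 hb)]; ring
      · rw [if_neg hb]
        by_cases hF : F1 x y b c = 0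
        · rw [hF]; simp
        · have := F1_bound n L x y b c hn hL hq.1 hq.2.1 hq.2.2.1 hb hc hF
          rw [if_pos ⟨this.1, this.2.1, this.2.2, hb, hc⟩]; ring
  have z : SY n L K (fun x y b c => if bnd L n x y b c then F1 x y b c else 0) = 0 := by
    have : SY n L K (fun x y b c => if bnd L n x y b c then F1 x y b c else 0) =
      - SY n L K (fun x y b c => if bnd L n x y b c then F1 x y b c else 0) := by
      unfold SY
      rw [← sum_neg_distrib]
      have e : ∀ q : Q4, (-if bnd L n q.1 q.2.1 q.2.2.1 q.2.2.2 then F1 q.1 q.2.1 q.2.2.1 q.2.2.2 else 0)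
         = (if bnd L n q.1 q.2.1 q.2.2.1 q.2.2.2 then -F1 q.1 q.2.1 q.2.2.1 q.2.2.2 else 0) := by
        intro q; split_ifs <;> simp
      simp only [e]
      rw [← sum_filter, ← sum_filter]
      refine sum_nbij' (fun q => (q.1, q.2.1, -q.2.2.1, -q.2.2.2)) (fun q => (q.1, q.2.1, -q.2.2.1, -q.2.2.2)) ?_ ?_ ?_ ?_ ?_
      · rintro ⟨x, y, b, c⟩ h
        simp only [mem_filter, mem_Y] at h ⊢
        unfold YP bnd at h ⊢
        simp only [abs_le] at h ⊢
        refine ⟨⟨by linear_combination h.1.1, ?_⟩, ?_⟩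
        · have := h.1.2
          have := h.2
          omega
        · have := h.2; omega
      · rintro ⟨x, y, b, c⟩ h
        simp only [mem_filter, mem_Y] at h ⊢
        unfold YP bnd at h ⊢
        simp only [abs_le] at h ⊢
        refine ⟨⟨by linear_combination h.1.1, ?_⟩, ?_⟩
        · have := h.1.2
          have := h.2
          omega
        · have := h.2; omega
      · rintro ⟨x, y, b, c⟩ h; simp
      · rintro ⟨x, y, b, c⟩ h; simp
      · rintro ⟨x, y, b, c⟩ h
        simp only [F1, phi, Int.sign_neg]; ring
    linarith
  have w : SY n L K (fun x y b c => if b = 0 then F1 x y b c else 0) =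
      SY n L K (fun x y b c => if c = 0 then (x+y)^2 * (((x-y).sign + 2 * y.sign) * b.sign) else 0) := by
    refine (SY_W n L K _).trans ?_
    unfold SY
    refine sum_congr rfl ?_
    rintro ⟨x, y, b, c⟩ hq
    simp only [neg_eq_zero]
    split_ifs with h
    · rw [h]; simp only [F1, phi, Int.sign_neg, neg_zero, Int.sign_zero]
      rw [show y - x = -(x-y) by ring, Int.sign_neg]; ring
    · rfl
  have d2 : SY n L K F1 = SY n L K (fun x y b c => if c = 0 then (x+y)^2 * ((2*(x-y).sign + 2 * y.sign) * b.sign) else 0) := by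
    rw [d, z, w, add_zero]
    unfold SY; rw [← sum_add_distrib]
    refine sum_congr rfl ?_
    rintro ⟨x, y, b, c⟩ hq
    simp only
    split_ifs with h
    · rw [h]; simp only [F1, phi, Int.sign_zero]; ring
    · rfl
  rw [d2, Y_double]
  · have e : SY n L K (fun x y b c => if 0 < x then (if c = 0 then (x+y)^2 * ((2*(x-y).sign + 2 * y.sign) * b.sign) else 0) else 0) = 
      SY n L K (fun x y b c => if c = 0 ∧ 0 < x then (x+y)^2 * ((2*(x-y).sign + 2 * y.sign) * b.sign) else 0) := by
      unfold SY
      refine sum_congr rfl ?_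
      rintro ⟨x, y, b, c⟩ hq
      simp only
      split_ifs <;> first | rfl | tauto
    rw [e, Y_c0 n L K hn hL hK (fun x y b => (x+y)^2 * ((2*(x-y).sign + 2 * y.sign) * b.sign))]
    have e2 : ∑ p ∈ P1 n, ∑ b ∈ Icc ((p.1-p.2) - (K+2*(p.1-p.2))/4) ((K+2*(p.1-p.2))/4), (p.1+p.2)^2 * ((2*(p.1-p.2).sign + 2 * p.2.sign) * b.sign)
       = ∑ p ∈ P1 n, (2 * ((p.1+p.2)^2 * |p.1-p.2|) + 2 * ((p.1+p.2)^2 * (p.1-p.2))) := by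
      refine sum_congr rfl ?_
      rintro ⟨x, y⟩ hp
      rw [mem_P1] at hp
      have hb := pb x y n hp.1 hp.2.1 hp.2.2.1
      simp only [← mul_sum]
      rw [s5 (x-y) _ (by rw [abs_le]; omega), Int.sign_eq_one_of_pos hp.2.1]
      have : (x-y).sign * (x-y) = |x-y| := Int.sign_mul_self_eq_abs _
      rw [← this]; ring
    rw [e2, sum_add_distrib, ← mul_sum, ← mul_sum]
    have e3 : ∑ p ∈ P1 n, (p.1+p.2)^2 * (p.1-p.2) = 0 := by
      have := P1_swap n (fun x y => (x+y)^2 * (x-y))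
      have h2 : ∑ p ∈ P1 n, (p.2+p.1)^2 * (p.2-p.1) = - ∑ p ∈ P1 n, (p.1+p.2)^2 * (p.1-p.2) := by
        rw [← sum_neg_distrib]; refine sum_congr rfl fun p _ => by ring
      linarith
    rw [e3]; ring
  · intro x y b c
    simp only [neg_eq_zero]
    rw [show -x - -y = -(x-y) by ring]
    simp only [Int.sign_neg]
    split_ifs <;> ring
  · intro x y b c hq hx
    rw [mem_Y] at hq
    split_ifs with h
    · exfalso; have := hq.1; rw [hx, h] at this; linarith
    · rfl

def F2 (x y b c : ℤ) : ℤ := (x+y)^2 * (x.sign * c.sign - (x-b).sign * (3*c+y).sign)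

lemma F2_c0 (n L K : ℤ) (hn : 0 < n) (hL : 20 * n ≤ L) (hK : 1000 * (L * L + n) ≤ K) :
    SY n L K (fun x y b c => if c = 0 then F2 x y b c else 0) = -2 * ∑ p ∈ P1 n, (p.1+p.2)^3 := by
  have hKn : 1000 * n ≤ K := by nlinarith
  rw [Y_double]
  · have e : SY n L K (fun x y b c => if 0 < x then (if c = 0 then F2 x y b c else 0) else 0) = 
      SY n L K (fun x y b c => if c = 0 ∧ 0 < x then F2 x y b 0 else 0) := by
      unfold SY
      refine sum_congr rfl ?_
      rintro ⟨x, y, b, c⟩ hq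
      simp only
      by_cases hc : c = 0
      · rw [hc]; simp
      · simp [hc]
    rw [e, Y_c0 n L K hn hL hK (fun x y b => F2 x y b 0)]
    rw [mul_sum, mul_sum]
    refine sum_congr rfl ?_
    rintro ⟨x, y⟩ hp
    rw [mem_P1] at hp
    have hb := pb x y n hp.1 hp.2.1 hp.2.2.1
    have e2 : ∑ b ∈ Icc ((x-y) - (K+2*(x-y))/4) ((K+2*(x-y))/4), F2 x y b 0 =
      ∑ b ∈ Icc ((x+y) - (K+2*(x+y))/4) ((K+2*(x+y))/4), -(x+y)^2 * b.sign := by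
      refine sum_nbij' (fun b => x - b) (fun b => x - b) ?_ ?_ ?_ ?_ ?_
      · intro b h; simp only [mem_Icc] at h ⊢; omega
      · intro b h; simp only [mem_Icc] at h ⊢; omega
      · intro b h; ring
      · intro b h; ring
      · intro b h; simp only [F2]; rw [show 3 * 0 + y = y by ring, Int.sign_eq_one_of_pos hp.2.1, Int.sign_zero]; ring
    rw [e2, ← mul_sum, s5 (x+y) _ (by rw [abs_le]; omega)]; ring
  · intro x y b c
    simp only [neg_eq_zero, F2]
    rw [show -x - -b = -(x-b) by ring, show 3 * -c + -y = -(3*c+y) by ring]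
    simp only [Int.sign_neg]
    split_ifs <;> ring
  · intro x y b c hq hx
    rw [mem_Y] at hq
    split_ifs with h
    · exfalso; have := hq.1; rw [hx, h] at this; linarith
    · rfl

def UP (n L t1 t2 t3 t4 a b c d : ℤ) : Prop :=
  a*b-3*c*d = n ∧ ¬ 3 ∣ a - b ∧ |t1*a+t2*b+t3*c+t4*d| ≤ L ∧ |a| ≤ 2*L ∧ |b| ≤ 2*L ∧ |c| ≤ 2*L ∧ |d| ≤ 2*L

open Classical in
noncomputable def U (n L t1 t2 t3 t4 : ℤ) : Finset Q4 :=
  ((Icc (-(2*L)) (2*L)) ×ˢ (Icc (-(2*L)) (2*L)) ×ˢ (Icc (-(2*L)) (2*L)) ×ˢ (Icc (-(2*L)) (2*L))).filter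
   (fun q => UP n L t1 t2 t3 t4 q.1 q.2.1 q.2.2.1 q.2.2.2)

lemma mem_U (n L t1 t2 t3 t4 a b c d : ℤ) : (a,b,c,d) ∈ U n L t1 t2 t3 t4 ↔ UP n L t1 t2 t3 t4 a b c d := by
  simp only [U, mem_filter, mem_product, mem_Icc, and_iff_right_iff_imp]
  unfold UP
  simp only [abs_le]
  omega

noncomputable def SU (n L t1 t2 t3 t4 : ℤ) (f : ℤ → ℤ → ℤ → ℤ → ℤ) : ℤ :=
  ∑ q ∈ U n L t1 t2 t3 t4, f q.1 q.2.1 q.2.2.1 q.2.2.2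

def FF (t1 t2 t3 t4 a b c d : ℤ) : ℤ := (t1*a+t2*b+t3*c+t4*d)^2 * (a.sign * c.sign - d.sign * b.sign)

lemma UP_neg (n L t1 t2 t3 t4 a b c d : ℤ) (h : UP n L t1 t2 t3 t4 a b c d) : UP n L t1 t2 t3 t4 (-a) (-b) (-c) (-d) := by
  obtain ⟨h1, h2, h3, h4, h5, h6, h7⟩ := h
  refine ⟨by linear_combination h1, by omega, ?_, by rwa [abs_neg], by rwa [abs_neg], by rwa [abs_neg], by rwa [abs_neg]⟩
  rw [show t1 * -a + t2 * -b + t3 * -c + t4 * -d = -(t1*a+t2*b+t3*c+t4*d) by ring, abs_neg]; exact h3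

lemma SU_neg (n L t1 t2 t3 t4 : ℤ) (f : ℤ → ℤ → ℤ → ℤ → ℤ) :
    SU n L t1 t2 t3 t4 f = SU n L t1 t2 t3 t4 (fun a b c d => f (-a) (-b) (-c) (-d)) := by
  unfold SU
  symm
  refine sum_nbij' (fun q => (-q.1, -q.2.1, -q.2.2.1, -q.2.2.2))
    (fun q => (-q.1, -q.2.1, -q.2.2.1, -q.2.2.2)) ?_ ?_ ?_ ?_ ?_
  · rintro ⟨x, y, b, c⟩ h
    simp only [mem_U] at h ⊢
    exact UP_neg _ _ _ _ _ _ _ _ _ _ h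
  · rintro ⟨x, y, b, c⟩ h
    simp only [mem_U] at h ⊢
    exact UP_neg _ _ _ _ _ _ _ _ _ _ h
  · rintro ⟨x, y, b, c⟩ h
    simp
  · rintro ⟨x, y, b, c⟩ h
    simp
  · rintro ⟨x, y, b, c⟩ h; rfl

lemma FF_neg (t1 t2 t3 t4 a b c d : ℤ) : FF t1 t2 t3 t4 (-a) (-b) (-c) (-d) = FF t1 t2 t3 t4 a b c d := by
  unfold FF; simp only [Int.sign_neg]; ring

lemma SU_double (n L t1 t2 t3 t4 : ℤ) (p : ℤ → ℤ → ℤ → ℤ → Prop) (u : ℤ → ℤ → ℤ → ℤ → ℤ)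
    [∀ a b c d, Decidable (p a b c d)]
    (hp : ∀ a b c d, p (-a) (-b) (-c) (-d) ↔ p a b c d)
    (hu : ∀ a b c d, u (-a) (-b) (-c) (-d) = - u a b c d)
    (h0 : ∀ a b c d, UP n L t1 t2 t3 t4 a b c d → p a b c d → u a b c d = 0 → False) :
    SU n L t1 t2 t3 t4 (fun a b c d => if p a b c d then FF t1 t2 t3 t4 a b c d else 0) =
      2 * SU n L t1 t2 t3 t4 (fun a b c d => if p a b c d ∧ 0 < u a b c d then FF t1 t2 t3 t4 a b c d else 0) := by
  have h1 : SU n L t1 t2 t3 t4 (fun a b c d => if p a b c d then FF t1 t2 t3 t4 a b c d else 0) = 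
      SU n L t1 t2 t3 t4 (fun a b c d => if p a b c d ∧ 0 < u a b c d then FF t1 t2 t3 t4 a b c d else 0)
      + SU n L t1 t2 t3 t4 (fun a b c d => if p a b c d ∧ u a b c d < 0 then FF t1 t2 t3 t4 a b c d else 0) := by
    unfold SU; rw [← sum_add_distrib]
    refine sum_congr rfl ?_
    rintro ⟨x, y, b, c⟩ hq
    rw [mem_U] at hq
    have := h0 x y b c hq
    simp only
    by_cases hP : p x y b c
    · rcases lt_trichotomy (u x y b c) 0 with h | h | h
      · simp [hP, h, not_lt_of_gt h]
      · exact (this hP h).elim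
      · simp [hP, h, not_lt_of_gt h]
    · simp [hP]
  have h2 : SU n L t1 t2 t3 t4 (fun a b c d => if p a b c d ∧ u a b c d < 0 then FF t1 t2 t3 t4 a b c d else 0) =
      SU n L t1 t2 t3 t4 (fun a b c d => if p a b c d ∧ 0 < u a b c d then FF t1 t2 t3 t4 a b c d else 0) := by
    rw [SU_neg]
    unfold SU
    refine sum_congr rfl ?_
    rintro ⟨x, y, b, c⟩ hq
    simp only [hp, hu, Left.neg_neg_iff, FF_neg]
  linarith

lemma absmul (a b n : ℤ) (hn : 0 < n) (h : a * b = n) : a ≠ 0 ∧ b ≠ 0 ∧ |a| ≤ n ∧ |b| ≤ n := by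
  have ha : a ≠ 0 := by rintro rfl; omega
  have hb : b ≠ 0 := by rintro rfl; omega
  have h1 := Int.one_le_abs ha
  have h2 := Int.one_le_abs hb
  have h3 : |a| * |b| = n := by rw [← abs_mul, h, abs_of_pos hn]
  refine ⟨ha, hb, by nlinarith, by nlinarith⟩

lemma sgn_mul_pos {a b : ℤ} (h : 0 < a * b) : a.sign = b.sign := by
  rcases pos_and_pos_or_neg_and_neg_of_mul_pos h with ⟨u, v⟩ | ⟨u, v⟩
  · rw [Int.sign_eq_one_of_pos u, Int.sign_eq_one_of_pos v]
  · rw [Int.sign_eq_neg_one_of_neg u, Int.sign_eq_neg_one_of_neg v]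

lemma sgn_mul_neg {a b : ℤ} (h : a * b < 0) : a.sign = -b.sign := by
  have : 0 < a * (-b) := by linarith [mul_neg a b]
  rw [sgn_mul_pos this, Int.sign_neg]

lemma FF_nz (n a b c d : ℤ) (hn : 0 < n) (h : a*b-3*c*d = n) (ha : a ≠ 0) (hb : b ≠ 0) (hc : c ≠ 0) (hd : d ≠ 0)
    (hF : a.sign * c.sign - d.sign * b.sign ≠ 0) : 0 < a * b ∧ c * d < 0 := by
  have hab : a * b ≠ 0 := mul_ne_zero ha hb
  have hcd : c * d ≠ 0 := mul_ne_zero hc hd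
  rcases lt_or_gt_of_ne hab with h1 | h1 <;> rcases lt_or_gt_of_ne hcd with h2 | h2
  · exfalso; apply hF; rw [sgn_mul_neg h1, sgn_mul_neg h2]; ring
  · exfalso; nlinarith
  · exact ⟨h1, h2⟩
  · exfalso; apply hF; rw [sgn_mul_pos h1, sgn_mul_pos h2]; ring

lemma FF_bound (n a b c d : ℤ) (hn : 0 < n) (h : a*b-3*c*d = n) (h3 : ¬ 3 ∣ a - b) 
    (hF : a.sign * c.sign - d.sign * b.sign ≠ 0) :
    (a = 0 ∧ b ≠ 0 ∧ c ≠ 0 ∧ d ≠ 0 ∧ |c| ≤ n ∧ |d| ≤ n) ∨ (b = 0 ∧ a ≠ 0 ∧ c ≠ 0 ∧ d ≠ 0 ∧ |c| ≤ n ∧ |d| ≤ n) ∨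
    (c = 0 ∧ a ≠ 0 ∧ b ≠ 0 ∧ d ≠ 0 ∧ |a| ≤ n ∧ |b| ≤ n) ∨ (d = 0 ∧ a ≠ 0 ∧ b ≠ 0 ∧ c ≠ 0 ∧ |a| ≤ n ∧ |b| ≤ n) ∨
    (a ≠ 0 ∧ b ≠ 0 ∧ c ≠ 0 ∧ d ≠ 0 ∧ |a| ≤ n ∧ |b| ≤ n ∧ |c| ≤ n ∧ |d| ≤ n) := by
  by_cases ha : a = 0
  · left
    have := absmul (-3*c) d n hn (by rw [ha] at h; linarith)
    refine ⟨ha, by rintro rfl; omega, by omega, by omega, ?_, by omega⟩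
    have := this.2.2.1
    rw [abs_le] at this ⊢; omega
  by_cases hb : b = 0
  · right; left
    have := absmul (-3*c) d n hn (by rw [hb] at h; linarith)
    refine ⟨hb, ha, by omega, by omega, ?_, by omega⟩
    have := this.2.2.1
    rw [abs_le] at this ⊢; omega
  by_cases hc : c = 0
  · right; right; left
    have := absmul a b n hn (by rw [hc] at h; linarith)
    refine ⟨hc, ha, hb, ?_, this.2.2⟩
    rintro rfl; apply hF; rw [hc]; simp
  by_cases hd : d = 0
  · right; right; right; left
    have := absmul a b n hn (by rw [hd] at h; linarith)
    exact ⟨hd, ha, hb, hc, this.2.2⟩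
  right; right; right; right
  obtain ⟨h1, h2⟩ := FF_nz n a b c d hn h ha hb hc hd hF
  have h4 := absmul a b _ h1 rfl
  have h5 := absmul c (-d) (-(c*d)) (by linarith) (by ring)
  rw [abs_neg] at h5
  refine ⟨ha, hb, hc, hd, ?_, ?_, ?_, ?_⟩ <;> nlinarith

lemma SU_split (n L t1 t2 t3 t4 : ℤ) (hn : 0 < n) :
    SU n L t1 t2 t3 t4 (FF t1 t2 t3 t4) =
      SU n L t1 t2 t3 t4 (fun a b c d => if a = 0 then FF t1 t2 t3 t4 a b c d else 0)
    + SU n L t1 t2 t3 t4 (fun a b c d => if b = 0 then FF t1 t2 t3 t4 a b c d else 0)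
    + SU n L t1 t2 t3 t4 (fun a b c d => if c = 0 ∧ d ≠ 0 then FF t1 t2 t3 t4 a b c d else 0)
    + SU n L t1 t2 t3 t4 (fun a b c d => if d = 0 ∧ c ≠ 0 then FF t1 t2 t3 t4 a b c d else 0)
    + SU n L t1 t2 t3 t4 (fun a b c d => if 0 < a * b ∧ c * d < 0 then FF t1 t2 t3 t4 a b c d else 0) := by
  unfold SU; simp only [← sum_add_distrib]
  refine sum_congr rfl ?_
  rintro ⟨a, b, c, d⟩ hq
  rw [mem_U] at hq
  by_cases hF : a.sign * c.sign - d.sign * b.sign = 0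
  · simp [FF, hF]
  · simp only
    rcases FF_bound n a b c d hn hq.1 hq.2.1 hF with h | h | h | h | h
    · simp [h]
    · simp [h]
    · simp [h]
    · simp [h]
    · have := FF_nz n a b c d hn hq.1 h.1 h.2.1 h.2.2.1 h.2.2.2.1 hF
      simp [h, this]

lemma SU_E (n L t1 t2 t3 t4 : ℤ) (hn : 0 < n) (hL : 20 * n ≤ L) (h1 : |t1| ≤ 3) (h2 : |t2| ≤ 3) (h3 : |t3| ≤ 3) (h4 : |t4| ≤ 3) :
    SU n L t1 t2 t3 t4 (fun a b c d => if 0 < a * b ∧ c * d < 0 then FF t1 t2 t3 t4 a b c d else 0)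
     = 16 * ∑ q ∈ PP n, (t1*q.1+t2*q.2.1)*(t3*q.2.2.1-t4*q.2.2.2) := by
  have e : ∀ q : Q4, 16 * ((t1*q.1+t2*q.2.1)*(t3*q.2.2.1-t4*q.2.2.2)) = 
     ∑ e ∈ (({1,-1} : Finset ℤ) ×ˢ ({1,-1} : Finset ℤ)), (e.1 * (t1*q.1+t2*q.2.1) + e.2 * (t3*q.2.2.1-t4*q.2.2.2))^2 * (2 * (e.1 * e.2)) := by
    intro q
    rw [sum_product, sum_pair (by norm_num), sum_pair (by norm_num), sum_pair (by norm_num)]; ring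
  rw [mul_sum, sum_congr rfl (fun q _ => e q), ← sum_product' (f := fun (q : Q4) (e : ℤ × ℤ) => (e.1 * (t1*q.1+t2*q.2.1) + e.2 * (t3*q.2.2.1-t4*q.2.2.2))^2 * (2 * (e.1 * e.2)))]
  unfold SU
  rw [← sum_filter]
  refine sum_bij' (fun (q : Q4) _ => (((|q.1|, |q.2.1|, |q.2.2.1|, |q.2.2.2|), (q.1.sign, q.2.2.1.sign)) : Q4 × (ℤ × ℤ)))
    (fun (g : Q4 × (ℤ × ℤ)) _ => ((g.2.1 * g.1.1, g.2.1 * g.1.2.1, g.2.2 * g.1.2.2.1, -(g.2.2 * g.1.2.2.2)) : Q4)) ?_ ?_ ?_ ?_ ?_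
  · rintro ⟨a, b, c, d⟩ hq
    simp only [mem_filter, mem_U] at hq
    obtain ⟨hU, hab, hcd⟩ := hq
    have ha : a ≠ 0 := by rintro rfl; simp at hab
    have hb : b ≠ 0 := by rintro rfl; simp at hab
    have hc : c ≠ 0 := by rintro rfl; simp at hcd
    have hd : d ≠ 0 := by rintro rfl; simp at hcd
    have e1 : |a| * |b| = a * b := by rw [← abs_mul, abs_of_pos hab]
    have e2 : |c| * |d| = -(c * d) := by rw [← abs_mul, abs_of_neg hcd]
    simp only [mem_product, mem_PP]
    refine ⟨⟨abs_pos.2 ha, abs_pos.2 hb, abs_pos.2 hc, abs_pos.2 hd, ?_, ?_⟩, ?_, ?_⟩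
    · rw [mul_assoc, e1, e2]; linarith [hU.1]
    · have := hU.2.1
      rcases pos_and_pos_or_neg_and_neg_of_mul_pos hab with ⟨u, v⟩ | ⟨u, v⟩
      · rw [abs_of_pos u, abs_of_pos v]; exact this
      · rw [abs_of_neg u, abs_of_neg v]; omega
    · rcases sgn_cases a with ⟨h, e⟩ | ⟨h, e⟩ | ⟨h, e⟩ <;> first | omega | simp [e]
    · rcases sgn_cases c with ⟨h, e⟩ | ⟨h, e⟩ | ⟨h, e⟩ <;> first | omega | simp [e]
  · rintro ⟨⟨x, C, c, X⟩, ⟨ε, η⟩⟩ hg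
    simp only [mem_product, mem_PP, mem_insert, mem_singleton] at hg
    obtain ⟨⟨hx, hC, hc, hX, he, h3'⟩, hε, hη⟩ := hg
    have b1 := pb x C (x*C) hx hC rfl
    have b2 := pb c X (c*X) hc hX rfl
    have hxC : 0 < x * C := mul_pos hx hC
    have hcX : 0 < c * X := mul_pos hc hX
    have b3 : x ≤ n ∧ C ≤ n ∧ c ≤ n ∧ X ≤ n := by
      refine ⟨?_, ?_, ?_, ?_⟩ <;> nlinarith
    have bt : ∀ a b c d : ℤ, |a| ≤ n → |b| ≤ n → |c| ≤ n → |d| ≤ n → |t1*a+t2*b+t3*c+t4*d| ≤ L := by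
      intro a b c d ha hb hc hd
      have m1 : |t1*a| ≤ 3 * n := by rw [abs_mul]; exact mul_le_mul h1 ha (abs_nonneg _) (by norm_num)
      have m2 : |t2*b| ≤ 3 * n := by rw [abs_mul]; exact mul_le_mul h2 hb (abs_nonneg _) (by norm_num)
      have m3 : |t3*c| ≤ 3 * n := by rw [abs_mul]; exact mul_le_mul h3 hc (abs_nonneg _) (by norm_num)
      have m4 : |t4*d| ≤ 3 * n := by rw [abs_mul]; exact mul_le_mul h4 hd (abs_nonneg _) (by norm_num)
      rw [abs_le] at *
      omega
    have hε2 : ε * ε = 1 := by rcases hε with rfl | rfl <;> norm_num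
    have hη2 : η * η = 1 := by rcases hη with rfl | rfl <;> norm_num
    have c1 : |ε * x| ≤ n := by rcases hε with rfl | rfl <;> rw [abs_le] <;> constructor <;> linarith
    have c2 : |ε * C| ≤ n := by rcases hε with rfl | rfl <;> rw [abs_le] <;> constructor <;> linarith
    have c3 : |η * c| ≤ n := by rcases hη with rfl | rfl <;> rw [abs_le] <;> constructor <;> linarith
    have c4 : |-(η * X)| ≤ n := by rcases hη with rfl | rfl <;> rw [abs_le] <;> constructor <;> linarith
    simp only [mem_filter, mem_U]
    refine ⟨⟨by linear_combination he + x * C * hε2 + 3 * c * X * hη2, ?_, bt _ _ _ _ c1 c2 c3 c4, by linarith, by linarith, by linarith, by linarith⟩, ?_, ?_⟩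
    · rcases hε with rfl | rfl <;> omega
    · have : ε * x * (ε * C) = x * C := by linear_combination x * C * hε2
      rw [this]; exact hxC
    · have : η * c * (-(η * X)) = -(c * X) := by linear_combination -c * X * hη2
      rw [this]; linarith
  · rintro ⟨a, b, c, d⟩ hq
    simp only [mem_filter, mem_U] at hq
    obtain ⟨hU, hab, hcd⟩ := hq
    have hb : a.sign * |b| = b := by rw [sgn_mul_pos hab]; exact Int.sign_mul_abs b
    have hd : -(c.sign * |d|) = d := by rw [sgn_mul_neg hcd, neg_mul, neg_neg]; exact Int.sign_mul_abs d
    simp only [Int.sign_mul_abs, hb, hd]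
  · rintro ⟨⟨x, C, c, X⟩, ⟨ε, η⟩⟩ hg
    simp only [mem_product, mem_PP, mem_insert, mem_singleton] at hg
    obtain ⟨⟨hx, hC, hc, hX, he, h3'⟩, hε, hη⟩ := hg
    rcases hε with rfl | rfl <;> rcases hη with rfl | rfl <;>
    simp [abs_of_pos hx, abs_of_pos hC, abs_of_pos hc, abs_of_pos hX, Int.sign_eq_one_of_pos hx, Int.sign_eq_one_of_pos hc]
  · rintro ⟨a, b, c, d⟩ hq
    simp only [mem_filter, mem_U] at hq
    obtain ⟨hU, hab, hcd⟩ := hq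
    have ha : a.sign * |a| = a := Int.sign_mul_abs a
    have hc : c.sign * |c| = c := Int.sign_mul_abs c
    have hb : a.sign * |b| = b := by rw [sgn_mul_pos hab]; exact Int.sign_mul_abs b
    have hd : c.sign * |d| = -d := by rw [sgn_mul_neg hcd, neg_mul]; rw [Int.sign_mul_abs d]
    have hs1 := sgn_mul_pos hab
    have hs2 := sgn_mul_neg hcd
    simp only [FF]
    rw [show a.sign * (t1 * |a| + t2 * |b|) + c.sign * (t3 * |c| - t4 * |d|) = t1 * (a.sign * |a|) + t2 * (a.sign * |b|) + t3 * (c.sign * |c|) - t4 * (c.sign * |d|) by ring,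
      ha, hb, hc, hd, ← hs1, show d.sign = - c.sign by rw [hs2]; ring]; ring

lemma pA2 (n N L : ℤ) (hN : n = 3 * N) (hn : 0 < n) (hL : 20 * n ≤ L) :
    SU n L 1 1 (-3) 0 (fun a b c d => if a = 0 then FF 1 1 (-3) 0 a b c d else 0) =
      2 * ∑ p ∈ P0 N, ∑ t ∈ (Icc (-L) L).filter (fun t => ¬ 3 ∣ t), (t+3*p.1).sign * t^2 := by
  rw [SU_double n L 1 1 (-3) 0 (fun a b c d => a = 0) (fun a b c d => c) (fun a b c d => by simp) (fun a b c d => rfl)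
    (by intro a b c d h h1 h2; have h3 := h.1; rw [h1, h2] at h3; simp at h3; omega)]
  congr 1
  rw [sum_sigma']
  unfold SU
  rw [← sum_filter]
  refine sum_bij' (fun (q : Q4) _ => (⟨(q.2.2.1, -q.2.2.2), q.2.1-3*q.2.2.1⟩ : (_ : ℤ × ℤ) × ℤ))
    (fun (g : (_ : ℤ × ℤ) × ℤ) _ => ((0, g.2+3*g.1.1, g.1.1, -g.1.2) : Q4)) ?_ ?_ ?_ ?_ ?_
  · rintro ⟨a, b, c, d⟩ hq
    simp only [mem_filter, mem_U] at hq
    obtain ⟨hU, h0, hu⟩ := hq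
    subst h0
    obtain ⟨h1, h2, h3⟩ := hU
    simp only [mem_sigma, mem_P0, mem_filter, mem_Icc]
    obtain ⟨r1, r2⟩ : d < 0 ∧ c * (-d) = N := by
      have : c * (-d) = N := by linarith
      exact ⟨by nlinarith, this⟩
    refine ⟨?_, ?_⟩
    · exact ⟨hu, by omega, r2⟩
    · simp only [abs_le] at h3 ⊢; omega
  · rintro ⟨⟨x, w⟩, t⟩ hg
    simp only [mem_sigma, mem_P0, mem_filter, mem_Icc, abs_le] at hg
    obtain ⟨hp, ht⟩ := hg
    have hpb := pb x w N hp.1 hp.2.1 hp.2.2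
    simp only [mem_filter, mem_U]
    refine ⟨⟨?_, ?_, ?_⟩, trivial, hp.1⟩
    · linear_combination 3 * hp.2.2 - hN
    · omega
    · simp only [abs_le]; omega
  · rintro ⟨a, b, c, d⟩ hq
    simp only [mem_filter, mem_U] at hq
    obtain ⟨hU, h0, hu⟩ := hq
    refine Prod.ext ?_ (Prod.ext ?_ (Prod.ext ?_ ?_)) <;> dsimp only <;> omega
  · rintro ⟨⟨x, w⟩, t⟩ hg
    simp only [mem_sigma, mem_P0, mem_filter, mem_Icc] at hg
    refine Sigma.ext (Prod.ext ?_ ?_) (heq_of_eq ?_) <;> dsimp only <;> omega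
  · rintro ⟨a, b, c, d⟩ hq
    simp only [mem_filter, mem_U] at hq
    obtain ⟨hU, h0, hu⟩ := hq
    subst h0
    obtain ⟨h1, h2, h3⟩ := hU
    obtain ⟨r1, r2⟩ : d < 0 ∧ c * (-d) = N := by
      have : c * (-d) = N := by linarith
      exact ⟨by nlinarith, this⟩
    simp only [FF, Int.sign_zero]; rw [Int.sign_eq_neg_one_of_neg r1]
    rw [show b - 3*c + 3*c = b by ring]; ring

lemma pB2 (n N L : ℤ) (hN : n = 3 * N) (hn : 0 < n) (hL : 20 * n ≤ L) :
    SU n L 1 1 (-3) 0 (fun a b c d => if b = 0 then FF 1 1 (-3) 0 a b c d else 0) =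
      2 * ∑ p ∈ P0 N, ∑ t ∈ (Icc (-L) L).filter (fun t => ¬ 3 ∣ t), (t+3*p.1).sign * t^2 := by
  rw [SU_double n L 1 1 (-3) 0 (fun a b c d => b = 0) (fun a b c d => c) (fun a b c d => by simp) (fun a b c d => rfl)
    (by intro a b c d h h1 h2; have h3 := h.1; rw [h1, h2] at h3; simp at h3; omega)]
  congr 1
  rw [sum_sigma']
  unfold SU
  rw [← sum_filter]
  refine sum_bij' (fun (q : Q4) _ => (⟨(q.2.2.1, -q.2.2.2), q.1-3*q.2.2.1⟩ : (_ : ℤ × ℤ) × ℤ))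
    (fun (g : (_ : ℤ × ℤ) × ℤ) _ => ((g.2+3*g.1.1, 0, g.1.1, -g.1.2) : Q4)) ?_ ?_ ?_ ?_ ?_
  · rintro ⟨a, b, c, d⟩ hq
    simp only [mem_filter, mem_U] at hq
    obtain ⟨hU, h0, hu⟩ := hq
    subst h0
    obtain ⟨h1, h2, h3⟩ := hU
    simp only [mem_sigma, mem_P0, mem_filter, mem_Icc]
    obtain ⟨r1, r2⟩ : d < 0 ∧ c * (-d) = N := by
      have : c * (-d) = N := by linarith
      exact ⟨by nlinarith, this⟩
    refine ⟨?_, ?_⟩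
    · exact ⟨hu, by omega, r2⟩
    · simp only [abs_le] at h3 ⊢; omega
  · rintro ⟨⟨x, w⟩, t⟩ hg
    simp only [mem_sigma, mem_P0, mem_filter, mem_Icc, abs_le] at hg
    obtain ⟨hp, ht⟩ := hg
    have hpb := pb x w N hp.1 hp.2.1 hp.2.2
    simp only [mem_filter, mem_U]
    refine ⟨⟨?_, ?_, ?_⟩, trivial, hp.1⟩
    · linear_combination 3 * hp.2.2 - hN
    · omega
    · simp only [abs_le]; omega
  · rintro ⟨a, b, c, d⟩ hq
    simp only [mem_filter, mem_U] at hq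
    obtain ⟨hU, h0, hu⟩ := hq
    refine Prod.ext ?_ (Prod.ext ?_ (Prod.ext ?_ ?_)) <;> dsimp only <;> omega
  · rintro ⟨⟨x, w⟩, t⟩ hg
    simp only [mem_sigma, mem_P0, mem_filter, mem_Icc] at hg
    refine Sigma.ext (Prod.ext ?_ ?_) (heq_of_eq ?_) <;> dsimp only <;> omega
  · rintro ⟨a, b, c, d⟩ hq
    simp only [mem_filter, mem_U] at hq
    obtain ⟨hU, h0, hu⟩ := hq
    subst h0
    obtain ⟨h1, h2, h3⟩ := hU
    obtain ⟨r1, r2⟩ : d < 0 ∧ c * (-d) = N := by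
      have : c * (-d) = N := by linarith
      exact ⟨by nlinarith, this⟩
    simp only [FF, Int.sign_zero]; rw [Int.sign_eq_one_of_pos hu]
    rw [show a - 3*c + 3*c = a by ring]; ring

lemma pA3 (n N L : ℤ) (hN : n = 3 * N) (hn : 0 < n) (hL : 20 * n ≤ L) :
    SU n L 1 (-2) 3 (-3) (fun a b c d => if a = 0 then FF 1 (-2) 3 (-3) a b c d else 0) =
      2 * ∑ p ∈ P0 N, ∑ t ∈ (Icc (-L) L).filter (fun t => t % 2 = (p.1+p.2) % 2 ∧ ¬ 3 ∣ t), (3*(p.1+p.2)-t).sign * t^2 := by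
  rw [SU_double n L 1 (-2) 3 (-3) (fun a b c d => a = 0) (fun a b c d => c) (fun a b c d => by simp) (fun a b c d => rfl)
    (by intro a b c d h h1 h2; have h3 := h.1; rw [h1, h2] at h3; simp at h3; omega)]
  congr 1
  rw [sum_sigma']
  unfold SU
  rw [← sum_filter]
  refine sum_bij' (fun (q : Q4) _ => (⟨(q.2.2.1, -q.2.2.2), -2*q.2.1+3*q.2.2.1-3*q.2.2.2⟩ : (_ : ℤ × ℤ) × ℤ))
    (fun (g : (_ : ℤ × ℤ) × ℤ) _ => ((0, (3*(g.1.1+g.1.2)-g.2)/2, g.1.1, -g.1.2) : Q4)) ?_ ?_ ?_ ?_ ?_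
  · rintro ⟨a, b, c, d⟩ hq
    simp only [mem_filter, mem_U] at hq
    obtain ⟨hU, h0, hu⟩ := hq
    subst h0
    obtain ⟨h1, h2, h3⟩ := hU
    simp only [mem_sigma, mem_P0, mem_filter, mem_Icc]
    obtain ⟨r1, r2⟩ : d < 0 ∧ c * (-d) = N := by
      have : c * (-d) = N := by linarith
      exact ⟨by nlinarith, this⟩
    refine ⟨?_, ?_⟩
    · exact ⟨hu, by omega, r2⟩
    · simp only [abs_le] at h3 ⊢; omega
  · rintro ⟨⟨x, w⟩, t⟩ hg
    simp only [mem_sigma, mem_P0, mem_filter, mem_Icc, abs_le] at hg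
    obtain ⟨hp, ht⟩ := hg
    have hpb := pb x w N hp.1 hp.2.1 hp.2.2
    simp only [mem_filter, mem_U]
    refine ⟨⟨?_, ?_, ?_⟩, trivial, hp.1⟩
    · linear_combination 3 * hp.2.2 - hN
    · omega
    · simp only [abs_le]; omega
  · rintro ⟨a, b, c, d⟩ hq
    simp only [mem_filter, mem_U] at hq
    obtain ⟨hU, h0, hu⟩ := hq
    refine Prod.ext ?_ (Prod.ext ?_ (Prod.ext ?_ ?_)) <;> dsimp only <;> omega
  · rintro ⟨⟨x, w⟩, t⟩ hg
    simp only [mem_sigma, mem_P0, mem_filter, mem_Icc] at hg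
    refine Sigma.ext (Prod.ext ?_ ?_) (heq_of_eq ?_) <;> dsimp only <;> omega
  · rintro ⟨a, b, c, d⟩ hq
    simp only [mem_filter, mem_U] at hq
    obtain ⟨hU, h0, hu⟩ := hq
    subst h0
    obtain ⟨h1, h2, h3⟩ := hU
    obtain ⟨r1, r2⟩ : d < 0 ∧ c * (-d) = N := by
      have : c * (-d) = N := by linarith
      exact ⟨by nlinarith, this⟩
    simp only [FF, Int.sign_zero]; rw [Int.sign_eq_neg_one_of_neg r1]
    rw [show 3*(c+-d) - (-2*b+3*c-3*d) = 2 * b by ring, Int.sign_mul, show (2:ℤ).sign = 1 from rfl]; ring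

lemma pB3 (n N L : ℤ) (hN : n = 3 * N) (hn : 0 < n) (hL : 20 * n ≤ L) :
    SU n L 1 (-2) 3 (-3) (fun a b c d => if b = 0 then FF 1 (-2) 3 (-3) a b c d else 0) =
      2 * ∑ p ∈ P0 N, ∑ t ∈ (Icc (-L) L).filter (fun t => ¬ 3 ∣ t), (t-3*(p.1+p.2)).sign * t^2 := by
  rw [SU_double n L 1 (-2) 3 (-3) (fun a b c d => b = 0) (fun a b c d => c) (fun a b c d => by simp) (fun a b c d => rfl)
    (by intro a b c d h h1 h2; have h3 := h.1; rw [h1, h2] at h3; simp at h3; omega)]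
  congr 1
  rw [sum_sigma']
  unfold SU
  rw [← sum_filter]
  refine sum_bij' (fun (q : Q4) _ => (⟨(q.2.2.1, -q.2.2.2), q.1+3*q.2.2.1-3*q.2.2.2⟩ : (_ : ℤ × ℤ) × ℤ))
    (fun (g : (_ : ℤ × ℤ) × ℤ) _ => ((g.2-3*(g.1.1+g.1.2), 0, g.1.1, -g.1.2) : Q4)) ?_ ?_ ?_ ?_ ?_
  · rintro ⟨a, b, c, d⟩ hq
    simp only [mem_filter, mem_U] at hq
    obtain ⟨hU, h0, hu⟩ := hq
    subst h0
    obtain ⟨h1, h2, h3⟩ := hU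
    simp only [mem_sigma, mem_P0, mem_filter, mem_Icc]
    obtain ⟨r1, r2⟩ : d < 0 ∧ c * (-d) = N := by
      have : c * (-d) = N := by linarith
      exact ⟨by nlinarith, this⟩
    refine ⟨?_, ?_⟩
    · exact ⟨hu, by omega, r2⟩
    · simp only [abs_le] at h3 ⊢; omega
  · rintro ⟨⟨x, w⟩, t⟩ hg
    simp only [mem_sigma, mem_P0, mem_filter, mem_Icc, abs_le] at hg
    obtain ⟨hp, ht⟩ := hg
    have hpb := pb x w N hp.1 hp.2.1 hp.2.2
    simp only [mem_filter, mem_U]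
    refine ⟨⟨?_, ?_, ?_⟩, trivial, hp.1⟩
    · linear_combination 3 * hp.2.2 - hN
    · omega
    · simp only [abs_le]; omega
  · rintro ⟨a, b, c, d⟩ hq
    simp only [mem_filter, mem_U] at hq
    obtain ⟨hU, h0, hu⟩ := hq
    refine Prod.ext ?_ (Prod.ext ?_ (Prod.ext ?_ ?_)) <;> dsimp only <;> omega
  · rintro ⟨⟨x, w⟩, t⟩ hg
    simp only [mem_sigma, mem_P0, mem_filter, mem_Icc] at hg
    refine Sigma.ext (Prod.ext ?_ ?_) (heq_of_eq ?_) <;> dsimp only <;> omega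
  · rintro ⟨a, b, c, d⟩ hq
    simp only [mem_filter, mem_U] at hq
    obtain ⟨hU, h0, hu⟩ := hq
    subst h0
    obtain ⟨h1, h2, h3⟩ := hU
    obtain ⟨r1, r2⟩ : d < 0 ∧ c * (-d) = N := by
      have : c * (-d) = N := by linarith
      exact ⟨by nlinarith, this⟩
    simp only [FF, Int.sign_zero]; rw [Int.sign_eq_one_of_pos hu]
    rw [show a+3*c-3*d-3*(c+-d) = a by ring]; ring

lemma pD2 (n L : ℤ) (hn : 0 < n) (hL : 20 * n ≤ L) :
    SU n L 1 1 (-3) 0 (fun a b c d => if d = 0 then FF 1 1 (-3) 0 a b c d else 0) =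
      2 * ∑ p ∈ P1 n, ∑ t ∈ (Icc (-(2*L)) (2*L)).filter (fun t => |p.1+p.2-3*t| ≤ L), t.sign * (p.1+p.2-3*t)^2 := by
  rw [SU_double n L 1 1 (-3) 0 (fun a b c d => d = 0) (fun a b c d => a) (fun a b c d => by simp) (fun a b c d => rfl)
    (by intro a b c d h h1 h2; have h3 := h.1; rw [h1, h2] at h3; simp at h3; omega)]
  congr 1
  rw [sum_sigma']
  unfold SU
  rw [← sum_filter]
  refine sum_bij' (fun (q : Q4) _ => (⟨(q.1, q.2.1), q.2.2.1⟩ : (_ : ℤ × ℤ) × ℤ))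
    (fun (g : (_ : ℤ × ℤ) × ℤ) _ => ((g.1.1, g.1.2, g.2, 0) : Q4)) ?_ ?_ ?_ ?_ ?_
  · rintro ⟨a, b, c, d⟩ hq
    simp only [mem_filter, mem_U] at hq
    obtain ⟨hU, h0, hu⟩ := hq
    subst h0
    obtain ⟨h1, h2, h3⟩ := hU
    simp only [mem_sigma, mem_P1, mem_filter, mem_Icc]
    obtain ⟨r1, r2⟩ : 0 < b ∧ a * b = n := by
      have : a * b = n := by linarith
      exact ⟨by nlinarith, this⟩
    refine ⟨?_, ?_⟩
    · exact ⟨hu, r1, r2, h2⟩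
    · simp only [abs_le] at h3 ⊢; omega
  · rintro ⟨⟨x, w⟩, t⟩ hg
    simp only [mem_sigma, mem_P1, mem_filter, mem_Icc, abs_le] at hg
    obtain ⟨hp, ht⟩ := hg
    have hpb := pb x w n hp.1 hp.2.1 hp.2.2.1
    simp only [mem_filter, mem_U]
    refine ⟨⟨?_, ?_, ?_⟩, trivial, hp.1⟩
    · linear_combination hp.2.2.1
    · omega
    · simp only [abs_le]; omega
  · rintro ⟨a, b, c, d⟩ hq
    simp only [mem_filter, mem_U] at hq
    obtain ⟨hU, h0, hu⟩ := hq
    refine Prod.ext ?_ (Prod.ext ?_ (Prod.ext ?_ ?_)) <;> dsimp only <;> omega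
  · rintro ⟨⟨x, w⟩, t⟩ hg
    simp only [mem_sigma, mem_P1, mem_filter, mem_Icc] at hg
    refine Sigma.ext (Prod.ext ?_ ?_) (heq_of_eq ?_) <;> dsimp only <;> omega
  · rintro ⟨a, b, c, d⟩ hq
    simp only [mem_filter, mem_U] at hq
    obtain ⟨hU, h0, hu⟩ := hq
    subst h0
    obtain ⟨h1, h2, h3⟩ := hU
    obtain ⟨r1, r2⟩ : 0 < b ∧ a * b = n := by
      have : a * b = n := by linarith
      exact ⟨by nlinarith, this⟩
    simp only [FF, Int.sign_zero]; rw [Int.sign_eq_one_of_pos hu]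
    ring

lemma pD3 (n L : ℤ) (hn : 0 < n) (hL : 20 * n ≤ L) :
    SU n L 1 (-2) 3 (-3) (fun a b c d => if d = 0 then FF 1 (-2) 3 (-3) a b c d else 0) =
      2 * ∑ p ∈ P1 n, ∑ t ∈ (Icc (-(2*L)) (2*L)).filter (fun t => |p.1+p.2-3*t| ≤ L), (p.2-t).sign * (p.1+p.2-3*t)^2 := by
  rw [SU_double n L 1 (-2) 3 (-3) (fun a b c d => d = 0) (fun a b c d => a) (fun a b c d => by simp) (fun a b c d => rfl)
    (by intro a b c d h h1 h2; have h3 := h.1; rw [h1, h2] at h3; simp at h3; omega)]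
  congr 1
  rw [sum_sigma']
  unfold SU
  rw [← sum_filter]
  refine sum_bij' (fun (q : Q4) _ => (⟨(q.1, q.2.1), q.2.1-q.2.2.1⟩ : (_ : ℤ × ℤ) × ℤ))
    (fun (g : (_ : ℤ × ℤ) × ℤ) _ => ((g.1.1, g.1.2, g.1.2-g.2, 0) : Q4)) ?_ ?_ ?_ ?_ ?_
  · rintro ⟨a, b, c, d⟩ hq
    simp only [mem_filter, mem_U] at hq
    obtain ⟨hU, h0, hu⟩ := hq
    subst h0
    obtain ⟨h1, h2, h3⟩ := hU
    simp only [mem_sigma, mem_P1, mem_filter, mem_Icc]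
    obtain ⟨r1, r2⟩ : 0 < b ∧ a * b = n := by
      have : a * b = n := by linarith
      exact ⟨by nlinarith, this⟩
    refine ⟨?_, ?_⟩
    · exact ⟨hu, r1, r2, h2⟩
    · simp only [abs_le] at h3 ⊢; omega
  · rintro ⟨⟨x, w⟩, t⟩ hg
    simp only [mem_sigma, mem_P1, mem_filter, mem_Icc, abs_le] at hg
    obtain ⟨hp, ht⟩ := hg
    have hpb := pb x w n hp.1 hp.2.1 hp.2.2.1
    simp only [mem_filter, mem_U]
    refine ⟨⟨?_, ?_, ?_⟩, trivial, hp.1⟩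
    · linear_combination hp.2.2.1
    · omega
    · simp only [abs_le]; omega
  · rintro ⟨a, b, c, d⟩ hq
    simp only [mem_filter, mem_U] at hq
    obtain ⟨hU, h0, hu⟩ := hq
    refine Prod.ext ?_ (Prod.ext ?_ (Prod.ext ?_ ?_)) <;> dsimp only <;> omega
  · rintro ⟨⟨x, w⟩, t⟩ hg
    simp only [mem_sigma, mem_P1, mem_filter, mem_Icc] at hg
    refine Sigma.ext (Prod.ext ?_ ?_) (heq_of_eq ?_) <;> dsimp only <;> omega
  · rintro ⟨a, b, c, d⟩ hq
    simp only [mem_filter, mem_U] at hq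
    obtain ⟨hU, h0, hu⟩ := hq
    subst h0
    obtain ⟨h1, h2, h3⟩ := hU
    obtain ⟨r1, r2⟩ : 0 < b ∧ a * b = n := by
      have : a * b = n := by linarith
      exact ⟨by nlinarith, this⟩
    simp only [FF, Int.sign_zero]; rw [Int.sign_eq_one_of_pos hu]
    rw [show b - (b-c) = c by ring]; ring

lemma pC3 (n L : ℤ) (hn : 0 < n) (hL : 20 * n ≤ L) :
    SU n L 1 (-2) 3 (-3) (fun a b c d => if c = 0 then FF 1 (-2) 3 (-3) a b c d else 0) =
      2 * ∑ p ∈ P1 n, ∑ t ∈ (Icc (-(2*L)) (2*L)).filter (fun t => |p.1+p.2-3*t| ≤ L), (p.2-t).sign * (p.1+p.2-3*t)^2 := by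
  rw [SU_double n L 1 (-2) 3 (-3) (fun a b c d => c = 0) (fun a b c d => a) (fun a b c d => by simp) (fun a b c d => rfl)
    (by intro a b c d h h1 h2; have h3 := h.1; rw [h1, h2] at h3; simp at h3; omega)]
  congr 1
  rw [sum_sigma']
  unfold SU
  rw [← sum_filter]
  refine sum_bij' (fun (q : Q4) _ => (⟨(q.1, q.2.1), q.2.1+q.2.2.2⟩ : (_ : ℤ × ℤ) × ℤ))
    (fun (g : (_ : ℤ × ℤ) × ℤ) _ => ((g.1.1, g.1.2, 0, g.2-g.1.2) : Q4)) ?_ ?_ ?_ ?_ ?_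
  · rintro ⟨a, b, c, d⟩ hq
    simp only [mem_filter, mem_U] at hq
    obtain ⟨hU, h0, hu⟩ := hq
    subst h0
    obtain ⟨h1, h2, h3⟩ := hU
    simp only [mem_sigma, mem_P1, mem_filter, mem_Icc]
    obtain ⟨r1, r2⟩ : 0 < b ∧ a * b = n := by
      have : a * b = n := by linarith
      exact ⟨by nlinarith, this⟩
    refine ⟨?_, ?_⟩
    · exact ⟨hu, r1, r2, h2⟩
    · simp only [abs_le] at h3 ⊢; omega
  · rintro ⟨⟨x, w⟩, t⟩ hg
    simp only [mem_sigma, mem_P1, mem_filter, mem_Icc, abs_le] at hg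
    obtain ⟨hp, ht⟩ := hg
    have hpb := pb x w n hp.1 hp.2.1 hp.2.2.1
    simp only [mem_filter, mem_U]
    refine ⟨⟨?_, ?_, ?_⟩, trivial, hp.1⟩
    · linear_combination hp.2.2.1
    · omega
    · simp only [abs_le]; omega
  · rintro ⟨a, b, c, d⟩ hq
    simp only [mem_filter, mem_U] at hq
    obtain ⟨hU, h0, hu⟩ := hq
    refine Prod.ext ?_ (Prod.ext ?_ (Prod.ext ?_ ?_)) <;> dsimp only <;> omega
  · rintro ⟨⟨x, w⟩, t⟩ hg
    simp only [mem_sigma, mem_P1, mem_filter, mem_Icc] at hg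
    refine Sigma.ext (Prod.ext ?_ ?_) (heq_of_eq ?_) <;> dsimp only <;> omega
  · rintro ⟨a, b, c, d⟩ hq
    simp only [mem_filter, mem_U] at hq
    obtain ⟨hU, h0, hu⟩ := hq
    subst h0
    obtain ⟨h1, h2, h3⟩ := hU
    obtain ⟨r1, r2⟩ : 0 < b ∧ a * b = n := by
      have : a * b = n := by linarith
      exact ⟨by nlinarith, this⟩
    simp only [FF, Int.sign_zero]; rw [Int.sign_eq_one_of_pos r1]
    rw [show b - (b+d) = -d by ring, Int.sign_neg]; ring

lemma FF_ne {t1 t2 t3 t4 a b c d : ℤ} (h : FF t1 t2 t3 t4 a b c d ≠ 0) : a.sign * c.sign - d.sign * b.sign ≠ 0 := by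
  intro h0; apply h; unfold FF; rw [h0, mul_zero]

lemma F2_FF (x y b c : ℤ) : F2 x y b c = FF 1 1 (-3) 0 x (3*c+y) c (x-b) := by
  unfold F2 FF; ring

def F3 (x y b c : ℤ) : ℤ := (x+y)^2 * ((x-b).sign * (3*c+y).sign - (2*x-3*b).sign * (2*c+y).sign)

lemma F3_FF (x y b c : ℤ) : F3 x y b c = FF 1 (-2) 3 (-3) (3*b-2*x) (3*c+y) (2*c+y) (b-x) := by
  unfold F3 FF
  rw [show 3*b-2*x = -(2*x-3*b) by ring, show b - x = -(x-b) by ring, Int.sign_neg, Int.sign_neg]; ring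

lemma link2 (n L K : ℤ) (hn : 0 < n) (hL : 20 * n ≤ L) (hK : 1000 * (L * L + n) ≤ K) :
    SY n L K (fun x y b c => if c ≠ 0 then F2 x y b c else 0) =
    SU n L 1 1 (-3) 0 (fun a b c d => if c ≠ 0 then FF 1 1 (-3) 0 a b c d else 0) := by
  have hKn : 1000 * n ≤ K := by nlinarith
  have hL2 : L ≤ L * L := by nlinarith
  have e1 : SY n L K (fun x y b c => if c ≠ 0 then F2 x y b c else 0) = 
     ∑ q ∈ (Y n L K).filter (fun q => q.2.2.2 ≠ 0 ∧ F2 q.1 q.2.1 q.2.2.1 q.2.2.2 ≠ 0), F2 q.1 q.2.1 q.2.2.1 q.2.2.2 := by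
    unfold SY; rw [sum_filter]; refine sum_congr rfl fun q _ => ?_
    by_cases h1 : q.2.2.2 = 0 <;> by_cases h2 : F2 q.1 q.2.1 q.2.2.1 q.2.2.2 = 0 <;> simp [h1, h2]
  have e2 : SU n L 1 1 (-3) 0 (fun a b c d => if c ≠ 0 then FF 1 1 (-3) 0 a b c d else 0) = 
     ∑ q ∈ (U n L 1 1 (-3) 0).filter (fun q => q.2.2.1 ≠ 0 ∧ FF 1 1 (-3) 0 q.1 q.2.1 q.2.2.1 q.2.2.2 ≠ 0), FF 1 1 (-3) 0 q.1 q.2.1 q.2.2.1 q.2.2.2 := by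
    unfold SU; rw [sum_filter]; refine sum_congr rfl fun q _ => ?_
    by_cases h1 : q.2.2.1 = 0 <;> by_cases h2 : FF 1 1 (-3) 0 q.1 q.2.1 q.2.2.1 q.2.2.2 = 0 <;> simp [h1, h2]
  rw [e1, e2]
  refine sum_nbij' (fun q => (q.1, 3*q.2.2.2+q.2.1, q.2.2.2, q.1-q.2.2.1))
    (fun q => (q.1, q.2.1-3*q.2.2.1, q.1-q.2.2.2, q.2.2.1)) ?_ ?_ ?_ ?_ ?_
  · rintro ⟨x, y, b, c⟩ hq
    simp only [mem_filter, mem_Y, mem_U] at hq ⊢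
    obtain ⟨hY, hc, hF⟩ := hq
    rw [F2_FF] at hF
    have he : x*(3*c+y)-3*c*(x-b) = n := by linear_combination hY.1
    have h3 : ¬ 3 ∣ x - (3*c+y) := by have := hY.2.1; omega
    have hb := FF_bound n _ _ _ _ hn he h3 (FF_ne hF)
    refine ⟨⟨he, h3, ?_⟩, hc, hF⟩
    have ht := hY.2.2.1
    simp only [abs_le] at ht hb ⊢
    omega
  · rintro ⟨a, b, c, d⟩ hq
    simp only [mem_filter, mem_Y, mem_U] at hq ⊢
    obtain ⟨hU, hc, hF⟩ := hq
    refine ⟨?_, hc, ?_⟩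
    · refine ⟨by linear_combination hU.1, ?_⟩
      have := hU.2
      simp only [abs_le] at this ⊢
      omega
    · rw [F2_FF]; convert hF using 2 <;> ring
  · rintro ⟨x, y, b, c⟩ hq
    refine Prod.ext ?_ (Prod.ext ?_ (Prod.ext ?_ ?_)) <;> dsimp only <;> ring
  · rintro ⟨x, y, b, c⟩ hq
    refine Prod.ext ?_ (Prod.ext ?_ (Prod.ext ?_ ?_)) <;> dsimp only <;> ring
  · rintro ⟨x, y, b, c⟩ hq
    exact F2_FF x y b c

lemma link3 (n L K : ℤ) (hn : 0 < n) (hL : 20 * n ≤ L) (hK : 1000 * (L * L + n) ≤ K) :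
    SY n L K F3 = SU n L 1 (-2) 3 (-3) (FF 1 (-2) 3 (-3)) := by
  have hKn : 1000 * n ≤ K := by nlinarith
  have hL2 : L ≤ L * L := by nlinarith
  have e1 : SY n L K F3 = 
     ∑ q ∈ (Y n L K).filter (fun q => F3 q.1 q.2.1 q.2.2.1 q.2.2.2 ≠ 0), F3 q.1 q.2.1 q.2.2.1 q.2.2.2 := by
    unfold SY; rw [sum_filter]; refine sum_congr rfl fun q _ => ?_
    by_cases h2 : F3 q.1 q.2.1 q.2.2.1 q.2.2.2 = 0 <;> simp [h2]
  have e2 : SU n L 1 (-2) 3 (-3) (FF 1 (-2) 3 (-3)) = 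
     ∑ q ∈ (U n L 1 (-2) 3 (-3)).filter (fun q => FF 1 (-2) 3 (-3) q.1 q.2.1 q.2.2.1 q.2.2.2 ≠ 0), FF 1 (-2) 3 (-3) q.1 q.2.1 q.2.2.1 q.2.2.2 := by
    unfold SU; rw [sum_filter]; refine sum_congr rfl fun q _ => ?_
    by_cases h2 : FF 1 (-2) 3 (-3) q.1 q.2.1 q.2.2.1 q.2.2.2 = 0 <;> simp [h2]
  rw [e1, e2]
  refine sum_nbij' (fun q => (3*q.2.2.1-2*q.1, 3*q.2.2.2+q.2.1, 2*q.2.2.2+q.2.1, q.2.2.1-q.1))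
    (fun q => (q.1-3*q.2.2.2, 3*q.2.2.1-2*q.2.1, q.1-2*q.2.2.2, q.2.1-q.2.2.1)) ?_ ?_ ?_ ?_ ?_
  · rintro ⟨x, y, b, c⟩ hq
    simp only [mem_filter, mem_Y, mem_U] at hq ⊢
    obtain ⟨hY, hF⟩ := hq
    rw [F3_FF] at hF
    have he : (3*b-2*x)*(3*c+y)-3*(2*c+y)*(b-x) = n := by linear_combination hY.1
    have h3 : ¬ 3 ∣ (3*b-2*x) - (3*c+y) := by have := hY.2.1; omega
    have hb := FF_bound n _ _ _ _ hn he h3 (FF_ne hF)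
    refine ⟨⟨he, h3, ?_⟩, hF⟩
    have ht := hY.2.2.1
    simp only [abs_le] at ht hb ⊢
    omega
  · rintro ⟨a, b, c, d⟩ hq
    simp only [mem_filter, mem_Y, mem_U] at hq ⊢
    obtain ⟨hU, hF⟩ := hq
    refine ⟨?_, ?_⟩
    · refine ⟨by linear_combination hU.1, ?_⟩
      have := hU.2
      simp only [abs_le] at this ⊢
      omega
    · rw [F3_FF]; convert hF using 2 <;> ring
  · rintro ⟨x, y, b, c⟩ hq
    refine Prod.ext ?_ (Prod.ext ?_ (Prod.ext ?_ ?_)) <;> dsimp only <;> ring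
  · rintro ⟨x, y, b, c⟩ hq
    refine Prod.ext ?_ (Prod.ext ?_ (Prod.ext ?_ ?_)) <;> dsimp only <;> ring
  · rintro ⟨x, y, b, c⟩ hq
    exact F3_FF x y b c

lemma SU_c (n L t1 t2 t3 t4 : ℤ) :
    SU n L t1 t2 t3 t4 (fun a b c d => if c = 0 ∧ d ≠ 0 then FF t1 t2 t3 t4 a b c d else 0) =
    SU n L t1 t2 t3 t4 (fun a b c d => if c = 0 then FF t1 t2 t3 t4 a b c d else 0) := by
  unfold SU
  refine sum_congr rfl ?_
  rintro ⟨a, b, c, d⟩ _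
  by_cases h1 : c = 0 <;> by_cases h2 : d = 0 <;> simp [h1, h2, FF]

lemma SU_d (n L t1 t2 t3 t4 : ℤ) :
    SU n L t1 t2 t3 t4 (fun a b c d => if d = 0 ∧ c ≠ 0 then FF t1 t2 t3 t4 a b c d else 0) =
    SU n L t1 t2 t3 t4 (fun a b c d => if d = 0 then FF t1 t2 t3 t4 a b c d else 0) := by
  unfold SU
  refine sum_congr rfl ?_
  rintro ⟨a, b, c, d⟩ _
  by_cases h1 : c = 0 <;> by_cases h2 : d = 0 <;> simp [h1, h2, FF]

lemma SU_nc (n L t1 t2 t3 t4 : ℤ) :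
    SU n L t1 t2 t3 t4 (fun a b c d => if c ≠ 0 then FF t1 t2 t3 t4 a b c d else 0) =
    SU n L t1 t2 t3 t4 (FF t1 t2 t3 t4) - SU n L t1 t2 t3 t4 (fun a b c d => if c = 0 then FF t1 t2 t3 t4 a b c d else 0) := by
  unfold SU
  rw [← sum_sub_distrib]
  refine sum_congr rfl ?_
  rintro ⟨a, b, c, d⟩ _
  by_cases h1 : c = 0 <;> simp [h1]

lemma PP_sw1 (n : ℤ) (f : ℤ → ℤ → ℤ → ℤ → ℤ) :
    ∑ q ∈ PP n, f q.1 q.2.1 q.2.2.1 q.2.2.2 = ∑ q ∈ PP n, f q.2.1 q.1 q.2.2.1 q.2.2.2 := by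
  refine sum_nbij' (fun q => (q.2.1, q.1, q.2.2.1, q.2.2.2)) (fun q => (q.2.1, q.1, q.2.2.1, q.2.2.2)) ?_ ?_ ?_ ?_ ?_ <;>
  rintro ⟨x, C, c, X⟩ h <;> simp only [mem_PP] at h ⊢
  · exact ⟨h.2.1, h.1, h.2.2.1, h.2.2.2.1, by linarith [h.2.2.2.2.1], by omega⟩
  · exact ⟨h.2.1, h.1, h.2.2.1, h.2.2.2.1, by linarith [h.2.2.2.2.1], by omega⟩

lemma PP_sw2 (n : ℤ) (f : ℤ → ℤ → ℤ → ℤ → ℤ) :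
    ∑ q ∈ PP n, f q.1 q.2.1 q.2.2.1 q.2.2.2 = ∑ q ∈ PP n, f q.1 q.2.1 q.2.2.2 q.2.2.1 := by
  refine sum_nbij' (fun q => (q.1, q.2.1, q.2.2.2, q.2.2.1)) (fun q => (q.1, q.2.1, q.2.2.2, q.2.2.1)) ?_ ?_ ?_ ?_ ?_ <;>
  rintro ⟨x, C, c, X⟩ h <;> simp only [mem_PP] at h ⊢
  · exact ⟨h.1, h.2.1, h.2.2.2.1, h.2.2.1, by linarith [h.2.2.2.2.1], h.2.2.2.2.2⟩
  · exact ⟨h.1, h.2.1, h.2.2.2.1, h.2.2.1, by linarith [h.2.2.2.2.1], h.2.2.2.2.2⟩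

lemma E2 (n L : ℤ) (hn : 0 < n) (hL : 20 * n ≤ L) :
    SU n L 1 1 (-3) 0 (fun a b c d => if 0 < a * b ∧ c * d < 0 then FF 1 1 (-3) 0 a b c d else 0) = -96 * ∑ q ∈ PP n, q.1 * q.2.2.1 := by
  rw [SU_E n L _ _ _ _ hn hL (by norm_num) (by norm_num) (by norm_num) (by norm_num)]
  have h1 := PP_sw1 n (fun x C c X => x * c)
  have : ∑ q ∈ PP n, (1*q.1+1*q.2.1)*(-3*q.2.2.1-0*q.2.2.2) = -3 * ∑ q ∈ PP n, q.1 * q.2.2.1 - 3 * ∑ q ∈ PP n, q.2.1 * q.2.2.1 := by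
    rw [mul_sum, mul_sum, ← sum_sub_distrib]; refine sum_congr rfl fun q _ => by ring
  rw [this, ← h1]; ring

lemma E3 (n L : ℤ) (hn : 0 < n) (hL : 20 * n ≤ L) :
    SU n L 1 (-2) 3 (-3) (fun a b c d => if 0 < a * b ∧ c * d < 0 then FF 1 (-2) 3 (-3) a b c d else 0) = -96 * ∑ q ∈ PP n, q.1 * q.2.2.1 := by
  rw [SU_E n L _ _ _ _ hn hL (by norm_num) (by norm_num) (by norm_num) (by norm_num)]
  have h1 := PP_sw1 n (fun x C c X => x * c)
  have h2 := PP_sw2 n (fun x C c X => x * c)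
  have h3 := PP_sw1 n (fun x C c X => x * X)
  have : ∑ q ∈ PP n, (1*q.1+(-2)*q.2.1)*(3*q.2.2.1-(-3)*q.2.2.2) = 3 * ∑ q ∈ PP n, q.1 * q.2.2.1 + 3 * ∑ q ∈ PP n, q.1 * q.2.2.2
     - 6 * ∑ q ∈ PP n, q.2.1 * q.2.2.1 - 6 * ∑ q ∈ PP n, q.2.1 * q.2.2.2 := by
    simp only [mul_sum, ← sum_sub_distrib, ← sum_add_distrib]; refine sum_congr rfl fun q _ => by ring
  rw [this, ← h1, ← h3, ← h2]; ring

theorem SYfgi (n N L K : ℤ) (hN : n = 3 * N) (hn : 0 < n) (hL : 20 * n ≤ L) (hK : 1000 * (L * L + n) ≤ K) :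
    12 * SY n L K fgi = -576 * ∑ q ∈ PP n, q.1 * q.2.2.1
      + ∑ p ∈ P1 n, (12 * (p.1+p.2)^2 * |p.1-p.2| - 8 * (p.1+p.2)^3 + 8 * (2*n*p.1-2*n*p.2+2*p.2^3+3*p.2))
      + ∑ p ∈ P0 N, (16 * (12*p.1^3-2*p.1) + 4 * (6*(p.1+p.2)^3 - 4*(p.1+p.2)) - 4*(12*(p.1+p.2)^3 - 2*(p.1+p.2))) := by
  have m := main12 n L K hn
  have f1 : SY n L K (fun x y b c => (x+y)^2 * (phi (x-y) b c - 2 * (x.sign * c.sign))) = 4 * ∑ p ∈ P1 n, (p.1+p.2)^2 * |p.1-p.2| :=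
    F1_sum n L K hn hL hK
  have f2 : SY n L K (fun x y b c => (x+y)^2 * (x.sign * c.sign - (x-b).sign * (3*c+y).sign)) = 
      SY n L K (fun x y b c => if c = 0 then F2 x y b c else 0) + SY n L K (fun x y b c => if c ≠ 0 then F2 x y b c else 0) := by
    unfold SY; rw [← sum_add_distrib]
    refine sum_congr rfl ?_
    rintro ⟨x, y, b, c⟩ _
    by_cases h : c = 0 <;> simp [h, F2]
  have f3 : SY n L K (fun x y b c => (x+y)^2 * ((x-b).sign * (3*c+y).sign - (2*x-3*b).sign * (2*c+y).sign)) = SU n L 1 (-2) 3 (-3) (FF 1 (-2) 3 (-3)) :=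
    link3 n L K hn hL hK
  rw [f1, f2, f3, F2_c0 n L K hn hL hK, link2 n L K hn hL hK, SU_nc, SU_split n L _ _ _ _ hn, SU_split n L _ _ _ _ hn, SU_c, SU_d, SU_c, SU_d,
    E2 n L hn hL, E3 n L hn hL, pA2 n N L hN hn hL, pB2 n N L hN hn hL, pA3 n N L hN hn hL, pB3 n N L hN hn hL, pD2 n L hn hL, pD3 n L hn hL, pC3 n L hn hL] at m
  have a1 : ∑ p ∈ P0 N, ∑ t ∈ (Icc (-L) L).filter (fun t => ¬ 3 ∣ t), (t+3*p.1).sign * t^2 = ∑ p ∈ P0 N, (12*p.1^3 - 2*p.1) := by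
    refine sum_congr rfl ?_
    rintro ⟨x, w⟩ hp
    rw [mem_P0] at hp
    have := pb x w N hp.1 hp.2.1 hp.2.2
    exact s1 L x hp.1 (by omega)
  have a2 : ∑ p ∈ P0 N, ∑ t ∈ (Icc (-L) L).filter (fun t => t % 2 = (p.1+p.2) % 2 ∧ ¬ 3 ∣ t), (3*(p.1+p.2)-t).sign * t^2 = ∑ p ∈ P0 N, (6*(p.1+p.2)^3 - 4*(p.1+p.2)) := by
    refine sum_congr rfl ?_
    rintro ⟨x, w⟩ hp
    rw [mem_P0] at hp
    have := pb x w N hp.1 hp.2.1 hp.2.2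
    exact s2 L (x+w) (by omega) (by omega)
  have a3 : ∑ p ∈ P0 N, ∑ t ∈ (Icc (-L) L).filter (fun t => ¬ 3 ∣ t), (t-3*(p.1+p.2)).sign * t^2 = ∑ p ∈ P0 N, (-(12*(p.1+p.2)^3 - 2*(p.1+p.2))) := by
    refine sum_congr rfl ?_
    rintro ⟨x, w⟩ hp
    rw [mem_P0] at hp
    have := pb x w N hp.1 hp.2.1 hp.2.2
    exact s3 L (x+w) (by omega) (by omega)
  have a4 : ∑ p ∈ P1 n, ∑ t ∈ (Icc (-(2*L)) (2*L)).filter (fun t => |p.1+p.2-3*t| ≤ L), t.sign * (p.1+p.2-3*t)^2 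
     + ∑ p ∈ P1 n, ∑ t ∈ (Icc (-(2*L)) (2*L)).filter (fun t => |p.1+p.2-3*t| ≤ L), (p.2-t).sign * (p.1+p.2-3*t)^2
     = ∑ p ∈ P1 n, (2*n*p.1-2*n*p.2+2*p.2^3+3*p.2) := by
    rw [← sum_add_distrib]
    refine sum_congr rfl ?_
    rintro ⟨x, w⟩ hp
    rw [mem_P1] at hp
    have := pb x w n hp.1 hp.2.1 hp.2.2.1
    rw [← sum_add_distrib]
    simp only [← add_mul]
    rw [s4 (2*L) L x w hp.1 hp.2.1 (by omega) (by omega), hp.2.2.1]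
  rw [a1, a2, a3] at m
  rw [m]
  simp only [sum_add_distrib, sum_sub_distrib, sum_neg_distrib, mul_sub, mul_add, mul_assoc, ← mul_sum] at a4 ⊢
  linarith

def Bs (n : ℕ) : Finset ℕ := n.divisors.filter (fun d => 3 ∣ d ∧ 3 ∣ n / d)

lemma Bs_sub (n : ℕ) : Bs n ⊆ n.divisors := filter_subset _ _

lemma mem_dv (n d : ℕ) (hn : 0 < n) (h : d ∈ n.divisors) : 0 < d ∧ 0 < n / d ∧ d * (n / d) = n := by
  have h1 := Nat.dvd_of_mem_divisors h
  exact ⟨Nat.pos_of_mem_divisors h, Nat.div_pos (Nat.le_of_dvd hn h1) (Nat.pos_of_mem_divisors h), Nat.mul_div_cancel' h1⟩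

lemma P0_dv (n : ℕ) (hn : 0 < n) (f : ℤ → ℤ → ℤ) :
    ∑ p ∈ P0 (n:ℤ), f p.1 p.2 = ∑ d ∈ n.divisors, f (d:ℤ) ((n / d : ℕ) : ℤ) := by
  symm
  refine sum_bij (fun d _ => ((d:ℤ), ((n / d : ℕ) : ℤ))) ?_ ?_ ?_ ?_
  · intro d hd
    obtain ⟨h1, h2, h3⟩ := mem_dv n d hn hd
    rw [mem_P0]
    exact ⟨by exact_mod_cast h1, by exact_mod_cast h2, by exact_mod_cast h3⟩
  · intro a _ b _ h
    have := (Prod.mk.inj h).1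
    exact_mod_cast this
  · rintro ⟨x, w⟩ h
    rw [mem_P0] at h
    obtain ⟨h1, h2, h3⟩ := h
    lift x to ℕ using h1.le
    lift w to ℕ using h2.le
    have h3' : x * w = n := by exact_mod_cast h3
    have h1' : 0 < x := by exact_mod_cast h1
    refine ⟨x, ?_, ?_⟩
    · rw [Nat.mem_divisors]; exact ⟨⟨w, h3'.symm⟩, by omega⟩
    · have : n / x = w := by rw [← h3']; exact Nat.mul_div_cancel_left w h1'
      simp only [this]
  · intro d hd; rfl

lemma dvB (n d : ℕ) (hn : 0 < n) (h3 : 3 ∣ n) (h : d ∈ n.divisors) :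
    ((3:ℤ) ∣ (d:ℤ) - ((n / d : ℕ) : ℤ)) ↔ (3 ∣ d ∧ 3 ∣ n / d) := by
  obtain ⟨_, _, h1⟩ := mem_dv n d hn h
  rw [← h1] at h3
  have := (Nat.Prime.dvd_mul Nat.prime_three).1 h3
  generalize n / d = e at *
  omega

lemma P1_dv (n : ℕ) (hn : 0 < n) (h3 : 3 ∣ n) (f : ℤ → ℤ → ℤ) :
    ∑ p ∈ P1 (n:ℤ), f p.1 p.2 = ∑ d ∈ n.divisors, f (d:ℤ) ((n / d : ℕ) : ℤ) - ∑ d ∈ Bs n, f (d:ℤ) ((n / d : ℕ) : ℤ) := by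
  have h0 : ∑ p ∈ P1 (n:ℤ), f p.1 p.2 = ∑ p ∈ P0 (n:ℤ), if ¬ (3:ℤ) ∣ p.1 - p.2 then f p.1 p.2 else 0 := by
    rw [← sum_filter]
    refine sum_congr ?_ fun _ _ => rfl
    ext ⟨x, w⟩
    rw [mem_filter, mem_P0, mem_P1]; tauto
  rw [h0, P0_dv n hn (fun x y => if ¬ (3:ℤ) ∣ x - y then f x y else 0), Bs, sum_filter, ← sum_sub_distrib]
  refine sum_congr rfl fun d hd => ?_
  have := dvB n d hn h3 hd
  by_cases h : 3 ∣ d ∧ 3 ∣ n / d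
  · rw [if_neg (not_not.2 (this.2 h)), if_pos h]; ring
  · rw [if_pos (fun hh => h (this.1 hh)), if_neg h]; ring

lemma D1 (N : ℕ) (hN : 0 < N) :
    (4:ℝ) * ∑ d ∈ N.divisors, (d:ℝ) = ∑ d ∈ (3*N).divisors, (d:ℝ) + ∑ d ∈ Bs (3*N), (d:ℝ) := by
  have a1 : N.divisors = (3*N).divisors.filter (fun d => 3 ∣ (3*N) / d) := by
    ext d
    rw [mem_filter, Nat.mem_divisors, Nat.mem_divisors]
    constructor
    · rintro ⟨⟨k, rfl⟩, h⟩
      have : 0 < d := Nat.pos_of_ne_zero (by rintro rfl; simp at h)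
      refine ⟨⟨⟨3*k, by ring⟩, by omega⟩, ⟨k, ?_⟩⟩
      rw [show 3 * (d * k) = d * (3 * k) by ring, Nat.mul_div_cancel_left _ this]
    · rintro ⟨⟨⟨k, hk⟩, h⟩, h2⟩
      have : 0 < d := Nat.pos_of_ne_zero (by rintro rfl; simp at hk; omega)
      rw [hk, Nat.mul_div_cancel_left _ this] at h2
      obtain ⟨j, rfl⟩ := h2
      refine ⟨⟨j, ?_⟩, hN.ne'⟩
      have : 3 * N = 3 * (d * j) := by rw [hk]; ring
      omega
  have a2 : ∑ d ∈ (3*N).divisors.filter (fun d => 3 ∣ d), (d:ℝ) = 3 * ∑ d ∈ N.divisors, (d:ℝ) := by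
    rw [mul_sum]; symm
    refine sum_bij (fun d _ => 3 * d) ?_ ?_ ?_ ?_
    · intro d hd
      rw [Nat.mem_divisors] at hd
      rw [mem_filter, Nat.mem_divisors]
      exact ⟨⟨Nat.mul_dvd_mul_left 3 hd.1, by omega⟩, ⟨d, rfl⟩⟩
    · intro a _ b _ h
      have h' : 3 * a = 3 * b := h
      omega
    · intro d hd
      rw [mem_filter, Nat.mem_divisors] at hd
      obtain ⟨⟨h1, _⟩, ⟨e, rfl⟩⟩ := hd
      refine ⟨e, ?_, rfl⟩
      rw [Nat.mem_divisors]
      exact ⟨Nat.dvd_of_mul_dvd_mul_left (by norm_num) h1, hN.ne'⟩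
    · intro d _; push_cast; ring
  have a3 : ∑ d ∈ (3*N).divisors.filter (fun d => 3 ∣ (3*N) / d), (d:ℝ) + ∑ d ∈ (3*N).divisors.filter (fun d => 3 ∣ d), (d:ℝ)
      = ∑ d ∈ (3*N).divisors, (d:ℝ) + ∑ d ∈ Bs (3*N), (d:ℝ) := by
    rw [Bs, sum_filter, sum_filter, sum_filter, ← sum_add_distrib, ← sum_add_distrib]
    refine sum_congr rfl fun d hd => ?_
    obtain ⟨_, _, h1⟩ := mem_dv (3*N) d (by omega) hd
    have h3 : 3 ∣ d * (3*N/d) := by rw [h1]; exact ⟨N, rfl⟩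
    have := (Nat.Prime.dvd_mul Nat.prime_three).1 h3
    by_cases p : 3 ∣ d <;> by_cases q : 3 ∣ 3*N/d <;> simp [p, q] <;> tauto
  rw [← a3, a2, ← a1]; ring

lemma D2 (n : ℕ) (hn : 0 < n) (S : Finset ℕ) (hS : S ⊆ n.divisors) (hc : ∀ d ∈ S, n / d ∈ S) (g : ℕ → ℝ) :
    ∑ d ∈ S, g (min d (n / d)) = 2 * ∑ d ∈ S.filter (fun d => d^2 < n), g d + ∑ d ∈ S.filter (fun d => d^2 = n), g d := by
  have b1 : ∑ d ∈ S.filter (fun d => n < d^2), g (n / d) = ∑ d ∈ S.filter (fun d => d^2 < n), g d := by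
    refine sum_nbij' (fun d => n / d) (fun d => n / d) ?_ ?_ ?_ ?_ ?_
    · intro d hd
      rw [mem_filter] at hd ⊢
      obtain ⟨p, q, r⟩ := mem_dv n d hn (hS hd.1)
      refine ⟨hc d hd.1, ?_⟩
      have := hd.2
      generalize n / d = e at *
      subst r
      nlinarith
    · intro d hd
      rw [mem_filter] at hd ⊢
      obtain ⟨p, q, r⟩ := mem_dv n d hn (hS hd.1)
      refine ⟨hc d hd.1, ?_⟩
      have := hd.2
      generalize n / d = e at *
      subst r
      nlinarith
    · intro d hd
      exact Nat.div_div_self (Nat.dvd_of_mem_divisors (hS (mem_filter.1 hd).1)) hn.ne'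
    · intro d hd
      exact Nat.div_div_self (Nat.dvd_of_mem_divisors (hS (mem_filter.1 hd).1)) hn.ne'
    · intro d _; rfl
  have : (2:ℝ) * ∑ d ∈ S.filter (fun d => d^2 < n), g d = ∑ d ∈ S.filter (fun d => d^2 < n), g d + ∑ d ∈ S.filter (fun d => n < d^2), g (n / d) := by
    rw [b1]; ring
  rw [this, sum_filter, sum_filter, sum_filter, ← sum_add_distrib, ← sum_add_distrib]
  refine sum_congr rfl fun d hd => ?_
  obtain ⟨p, q, r⟩ := mem_dv n d hn (hS hd)
  generalize n / d = e at *
  rcases lt_trichotomy (d^2) n with h | h | h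
  · rw [if_pos h, if_neg (by omega), if_neg (by omega), min_eq_left (by subst r; nlinarith)]; ring
  · rw [if_pos h, if_neg (by omega), if_neg (by omega), min_eq_left (by subst r; nlinarith)]; ring
  · rw [if_pos h, if_neg (by omega), if_neg (by omega), min_eq_right (by subst r; nlinarith)]; ring

lemma dvc (n : ℕ) : ∀ d ∈ n.divisors, n / d ∈ n.divisors := by
  intro d hd
  rw [Nat.mem_divisors] at hd ⊢
  exact ⟨Nat.div_dvd_of_dvd hd.1, hd.2⟩

lemma Bsc (n : ℕ) : ∀ d ∈ Bs n, n / d ∈ Bs n := by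
  intro d hd
  rw [Bs, mem_filter] at hd ⊢
  have h1 := Nat.mem_divisors.1 hd.1
  exact ⟨dvc n d hd.1, hd.2.2, by rw [Nat.div_div_self h1.1 h1.2]; exact hd.2.1⟩

lemma D3 (n : ℕ) (hn : 0 < n) :
    (3:ℝ) * (if 9 ∣ n then (1:ℝ) else 0) * ∑ d ∈ (n/9).divisors.filter (fun d => d^2 < n/9), (d:ℝ)
     = ∑ d ∈ (Bs n).filter (fun d => d^2 < n), (d:ℝ) := by
  by_cases h9 : 9 ∣ n
  · obtain ⟨k, rfl⟩ := h9
    rw [if_pos ⟨k, rfl⟩, Nat.mul_div_cancel_left k (by norm_num), mul_one, mul_sum]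
    refine sum_bij (fun d _ => 3 * d) ?_ ?_ ?_ ?_
    · intro d hd
      rw [mem_filter, Nat.mem_divisors] at hd
      obtain ⟨⟨⟨j, rfl⟩, h⟩, h2⟩ := hd
      have : 0 < d := Nat.pos_of_ne_zero (by rintro rfl; simp at h)
      rw [mem_filter, Bs, mem_filter, Nat.mem_divisors]
      refine ⟨⟨⟨⟨3*j, by ring⟩, by omega⟩, ⟨d, rfl⟩, ⟨j, ?_⟩⟩, by nlinarith⟩
      rw [show 9 * (d * j) = (3*d) * (3 * j) by ring, Nat.mul_div_cancel_left _ (by omega)]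
    · intro a _ b _ h
      have h' : 3 * a = 3 * b := h
      omega
    · intro d hd
      rw [mem_filter, Bs, mem_filter] at hd
      obtain ⟨⟨h1, ⟨a, rfl⟩, ⟨b, hb⟩⟩, h2⟩ := hd
      obtain ⟨p, q, r⟩ := mem_dv _ _ hn h1
      rw [hb] at r
      have r' : 9 * (a * b) = 9 * k := by rw [← r]; ring
      refine ⟨a, ?_, rfl⟩
      rw [mem_filter, Nat.mem_divisors]
      refine ⟨⟨⟨b, by omega⟩, by omega⟩, by nlinarith⟩
    · intro d _; push_cast; ring
  · rw [if_neg h9]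
    have : Bs n = ∅ := by
      rw [Finset.eq_empty_iff_forall_notMem]
      intro d hd
      rw [Bs, mem_filter] at hd
      obtain ⟨p, q, r⟩ := mem_dv _ _ hn hd.1
      apply h9; rw [← r]
      exact Nat.mul_dvd_mul hd.2.1 hd.2.2
    rw [this]; simp

lemma D4 (n : ℕ) (hn : 0 < n) (h3 : 3 ∣ n) : (Bs n).filter (fun d => d^2 = n) = n.divisors.filter (fun d => d^2 = n) := by
  ext d
  rw [mem_filter, mem_filter, Bs, mem_filter]
  constructor
  · tauto
  · rintro ⟨h1, h2⟩
    have h4 : 3 ∣ d := Nat.Prime.dvd_of_dvd_pow Nat.prime_three (h2 ▸ h3)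
    obtain ⟨p, q, r⟩ := mem_dv _ _ hn h1
    have : n / d = d := by
      rw [← h2, pow_two]; exact Nat.mul_div_cancel_left _ p
    exact ⟨⟨h1, h4, by rw [this]; exact h4⟩, h2⟩

lemma D5 (n : ℕ) (hn : 0 < n) :
   (n : ℝ) ^ ((3 : ℝ) / 2) / 2 * (if IsSquare n then (1 : ℝ) else 0) = (n:ℝ) / 2 * ∑ d ∈ n.divisors.filter (fun d => d^2 = n), (d:ℝ) := by
  by_cases h : IsSquare n
  · obtain ⟨r, rfl⟩ := h
    have hr : 0 < r := Nat.pos_of_ne_zero (by rintro rfl; simp at hn)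
    have : (r*r).divisors.filter (fun d => d^2 = r*r) = {r} := by
      ext d
      rw [mem_filter, Nat.mem_divisors, mem_singleton]
      constructor
      · rintro ⟨_, h⟩; nlinarith
      · rintro rfl; exact ⟨⟨⟨d, rfl⟩, hn.ne'⟩, by ring⟩
    rw [this, sum_singleton, if_pos ⟨r, rfl⟩]
    have e : ((r * r : ℕ) : ℝ) ^ ((3 : ℝ) / 2) = (r:ℝ)^3 := by
      rw [show ((r * r : ℕ) : ℝ) = (r:ℝ)^(2:ℝ) by rw [Real.rpow_two]; push_cast; ring, ← Real.rpow_mul (by positivity)]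
      rw [show (2:ℝ) * (3/2) = ((3:ℕ):ℝ) by norm_num, Real.rpow_natCast]
    rw [e]; push_cast; ring
  · have : n.divisors.filter (fun d => d^2 = n) = ∅ := by
      rw [Finset.eq_empty_iff_forall_notMem]
      intro d hd
      rw [mem_filter] at hd
      exact h ⟨d, by rw [← hd.2]; ring⟩
    rw [this, if_neg h]; simp

lemma SYfin (n N L K : ℤ) (hN : n = 3 * N) (hn : 0 < n) (hL : 20 * n ≤ L) (hK : 1000 * (L * L + n) ≤ K) :
    SY n L K fgi = 2 * ∑ p ∈ P1 n, (n * p.1 - (min p.1 p.2)^3 - n * min p.1 p.2) + 4 * n * ∑ p ∈ P0 N, p.1 := by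
  have h := SYfgi n N L K hN hn hL hK
  have z := Z_eval n N hN
  set Z := ∑ q ∈ PP n, q.1 * q.2.2.1
  have e1 : ∑ p ∈ P1 n, (12*(p.1+p.2)^2*|p.1-p.2| - 8*(p.1+p.2)^3 + 8*(2*n*p.1-2*n*p.2+2*p.2^3+3*p.2)) - 24 * ∑ p ∈ P1 n, (p.2^3+p.2-2*n*p.2)
     = 24 * ∑ p ∈ P1 n, (n * p.1 - (min p.1 p.2)^3 - n * min p.1 p.2) := by
    have s := P1_swap n (fun x y => 12*(x+y)^2*|x-y| - 8*(x+y)^3 + 8*(2*n*x-2*n*y+2*y^3+3*y) - 24*(y^3+y-2*n*y) + 12*n*(y-x))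
    have s2 := P1_swap n (fun x y => 12*n*(y-x))
    have s3 : ∑ q ∈ P1 n, (12*n*(q.2-q.1)) = - ∑ q ∈ P1 n, (12*n*(q.1-q.2)) := by
      rw [← sum_neg_distrib]; refine sum_congr rfl fun q _ => by ring
    have s4 : ∑ q ∈ P1 n, (12*n*(q.2-q.1)) = 0 := by
      have : ∑ q ∈ P1 n, (12*n*(q.2-q.1)) = ∑ q ∈ P1 n, (12*n*(q.1-q.2)) := s2
      linarith
    have s5 : 2 * ∑ p ∈ P1 n, (12*(p.1+p.2)^2*|p.1-p.2| - 8*(p.1+p.2)^3 + 8*(2*n*p.1-2*n*p.2+2*p.2^3+3*p.2) - 24*(p.2^3+p.2-2*n*p.2) + 12*n*(p.2-p.1))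
      = 48 * ∑ p ∈ P1 n, (n * p.1 - (min p.1 p.2)^3 - n * min p.1 p.2) + 2 * ∑ q ∈ P1 n, (12*n*(q.2-q.1)) := by
      rw [two_mul]; nth_rw 2 [s]
      rw [← sum_add_distrib, mul_sum, mul_sum, ← sum_add_distrib]
      refine sum_congr rfl ?_
      rintro ⟨x, y⟩ hp
      rw [mem_P1] at hp
      obtain ⟨hx, hy, hxy, _⟩ := hp
      simp only
      rcases le_total x y with hle | hle
      · rw [min_eq_left hle, abs_of_nonpos (by linarith), abs_of_nonneg (by linarith)]
        subst hxy; ring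
      · rw [min_eq_right hle, abs_of_nonneg (by linarith), abs_of_nonpos (by linarith)]
        subst hxy; ring
    rw [sum_add_distrib, sum_sub_distrib, ← mul_sum] at s5
    linarith
  have e2 : ∑ p ∈ P0 N, (16*(12*p.1^3-2*p.1)+4*(6*(p.1+p.2)^3-4*(p.1+p.2))-4*(12*(p.1+p.2)^3-2*(p.1+p.2))) - 24 * ∑ p ∈ P0 N, (6*p.2^3-12*N*p.2-2*p.2)
     = 144 * N * ∑ p ∈ P0 N, p.1 := by
    have s := P0_swap N (fun x y => 168 * y^3 - 216 * N * y - 40 * y)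
    have s1 : ∑ q ∈ P0 N, (168 * q.2^3 - 216 * N * q.2 - 40 * q.2) = ∑ q ∈ P0 N, (168 * q.1^3 - 216 * N * q.1 - 40 * q.1) := s
    have : ∑ p ∈ P0 N, (16*(12*p.1^3-2*p.1)+4*(6*(p.1+p.2)^3-4*(p.1+p.2))-4*(12*(p.1+p.2)^3-2*(p.1+p.2))) - 24 * ∑ p ∈ P0 N, (6*p.2^3-12*N*p.2-2*p.2)
      = ∑ q ∈ P0 N, (168 * q.1^3 - 216 * N * q.1 - 40 * q.1) - ∑ q ∈ P0 N, (168 * q.2^3 - 216 * N * q.2 - 40 * q.2) + 144 * N * ∑ p ∈ P0 N, p.1 := by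
      rw [mul_sum, mul_sum, ← sum_sub_distrib, ← sum_sub_distrib, ← sum_add_distrib]
      refine sum_congr rfl ?_
      rintro ⟨x, y⟩ hp
      rw [mem_P0] at hp
      obtain ⟨hx, hy, hxy⟩ := hp
      subst hxy; ring
    rw [this, s1]; ring
  have : 12 * SY n L K fgi = 24 * ∑ p ∈ P1 n, (n * p.1 - (min p.1 p.2)^3 - n * min p.1 p.2) + 144 * N * ∑ p ∈ P0 N, p.1 := by
    rw [← e1, ← e2, h]; linarith
  have hN' : 144 * N * ∑ p ∈ P0 N, p.1 = 48 * n * ∑ p ∈ P0 N, p.1 := by rw [hN]; ring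
  have h4 : 12 * (4 * n * ∑ p ∈ P0 N, p.1) = 48 * n * ∑ p ∈ P0 N, p.1 := by ring
  linarith

lemma HHfin (m : ℤ) (hm : m = 1 ∨ m = 2) (n : ℕ) (hn : 0 < n) (h3 : 3 ∣ n) :
    HH 2 m 3 n = n * ∑ d ∈ (n/3).divisors, (d:ℝ)
      + (n * ∑ d ∈ n.divisors, (d:ℝ) - ∑ d ∈ n.divisors, ((min d (n / d) : ℕ) : ℝ)^3 - n * ∑ d ∈ n.divisors, ((min d (n / d) : ℕ) : ℝ)) / 2
      - (n * ∑ d ∈ Bs n, (d:ℝ) - ∑ d ∈ Bs n, ((min d (n / d) : ℕ) : ℝ)^3 - n * ∑ d ∈ Bs n, ((min d (n / d) : ℕ) : ℝ)) / 2 := by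
  have h := HH_SY m hm n hn h3 (20 * n) _ le_rfl le_rfl
  have hN : (n:ℤ) = 3 * ((n/3 : ℕ) : ℤ) := by omega
  rw [SYfin n ((n/3 : ℕ) : ℤ) (20 * n) _ hN (by exact_mod_cast hn) le_rfl le_rfl,
    P1_dv n hn h3 (fun x y => n * x - (min x y)^3 - n * min x y), P0_dv (n/3) (by omega) (fun x _ => x)] at h
  have key : ∀ S : Finset ℕ, ((∑ d ∈ S, ((n:ℤ) * (d:ℤ) - (min (d:ℤ) ((n/d : ℕ):ℤ))^3 - n * min (d:ℤ) ((n/d : ℕ):ℤ)) : ℤ) : ℝ)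
     = (n * ∑ d ∈ S, (d:ℝ) - ∑ d ∈ S, ((min d (n / d) : ℕ) : ℝ)^3 - n * ∑ d ∈ S, ((min d (n / d) : ℕ) : ℝ)) := by
    intro S
    rw [mul_sum, mul_sum, ← sum_sub_distrib, ← sum_sub_distrib, Int.cast_sum]
    refine sum_congr rfl fun d _ => ?_
    generalize n / d = e
    push_cast; ring
  rw [Int.cast_add, Int.cast_mul, Int.cast_sub, key, key] at h
  push_cast at h ⊢
  linarith

lemma final (m : ℤ) (hm : m = 1 ∨ m = 2)
    (n : ℕ) (hn : 0 < n) (h3 : 3 ∣ n) :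
    HH 2 m 3 n =
      -((∑ d ∈ n.divisors.filter (fun d => d ^ 2 < n), (d : ℝ) ^ 3)
          - (∑ d ∈ n.divisors.filter (fun d => d ^ 2 < n ∧ 3 ∣ d ∧ 3 ∣ n / d), (d : ℝ) ^ 3))
      + (n : ℝ) * ((∑ d ∈ n.divisors, (d : ℝ)) - (∑ d ∈ (n / 3).divisors, (d : ℝ)))
      - (n : ℝ) / 2 * (∑ d ∈ n.divisors, (min d (n / d) : ℝ))
      + 3 * (n : ℝ) * (if 9 ∣ n then (1 : ℝ) else 0) *
          (∑ d ∈ (n / 9).divisors.filter (fun d => d ^ 2 < n / 9), (d : ℝ))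
      + (n : ℝ) ^ ((3 : ℝ) / 2) / 2 * (if IsSquare n then (1 : ℝ) else 0) := by
  have c1 : n.divisors.filter (fun d => d ^ 2 < n ∧ 3 ∣ d ∧ 3 ∣ n / d) = (Bs n).filter (fun d => d^2 < n) := by
    ext d; simp only [Bs, mem_filter]; tauto
  have c2 : (∑ d ∈ n.divisors, (min d (n / d) : ℝ)) = ∑ d ∈ n.divisors, ((min d (n / d) : ℕ) : ℝ) := by
    refine sum_congr rfl fun d hd => ?_
    rw [Nat.cast_min, Nat.cast_div (Nat.dvd_of_mem_divisors hd)]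
    exact_mod_cast (Nat.pos_of_mem_divisors hd).ne'
  have d1 := D1 (n/3) (by omega)
  rw [Nat.mul_div_cancel' h3] at d1
  have d3 := D3 n hn
  have d4 := D4 n hn h3
  have p1 := D2 n hn _ (Finset.Subset.refl _) (dvc n) (fun d => (d:ℝ)^3)
  have p2 := D2 n hn _ (Bs_sub n) (Bsc n) (fun d => (d:ℝ)^3)
  have p4 := D2 n hn _ (Bs_sub n) (Bsc n) (fun d => (d:ℝ))
  rw [d4] at p2 p4
  rw [HHfin m hm n hn h3, c1, c2, D5 n hn, p1, p2, p4,
    show ∀ A B : ℝ, 3 * (n:ℝ) * A * B = n * (3 * A * B) from fun A B => by ring, d3]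
  have d1' : (n:ℝ) * (4 * ∑ d ∈ (n/3).divisors, (d:ℝ)) = n * (∑ d ∈ n.divisors, (d:ℝ) + ∑ d ∈ Bs n, (d:ℝ)) := by rw [d1]
  linear_combination d1' / 2

end Helpers

/-- Theorem 1.1 (2), case `m ∈ {1,2}`:
for `3 ∣ n`,
`H_{2,m,3}(n) = -(∑_{d∣n, d²<n} d³ - ∑_{d∣n, d²<n, 3∣d, 3∣(n/d)} d³)`
`+ n(σ(n) - σ(n/3)) - (n/2) ∑_{d∣n} min(d, n/d)`
`+ 3n δ_{9∣n} ∑_{d∣(n/9), d²<n/9} d + (n^{3/2}/2) δ_{n=□}`. -/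
theorem second_moment_m_ne_zero_three_dvd (m : ℤ) (hm : m = 1 ∨ m = 2)
    (n : ℕ) (hn : 0 < n) (h3 : 3 ∣ n) :
    HH 2 m 3 n =
      -((∑ d ∈ n.divisors.filter (fun d => d ^ 2 < n), (d : ℝ) ^ 3)
          - (∑ d ∈ n.divisors.filter (fun d => d ^ 2 < n ∧ 3 ∣ d ∧ 3 ∣ n / d), (d : ℝ) ^ 3))
      + (n : ℝ) * ((∑ d ∈ n.divisors, (d : ℝ)) - (∑ d ∈ (n / 3).divisors, (d : ℝ)))
      - (n : ℝ) / 2 * (∑ d ∈ n.divisors, (min d (n / d) : ℝ))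
      + 3 * (n : ℝ) * (if 9 ∣ n then (1 : ℝ) else 0) *
          (∑ d ∈ (n / 9).divisors.filter (fun d => d ^ 2 < n / 9), (d : ℝ))
      + (n : ℝ) ^ ((3 : ℝ) / 2) / 2 * (if IsSquare n then (1 : ℝ) else 0) := by
  exact final m hm n hn h3

end HurwitzPaper
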